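/- arXiv:2011.10816 — 7 statements merged into one kernel-verified Lean document; each statement's English description precedes it below -/
import Mathlib

section
/- Let c ∈ ℝ² and 0 < r < R. If h is harmonic on the open disk D(c,R) and square-integrable on D(c,R), then ∫_{D(c,r)} h(x)² dx ≤ (r/R)² · ∫_{D(c,R)} h(x)² dx. -/
open MeasureTheory Metric Filter

noncomputable section

abbrev Pt := EuclideanSpace ℝ (Fin 2)

/-- The Laplacian of `f : ℝ² → ℝ` at `x`, as the sum of the pure second derivatives. -/
def lap (f : Pt → ℝ) (x : Pt) : ℝ :=
  ∑ i : Fin 2, iteratedFDeriv ℝ 2 f x (fun _ => EuclideanSpace.single i (1 : ℝ))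

/-- A function is harmonic on an open set `U ⊆ ℝ²` if it is `C²` on `U` and its Laplacian
vanishes on `U`. -/
def IsHarmonicOn (f : Pt → ℝ) (U : Set Pt) : Prop :=
  ContDiffOn ℝ 2 f U ∧ ∀ x ∈ U, lap f x = 0

lemma intOn_aux {E : Type*} [NormedAddCommGroup E] {f : ℂ → E} {a : ℝ}
    (hf : ContinuousOn f (closedBall 0 a)) : IntegrableOn f (ball 0 a) :=
  (hf.integrableOn_compact (isCompact_closedBall 0 a)).mono_set ball_subset_closedBall

lemma core_aux (F : ℂ → ℂ) (r a R : ℝ) (hr : 0 < r) (hra : r < a) (haR : a < R)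
    (hF : AnalyticOnNhd ℂ F (ball 0 R)) :
    (∫ z in ball (0 : ℂ) r, (F z).re ^ 2) ≤ (r / a) ^ 2 * ∫ z in ball (0 : ℂ) a, (F z).re ^ 2 := by
  have ha : 0 < a := hr.trans hra
  set s : ℝ := r / a with hs
  have hs0 : 0 < s := div_pos hr ha
  have hs1 : s < 1 := (div_lt_one ha).2 hra
  obtain ⟨ρ, haρ, hρR⟩ := exists_between haR
  have hρ : 0 < ρ := ha.trans haρ
  have hκ : 1 < ρ / a := (one_lt_div ha).2 haρ
  have hsub : closedBall (0 : ℂ) ρ ⊆ ball 0 R := closedBall_subset_ball hρR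
  have hFc : ContinuousOn F (closedBall 0 ρ) := hF.continuousOn.mono hsub
  have hFdc : ContinuousOn (deriv F) (closedBall 0 ρ) := hF.deriv.continuousOn.mono hsub
  have hmap : ∀ w : ℂ, ‖w‖ ≤ ρ / a → Set.MapsTo (fun y : ℂ => w * y) (closedBall 0 a) (closedBall 0 ρ) := by
    intro w hw y hy
    simp only [mem_closedBall, dist_zero_right, norm_mul] at hy ⊢
    calc ‖w‖ * ‖y‖ ≤ (ρ / a) * a := by gcongr
      _ = ρ := by field_simp
  have hcw : ∀ w : ℂ, ‖w‖ ≤ ρ / a → ContinuousOn (fun y : ℂ => F (w * y)) (closedBall 0 a) :=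
    fun w hw => hFc.comp (by fun_prop) (hmap w hw)
  have hcdw : ∀ w : ℂ, ‖w‖ ≤ ρ / a → ContinuousOn (fun y : ℂ => deriv F (w * y)) (closedBall 0 a) :=
    fun w hw => hFdc.comp (by fun_prop) (hmap w hw)
  have hrw : ∀ w : ℂ, ‖w‖ ≤ ρ / a → ContinuousOn (fun y : ℂ => (F (w * y)).re) (closedBall 0 a) :=
    fun w hw => Complex.continuous_re.comp_continuousOn (hcw w hw)
  have hsn : ‖(s : ℂ)‖ = s := by simp [abs_of_pos hs0]
  have hsκ : ‖(s : ℂ)‖ ≤ ρ / a := by rw [hsn]; linarith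
  have hgs := hrw s hsκ
  have hgsC : ContinuousOn (fun y : ℂ => (((F (s * y)).re : ℝ) : ℂ)) (closedBall 0 a) :=
    Complex.continuous_ofReal.comp_continuousOn hgs
  set G : ℂ → ℂ := fun w => ∫ y in ball (0 : ℂ) a, F (w * y) * ((F (s * y)).re : ℂ) with hG
  obtain ⟨C, hC⟩ := (isCompact_closedBall (0 : ℂ) ρ).exists_bound_of_continuousOn hFdc
  have hGd : ∀ w ∈ ball (0 : ℂ) (ρ / a), DifferentiableAt ℂ G w := by
    intro w hw
    have hwn : ∀ x ∈ ball (0 : ℂ) (ρ / a), ‖x‖ ≤ ρ / a := fun x hx => by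
      simpa using (mem_ball.1 hx).le
    refine (hasDerivAt_integral_of_dominated_loc_of_deriv_le (s := ball 0 (ρ / a))
      (μ := volume.restrict (ball (0 : ℂ) a)) (𝕜 := ℂ)
      (F := fun w y => F (w * y) * ((F (s * y)).re : ℂ))
      (F' := fun w y => deriv F (w * y) * y * ((F (s * y)).re : ℂ))
      (bound := fun y => C * ‖y‖ * |(F (s * y)).re|)
      (isOpen_ball.mem_nhds hw) ?_ ?_ ?_ ?_ ?_ ?_).2.differentiableAt
    · filter_upwards [isOpen_ball.mem_nhds hw] with x hx
      exact (intOn_aux ((hcw x (hwn x hx)).mul hgsC)).aestronglyMeasurable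
    · exact intOn_aux ((hcw w (hwn w hw)).mul hgsC)
    · exact (intOn_aux (((hcdw w (hwn w hw)).mul continuousOn_id).mul hgsC)).aestronglyMeasurable
    · refine (ae_restrict_iff' measurableSet_ball).2 (Eventually.of_forall fun y hy x hx => ?_)
      have := hC _ (hmap x (hwn x hx) (ball_subset_closedBall hy))
      simp only [norm_mul, Complex.norm_real, Real.norm_eq_abs]
      gcongr
    · exact intOn_aux ((continuousOn_const.mul continuous_norm.continuousOn).mul hgs.abs)
    · refine (ae_restrict_iff' measurableSet_ball).2 (Eventually.of_forall fun y hy x hx => ?_)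
      have h1 := hsub (hmap x (hwn x hx) (ball_subset_closedBall hy))
      have h2 : HasDerivAt F (deriv F (x * y)) (x * y) := (hF _ h1).differentiableAt.hasDerivAt
      have h3 : HasDerivAt (fun x : ℂ => x * y) y x := by
        simpa using (hasDerivAt_id x).mul_const y
      exact (h2.comp x h3).mul_const _
  have hGre : ∀ w : ℂ, ‖w‖ ≤ ρ / a →
      (G w).re = ∫ y in ball (0 : ℂ) a, (F (w * y)).re * (F (s * y)).re := by
    intro w hw
    have := Complex.reCLM.integral_comp_comm (intOn_aux ((hcw w hw).mul hgsC))
    simp only [hG]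
    simp only [Pi.mul_apply] at this
    rw [← Complex.reCLM_apply, ← this]
    simp
  have hrot : ∀ w : ℂ, ‖w‖ = 1 →
      ∫ y in ball (0 : ℂ) a, (F (w * y)).re ^ 2 = ∫ y in ball (0 : ℂ) a, (F y).re ^ 2 := by
    intro w hw
    let e := rotation ⟨w, mem_sphere_zero_iff_norm.2 hw⟩
    have := e.measurePreserving.setIntegral_preimage_emb
      e.toHomeomorph.measurableEmbedding (fun y => (F y).re ^ 2) (ball 0 a)
    have h2 : e ⁻¹' (ball 0 a) = ball 0 a := by simp
    rw [h2] at this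
    exact this
  set A := ∫ y in ball (0 : ℂ) a, (F y).re ^ 2 with hA
  set B := ∫ y in ball (0 : ℂ) a, (F (s * y)).re ^ 2 with hB
  have hfr : ∀ w ∈ frontier (ball (0 : ℂ) 1), ‖Complex.exp (G w)‖ ≤ Real.exp ((A + B) / 2) := by
    intro w hw
    rw [frontier_ball _ one_ne_zero, mem_sphere_zero_iff_norm] at hw
    have hw' : ‖w‖ ≤ ρ / a := by rw [hw]; exact hκ.le
    rw [Complex.norm_exp, hGre w hw', Real.exp_le_exp]
    have i1 : IntegrableOn (fun y : ℂ => (F (w * y)).re ^ 2) (ball 0 a) :=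
      intOn_aux ((hrw w hw').pow 2)
    have i2 : IntegrableOn (fun y : ℂ => (F (s * y)).re ^ 2) (ball 0 a) := intOn_aux (hgs.pow 2)
    calc _ ≤ ∫ y in ball (0 : ℂ) a, ((F (w * y)).re ^ 2 + (F (s * y)).re ^ 2) / 2 := by
          apply integral_mono (intOn_aux ((hrw w hw').mul hgs)) ((i1.add i2).div_const 2)
          intro y
          simp only [Pi.mul_apply, Pi.add_apply]
          nlinarith [sq_nonneg ((F (w * y)).re - (F (s * y)).re)]
      _ = _ := by
          rw [integral_div, integral_add i1 i2, hrot w hw]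
  have hdc : DiffContOnCl ℂ (fun w => Complex.exp (G w)) (ball 0 1) := by
    apply DifferentiableOn.diffContOnCl
    rw [closure_ball _ one_ne_zero]
    intro w hw
    exact (hGd w (closedBall_subset_ball hκ hw)).cexp.differentiableWithinAt
  have key := Complex.norm_le_of_forall_mem_frontier_norm_le isBounded_ball hdc hfr
    (z := (s : ℂ)) (subset_closure (by simp [abs_of_pos hs0, hs1]))
  rw [Complex.norm_exp, hGre _ hsκ, Real.exp_le_exp] at key
  have hBA : B ≤ A := by
    have : ∫ y in ball (0 : ℂ) a, (F (s * y)).re * (F (s * y)).re = B := by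
      simp only [hB, sq]
    linarith
  have hscale := Measure.setIntegral_comp_smul_of_pos (volume : Measure ℂ)
    (fun y => (F y).re ^ 2) (ball 0 a) hs0
  open Pointwise in
  have hball : s • ball (0 : ℂ) a = ball 0 r := by
    rw [_root_.smul_ball hs0.ne', smul_zero, Real.norm_eq_abs, abs_of_pos hs0, hs, div_mul_cancel₀ _ ha.ne']
  rw [hball, Complex.finrank_real_complex] at hscale
  simp only [Complex.real_smul, smul_eq_mul] at hscale
  rw [← hB] at hscale
  have : ∫ z in ball (0 : ℂ) r, (F z).re ^ 2 = s ^ 2 * B := by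
    rw [hscale]; field_simp
  rw [this]
  gcongr

lemma harm_aux (c : Pt) (R : ℝ) (h : Pt → ℝ) (hharm : IsHarmonicOn h (ball c R)) :
    InnerProductSpace.HarmonicOnNhd
      (fun z => h (c + Complex.orthonormalBasisOneI.repr z)) (ball (0 : ℂ) R) := by
  set e := Complex.orthonormalBasisOneI.repr with he
  have hm : ∀ z ∈ ball (0 : ℂ) R, c + e z ∈ ball c R := by
    intro z hz
    simpa using hz
  intro z hz
  refine ⟨?_, ?_⟩
  · have h1 : ContDiffAt ℝ 2 h (c + e z) := hharm.1.contDiffAt (isOpen_ball.mem_nhds (hm z hz))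
    have h2 : ContDiffAt ℝ 2 (fun z => c + e z) z :=
      contDiffAt_const.add e.contDiff.contDiffAt
    exact ContDiffAt.comp z h1 h2
  · filter_upwards [isOpen_ball.mem_nhds hz] with x hx
    have h3 := hharm.2 _ (hm x hx)
    rw [InnerProductSpace.laplacian_eq_iteratedFDeriv_orthonormalBasis _ Complex.orthonormalBasisOneI]
    have h4 : iteratedFDeriv ℝ 2 (fun z => h (c + e z)) x
        = (iteratedFDeriv ℝ 2 h (c + e x)).compContinuousLinearMap
          fun _ => (e.toContinuousLinearEquiv : ℂ →L[ℝ] Pt) := by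
      rw [← iteratedFDeriv_comp_add_left]
      have := e.toContinuousLinearEquiv.iteratedFDerivWithin_comp_right (fun z => h (c + z))
        uniqueDiffOn_univ (x := x) (Set.mem_univ _) 2
      simpa [iteratedFDerivWithin_univ, Function.comp_def] using this
    beta_reduce
    rw [h4]
    simp only [Pi.zero_apply, ← h3, lap, ContinuousMultilinearMap.compContinuousLinearMap_apply]
    refine Finset.sum_congr rfl fun i _ => ?_
    congr 1
    ext j : 1
    have : e (Complex.orthonormalBasisOneI i) = EuclideanSpace.single i 1 :=
      Complex.orthonormalBasisOneI.repr_self i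
    fin_cases j <;> simpa using this

theorem stmt0 (c : Pt) (r R : ℝ) (hr : 0 < r) (hrR : r < R) (h : Pt → ℝ)
    (hharm : IsHarmonicOn h (ball c R))
    (hL2 : IntegrableOn (fun x => h x ^ 2) (ball c R)) :
    (∫ x in ball c r, h x ^ 2) ≤ (r / R) ^ 2 * ∫ x in ball c R, h x ^ 2 := by
  obtain ⟨F, hF, hFeq⟩ := (harm_aux c R h hharm).exists_analyticOnNhd_ball_re_eq
  set e := Complex.orthonormalBasisOneI.repr with he
  have htr : ∀ a ≤ R, ∫ z in ball (0 : ℂ) a, (F z).re ^ 2 = ∫ x in ball c a, h x ^ 2 := by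
    intro a haR
    have mp : MeasurePreserving (fun z : ℂ => c + e z) volume volume :=
      (measurePreserving_add_left volume c).comp e.measurePreserving
    have me : MeasurableEmbedding (fun z : ℂ => c + e z) :=
      (MeasurableEquiv.addLeft c).measurableEmbedding.comp e.toHomeomorph.measurableEmbedding
    rw [← mp.setIntegral_preimage_emb me]
    have : (fun z : ℂ => c + e z) ⁻¹' (ball c a) = ball 0 a := by
      ext z; simp
    rw [this]
    refine setIntegral_congr_fun measurableSet_ball fun z hz => ?_
    have := hFeq (ball_subset_ball haR hz)
    simp only at this ⊢
    rw [this]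
  have hle : ∀ a ∈ Set.Ioo r R,
      (∫ x in ball c r, h x ^ 2) ≤ (r / a) ^ 2 * ∫ x in ball c R, h x ^ 2 := by
    intro a ha
    have h1 := core_aux F r a R hr ha.1 ha.2 hF
    rw [htr r hrR.le, htr a ha.2.le] at h1
    refine h1.trans (mul_le_mul_of_nonneg_left ?_ (sq_nonneg _))
    exact setIntegral_mono_set hL2 (Eventually.of_forall fun x => sq_nonneg _)
      (ball_subset_ball ha.2.le).eventuallyLE
  have hR : R ≠ 0 := (hr.trans hrR).ne'
  have ht : Tendsto (fun a => (r / a) ^ 2 * ∫ x in ball c R, h x ^ 2) (nhdsWithin R (Set.Iio R))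
      (nhds ((r / R) ^ 2 * ∫ x in ball c R, h x ^ 2)) := by
    have : ContinuousAt (fun a => (r / a) ^ 2 * ∫ x in ball c R, h x ^ 2) R :=
      ((continuousAt_const.div continuousAt_id hR).pow 2).mul continuousAt_const
    exact this.tendsto.mono_left nhdsWithin_le_nhds
  refine ge_of_tendsto ht ?_
  filter_upwards [Ioo_mem_nhdsLT hrR] with a ha using hle a ha
end
end

section
/- Under the Geometry hypothesis, every function h that is harmonic on 𝒢 and square-integrable on 𝒢 satisfies ‖h‖²_{L²(𝒪)} ≤ (R_-²/(R_i² − R_-²)) · ‖h‖²_{L²(ℱ)}. (Lemma 3.2 of the paper.) -/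
open MeasureTheory Metric Filter

noncomputable section

/-- Hypothesis 3.1 of the paper (the "Geometry" hypothesis). -/
structure Geometry (𝒢 𝒪 : Set Pt) (c : Pt) (Re Ri Rp Rm δ δ₀ : ℝ) : Prop where
  openG : IsOpen 𝒢
  openO : IsOpen 𝒪
  bddG : Bornology.IsBounded 𝒢
  bddO : Bornology.IsBounded 𝒪
  scG : SimplyConnectedSpace 𝒢
  scO : SimplyConnectedSpace 𝒪
  clO_sub_G : closure 𝒪 ⊆ 𝒢
  Rm_pos : 0 < Rm
  Rm_lt_Rp : Rm < Rp
  Rp_lt_Ri : Rp < Ri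
  Ri_lt_Re : Ri < Re
  clG_sub : closure 𝒢 ⊆ ball c Re
  clDi_sub : closedBall c Ri ⊆ 𝒢
  clDp_sub : closedBall c Rp ⊆ ball c Ri
  clDm_sub : closedBall c Rm ⊆ ball c Rp
  clO_sub : closure 𝒪 ⊆ ball c Rm
  Rm_eq : Rm = Re * Real.exp (-δ ^ 2)
  Rp_eq : Rp = Re * Real.exp (-δ)
  δ₀_eq : δ₀ = 2 + Real.log (Re / Ri)
  δ₀_lt_δ : δ₀ < δ

open Complex in
lemma aux_rot (g : ℂ → ℝ) (r R : ℝ) (hr : 0 < r) (hrR : r < R) (z : ℂ) (hz : ‖z‖ = R / r) :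
    ∫ y in ball (0:ℂ) r, g (z * y) = (r / R) ^ 2 * ∫ y in ball (0:ℂ) R, g y := by
  have hR : 0 < R := hr.trans hrR
  have hl : 0 < R / r := div_pos hR hr
  have hz0 : z ≠ 0 := by
    rintro rfl; rw [norm_zero] at hz; exact hl.ne hz
  set w : ℂ := z / ((R / r : ℝ) : ℂ) with hw
  have hwn : ‖w‖ = 1 := by
    rw [hw, norm_div, hz, Complex.norm_real, Real.norm_of_nonneg hl.le, div_self hl.ne']
  let a : Circle := ⟨w, by simp [Submonoid.unitSphere, hwn]⟩
  have h1 : ∀ y, z * y = rotation a ((R / r) • y) := by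
    intro y
    have : ((R / r : ℝ) : ℂ) ≠ 0 := by exact_mod_cast hl.ne'
    rw [rotation_apply]
    change z * y = w * _
    rw [hw, Complex.real_smul, ← mul_assoc, div_mul_cancel₀ _ this]
  simp_rw [h1]
  rw [Measure.setIntegral_comp_smul_of_pos volume (fun y => g (rotation a y)) _ hl,
    Complex.finrank_real_complex, _root_.smul_ball hl.ne', smul_zero, Real.norm_of_nonneg hl.le,
    div_mul_cancel₀ _ hr.ne', smul_eq_mul]
  have hp : (rotation a) ⁻¹' (ball (0:ℂ) R) = ball 0 R := by
    ext y
    rw [Set.mem_preimage, mem_ball_zero_iff, mem_ball_zero_iff, LinearIsometryEquiv.norm_map]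
  have := ((rotation a).measurePreserving).setIntegral_preimage_emb
    (rotation a).toHomeomorph.measurableEmbedding g (ball 0 R)
  rw [hp] at this
  rw [this]
  congr 1
  field_simp

lemma aux_core (f : ℂ → ℂ) (r R R' : ℝ) (hr : 0 < r) (hrR : r < R) (hR : R < R')
    (hf : DifferentiableOn ℂ f (ball 0 R')) :
    ∫ y in ball (0:ℂ) r, (f y).re ^ 2 ≤ (r / R) ^ 2 * ∫ y in ball (0:ℂ) R, (f y).re ^ 2 := by
  obtain ⟨R₁, h1, h2⟩ := exists_between hR
  have hR0 : 0 < R := hr.trans hrR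
  have hfd : DifferentiableOn ℂ (deriv f) (ball 0 R') := hf.deriv isOpen_ball
  have hsub : closedBall (0:ℂ) R₁ ⊆ ball 0 R' := closedBall_subset_ball h2
  obtain ⟨C, hC⟩ := (isCompact_closedBall (0:ℂ) R₁).exists_bound_of_continuousOn
    (hf.continuousOn.mono hsub)
  obtain ⟨D, hD⟩ := (isCompact_closedBall (0:ℂ) R₁).exists_bound_of_continuousOn
    (hfd.continuousOn.mono hsub)
  have hC0 : 0 ≤ C := (norm_nonneg _).trans (hC 0 (by simp; linarith))
  have hD0 : 0 ≤ D := (norm_nonneg _).trans (hD 0 (by simp; linarith))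
  have hmem : ∀ z ∈ ball (0:ℂ) (R₁ / r), ∀ y ∈ ball (0:ℂ) r, z * y ∈ closedBall (0:ℂ) R₁ := by
    intro z hz y hy
    simp only [mem_ball_zero_iff, mem_closedBall_zero_iff, norm_mul] at *
    have : 0 ≤ R₁ / r := div_nonneg (by linarith) hr.le
    calc ‖z‖ * ‖y‖ ≤ (R₁ / r) * r := by gcongr
      _ = R₁ := div_mul_cancel₀ _ hr.ne'
  have hmem' : ∀ y ∈ ball (0:ℂ) r, y ∈ closedBall (0:ℂ) R₁ := by
    intro y hy
    simp only [mem_ball_zero_iff, mem_closedBall_zero_iff] at *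
    linarith
  have hcf : ∀ z ∈ ball (0:ℂ) (R₁ / r), ContinuousOn (fun y => f (z * y)) (ball 0 r) := by
    intro z hz
    exact hf.continuousOn.comp (by fun_prop) fun y hy => hsub (hmem z hz y hy)
  have hcd : ∀ z ∈ ball (0:ℂ) (R₁ / r), ContinuousOn (fun y => deriv f (z * y)) (ball 0 r) := by
    intro z hz
    exact hfd.continuousOn.comp (by fun_prop) fun y hy => hsub (hmem z hz y hy)
  have hcr : ContinuousOn (fun y => (f y).re) (ball 0 r) :=
    Complex.continuous_re.comp_continuousOn (hf.continuousOn.mono fun y hy => hsub (hmem' y hy))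
  have hcrc : ContinuousOn (fun y => (((f y).re : ℝ) : ℂ)) (ball 0 r) :=
    Complex.continuous_ofReal.comp_continuousOn hcr
  have hb1 : ∀ y ∈ ball (0:ℂ) r, |(f y).re| ≤ C := fun y hy =>
    (Complex.abs_re_le_norm _).trans (hC y (hmem' y hy))
  have hb2 : ∀ z ∈ ball (0:ℂ) (R₁ / r), ∀ y ∈ ball (0:ℂ) r, |(f (z * y)).re| ≤ C :=
    fun z hz y hy => (Complex.abs_re_le_norm _).trans (hC _ (hmem z hz y hy))
  have hfin : volume (ball (0:ℂ) r) ≠ ⊤ := measure_ball_lt_top.ne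
  have hint : ∀ z ∈ ball (0:ℂ) (R₁ / r),
      IntegrableOn (fun y => f (z * y) * ((f y).re : ℂ)) (ball 0 r) := by
    intro z hz
    refine IntegrableOn.of_bound (C := C * C) measure_ball_lt_top
      (((hcf z hz).mul hcrc).aestronglyMeasurable measurableSet_ball) ?_
    refine (ae_restrict_iff' measurableSet_ball).2 (Eventually.of_forall fun y hy => ?_)
    rw [norm_mul, Complex.norm_real]
    exact mul_le_mul (hC _ (hmem z hz y hy)) (hb1 y hy) (norm_nonneg _) hC0
  set G : ℂ → ℂ := fun z => ∫ y in ball (0:ℂ) r, f (z * y) * ((f y).re : ℂ) with hG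
  have hGd : DifferentiableOn ℂ G (ball 0 (R₁ / r)) := by
    intro z₀ hz₀
    have := hasDerivAt_integral_of_dominated_loc_of_deriv_le
      (μ := volume.restrict (ball (0:ℂ) r)) (𝕜 := ℂ) (x₀ := z₀) (s := ball 0 (R₁ / r))
      (F := fun z y => f (z * y) * ((f y).re : ℂ))
      (F' := fun z y => (deriv f (z * y) * y) * ((f y).re : ℂ))
      (bound := fun _ => D * r * C)
      (isOpen_ball.mem_nhds hz₀)
      (by
        filter_upwards [isOpen_ball.mem_nhds hz₀] with z hz
        exact (hint z hz).aestronglyMeasurable)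
      (hint z₀ hz₀)
      (((((hcd z₀ hz₀).mul continuousOn_id).mul hcrc)).aestronglyMeasurable measurableSet_ball)
      (by
        refine (ae_restrict_iff' measurableSet_ball).2 (Eventually.of_forall fun y hy z hz => ?_)
        rw [norm_mul, norm_mul, Complex.norm_real]
        have hy' : ‖y‖ ≤ r := (mem_ball_zero_iff.1 hy).le
        exact mul_le_mul (mul_le_mul (hD _ (hmem z hz y hy)) hy' (norm_nonneg _) hD0)
          (hb1 y hy) (norm_nonneg _) (by positivity))
      (integrableOn_const hfin)
      (by
        refine (ae_restrict_iff' measurableSet_ball).2 (Eventually.of_forall fun y hy z hz => ?_)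
        refine HasDerivAt.mul_const ?_ _
        have h3 : HasDerivAt f (deriv f (z * y)) (z * y) :=
          ((hf.differentiableAt (isOpen_ball.mem_nhds (hsub (hmem z hz y hy))))).hasDerivAt
        exact h3.comp z (hasDerivAt_mul_const y))
    exact this.2.differentiableAt.differentiableWithinAt
  have hGre : ∀ z ∈ ball (0:ℂ) (R₁ / r),
      (G z).re = ∫ y in ball (0:ℂ) r, (f (z * y)).re * (f y).re := by
    intro z hz
    have := integral_re (𝕜 := ℂ) (hint z hz)
    simpa [hG] using this.symm
  have hsq : IntegrableOn (fun y => (f y).re ^ 2) (ball 0 r) := by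
    refine IntegrableOn.of_bound (C := C ^ 2) measure_ball_lt_top
      ((hcr.pow 2).aestronglyMeasurable measurableSet_ball) ?_
    refine (ae_restrict_iff' measurableSet_ball).2 (Eventually.of_forall fun y hy => ?_)
    rw [norm_pow]
    exact pow_le_pow_left₀ (norm_nonneg _) (hb1 y hy) 2
  have hsqz : ∀ z ∈ ball (0:ℂ) (R₁ / r),
      IntegrableOn (fun y => (f (z * y)).re ^ 2) (ball 0 r) := by
    intro z hz
    refine IntegrableOn.of_bound (C := C ^ 2) measure_ball_lt_top
      (((Complex.continuous_re.comp_continuousOn (hcf z hz)).pow 2).aestronglyMeasurable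
        measurableSet_ball) ?_
    refine (ae_restrict_iff' measurableSet_ball).2 (Eventually.of_forall fun y hy => ?_)
    rw [norm_pow]
    exact pow_le_pow_left₀ (norm_nonneg _) (hb2 z hz y hy) 2
  set A := ∫ y in ball (0:ℂ) r, (f y).re ^ 2 with hA
  set B := (r / R) ^ 2 * ∫ y in ball (0:ℂ) R, (f y).re ^ 2 with hB
  have hball : closedBall (0:ℂ) (R / r) ⊆ ball 0 (R₁ / r) :=
    closedBall_subset_ball (by gcongr)
  have hbd : ∀ z ∈ frontier (ball (0:ℂ) (R / r)),
      ‖Complex.exp (G z)‖ ≤ Real.exp ((A + B) / 2) := by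
    intro z hz
    have hz' : ‖z‖ = R / r := by
      rw [frontier_ball _ (div_pos hR0 hr).ne'] at hz
      simpa using hz
    have hzm : z ∈ ball (0:ℂ) (R₁ / r) := hball (by simp [hz'])
    rw [Complex.norm_exp]
    refine Real.exp_le_exp.2 ?_
    rw [hGre z hzm, hB, ← aux_rot (fun y => (f y).re ^ 2) r R hr hrR z hz', hA,
      ← integral_add hsq (hsqz z hzm), ← integral_div]
    have hi : IntegrableOn (fun y => (f (z * y)).re * (f y).re) (ball 0 r) := by
      simpa [IntegrableOn] using (hint z hzm).re
    refine integral_mono hi ((hsq.add (hsqz z hzm)).div_const 2) fun y => ?_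
    change _ ≤ ((f y).re ^ 2 + (f (z * y)).re ^ 2) / 2
    nlinarith [sq_nonneg ((f y).re - (f (z * y)).re)]
  have hone : (1:ℂ) ∈ ball (0:ℂ) (R / r) := by
    simp [one_lt_div hr, hrR]
  have hmax := Complex.norm_le_of_forall_mem_frontier_norm_le (U := ball (0:ℂ) (R / r))
    (f := fun z => Complex.exp (G z)) isBounded_ball
    (DifferentiableOn.diffContOnCl
      ((hGd.mono (closure_ball_subset_closedBall.trans hball)).cexp)) hbd
    (subset_closure hone)
  rw [Complex.norm_exp, Real.exp_le_exp,
    hGre 1 (hball (ball_subset_closedBall hone))] at hmax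
  have : ∫ y in ball (0:ℂ) r, (f (1 * y)).re * (f y).re = A := by
    simp [hA, sq]
  linarith

open InnerProductSpace Complex in
lemma aux_harm (h : Pt → ℝ) (U : Set Pt) (hU : IsOpen U) (hh : IsHarmonicOn h U) (c : Pt) (R : ℝ)
    (hR : ball c R ⊆ U) :
    HarmonicOnNhd (fun w : ℂ => h (c + orthonormalBasisOneI.repr w)) (ball 0 R) := by
  set e : ℂ ≃ₗᵢ[ℝ] Pt := orthonormalBasisOneI.repr with he
  have hm : ∀ w ∈ ball (0:ℂ) R, c + e w ∈ U := by
    intro w hw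
    apply hR
    simpa [mem_ball, dist_eq_norm] using hw
  have hcd : ∀ w ∈ ball (0:ℂ) R, ContDiffAt ℝ 2 h (c + e w) := fun w hw =>
    hh.1.contDiffAt (hU.mem_nhds (hm w hw))
  intro w hw
  refine ⟨?_, ?_⟩
  · refine (hcd w hw).comp w ?_
    exact contDiffAt_const.add e.contDiff.contDiffAt
  · filter_upwards [isOpen_ball.mem_nhds hw] with x hx
    rw [laplacian_eq_iteratedFDeriv_orthonormalBasis _ orthonormalBasisOneI]
    have hl := hh.2 _ (hm x hx)
    have key : iteratedFDeriv ℝ 2 (fun w : ℂ => h (c + e w)) x =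
        (iteratedFDeriv ℝ 2 h (c + e x)).compContinuousLinearMap fun _ => (e : ℂ →L[ℝ] Pt) := by
      have h1 := e.toContinuousLinearEquiv.iteratedFDerivWithin_comp_right
        (fun p => h (c + p)) uniqueDiffOn_univ (x := x) (Set.mem_univ _) 2
      simp only [Set.preimage_univ, iteratedFDerivWithin_univ] at h1
      rw [iteratedFDeriv_comp_add_left] at h1
      exact h1
    simp only [key, Pi.zero_apply]
    rw [lap] at hl
    rw [← hl]
    refine Finset.sum_congr rfl fun i _ => ?_
    rw [ContinuousMultilinearMap.compContinuousLinearMap_apply]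
    congr 1
    ext j : 1
    have : e (orthonormalBasisOneI i) = EuclideanSpace.single i 1 := by
      rw [he]; exact OrthonormalBasis.repr_self _ _
    fin_cases j <;> exact this

theorem stmt1 (𝒢 𝒪 : Set Pt) (c : Pt) (Re Ri Rp Rm δ δ₀ : ℝ)
    (geom : Geometry 𝒢 𝒪 c Re Ri Rp Rm δ δ₀)
    (h : Pt → ℝ) (hharm : IsHarmonicOn h 𝒢)
    (hL2 : IntegrableOn (fun x => h x ^ 2) 𝒢) :
    (∫ x in 𝒪, h x ^ 2)
      ≤ Rm ^ 2 / (Ri ^ 2 - Rm ^ 2) * ∫ x in 𝒢 \ closure 𝒪, h x ^ 2 := by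
  have hRm := geom.Rm_pos
  have hlt : Rm < Ri := geom.Rm_lt_Rp.trans geom.Rp_lt_Ri
  have hRi : 0 < Ri := hRm.trans hlt
  obtain ⟨ε, hε, hsub⟩ := (isCompact_closedBall c Ri).exists_thickening_subset_open geom.openG
    geom.clDi_sub
  rw [thickening_closedBall hε hRi.le] at hsub
  obtain ⟨F, hF, hFe⟩ := (aux_harm h 𝒢 geom.openG hharm c _ hsub).exists_analyticOnNhd_ball_re_eq
  have core := aux_core F Rm Ri (ε + Ri) hRm hlt (by linarith) hF.differentiableOn
  have tr : ∀ ρ, ρ ≤ Ri → ∫ y in ball (0:ℂ) ρ, (F y).re ^ 2 = ∫ x in ball c ρ, h x ^ 2 := by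
    intro ρ hρ
    have h1 : ∫ y in ball (0:ℂ) ρ, (F y).re ^ 2
        = ∫ y in ball (0:ℂ) ρ, h (c + Complex.orthonormalBasisOneI.repr y) ^ 2 := by
      refine setIntegral_congr_fun measurableSet_ball fun y hy => ?_
      have := hFe (ball_subset_ball (by linarith) hy)
      simp only at this
      simp only [this]
    rw [h1]
    have mp : MeasurePreserving (fun y : ℂ => c + Complex.orthonormalBasisOneI.repr y)
        volume volume :=
      (measurePreserving_add_left volume c).comp
        (Complex.orthonormalBasisOneI.repr.measurePreserving)
    have me : MeasurableEmbedding (fun y : ℂ => c + Complex.orthonormalBasisOneI.repr y) :=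
      (measurableEmbedding_addLeft c).comp
        Complex.orthonormalBasisOneI.repr.toHomeomorph.measurableEmbedding
    rw [← mp.setIntegral_preimage_emb me (fun x => h x ^ 2) (ball c ρ)]
    congr 2
    ext y
    simp [mem_ball, dist_eq_norm]
  rw [tr Rm hlt.le, tr Ri le_rfl] at core
  have hOm : 𝒪 ⊆ ball c Rm := subset_closure.trans geom.clO_sub
  have hmi : ball c Rm ⊆ ball c Ri := ball_subset_ball hlt.le
  have hiG : ball c Ri ⊆ 𝒢 := ball_subset_closedBall.trans geom.clDi_sub
  have hnn : ∀ s : Set Pt, 0 ≤ᵐ[volume.restrict s] fun x => h x ^ 2 :=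
    fun s => Eventually.of_forall fun x => sq_nonneg _
  have e1 : ∫ x in 𝒪, h x ^ 2 ≤ ∫ x in ball c Rm, h x ^ 2 :=
    setIntegral_mono_set (hL2.mono_set (hmi.trans hiG)) (hnn _) hOm.eventuallyLE
  have e2 : ∫ x in ball c Ri \ ball c Rm, h x ^ 2 ≤ ∫ x in 𝒢 \ closure 𝒪, h x ^ 2 :=
    setIntegral_mono_set (hL2.mono_set Set.diff_subset) (hnn _)
      (Set.diff_subset_diff hiG geom.clO_sub).eventuallyLE
  rw [setIntegral_diff measurableSet_ball (hL2.mono_set hiG) hmi] at e2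
  have hd : 0 < Ri ^ 2 - Rm ^ 2 := by nlinarith
  rw [div_mul_eq_mul_div, le_div_iff₀ hd]
  rw [div_pow, div_mul_eq_mul_div, le_div_iff₀ (by positivity)] at core
  nlinarith [mul_le_mul_of_nonneg_left e2 (sq_nonneg Rm), mul_le_mul_of_nonneg_right e1 hd.le]
end
end

section
/- Under the Geometry hypothesis, every function h that is harmonic on 𝒦 = ℝ² ∖ closure(𝒪), locally square-integrable on 𝒦, and satisfies h(x) → 0 as |x| → ∞, obeys ‖h‖²_{L²(ℱ_Γ)} ≤ (1/δ) · ‖h‖²_{L²(ℱ)} and ‖h‖²_{L²(ℱ_Σ)} ≥ (1 − 1/δ) · ‖h‖²_{L²(ℱ)}. (Estimates (3.7) of Lemma 3.3.) -/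
open MeasureTheory Metric Filter

noncomputable section

open Complex InnerProductSpace in
lemma aux_radial (u : ℂ → ℝ) (r θ : ℝ) (hu : HarmonicAt u (circleMap 0 r θ)) :
    HasDerivAt (fun s : ℝ => u (circleMap 0 s θ))
      (fderiv ℝ u (circleMap 0 r θ) (circleMap 0 1 θ)) r := by
  have h1 : HasFDerivAt u (fderiv ℝ u (circleMap 0 r θ)) (circleMap 0 r θ) :=
    (hu.1.differentiableAt two_ne_zero).hasFDerivAt
  have h2 : HasDerivAt (fun s : ℝ => circleMap 0 s θ) (circleMap 0 1 θ) r := by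
    simp only [circleMap, zero_add]
    simpa using (Complex.ofRealCLM.hasDerivAt (x := r)).mul_const (Complex.exp (θ * I))
  exact h1.comp_hasDerivAt r h2

open Complex InnerProductSpace in
lemma aux_angular (u : ℂ → ℝ) (r θ : ℝ) (hu : HarmonicAt u (circleMap 0 r θ)) :
    HasDerivAt (fun s : ℝ => u (circleMap 0 r s))
      (fderiv ℝ u (circleMap 0 r θ) (circleMap 0 r θ * I)) θ := by
  have h1 : HasFDerivAt u (fderiv ℝ u (circleMap 0 r θ)) (circleMap 0 r θ) :=
    (hu.1.differentiableAt two_ne_zero).hasFDerivAt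
  exact h1.comp_hasDerivAt θ (hasDerivAt_circleMap 0 r θ)

/-- complex partial -/
def cpart (u : ℂ → ℝ) (z : ℂ) : ℂ := fderiv ℝ u z 1 - Complex.I * fderiv ℝ u z Complex.I

open Complex in
lemma aux_alg (u : ℂ → ℝ) (r θ : ℝ) :
    circleMap 0 r θ * cpart u (circleMap 0 r θ) =
      r * (fderiv ℝ u (circleMap 0 r θ) (circleMap 0 1 θ) : ℝ)
        - I * (fderiv ℝ u (circleMap 0 r θ) (circleMap 0 r θ * I) : ℝ) := by
  set L := fderiv ℝ u (circleMap 0 r θ) with hL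
  have e : ∀ w : ℂ, L w = w.re * L 1 + w.im * L I := by
    intro w
    conv_lhs => rw [show w = w.re • (1 : ℂ) + w.im • (I : ℂ) by simp]
    rw [map_add, map_smul, map_smul]; simp
  rw [e (circleMap 0 1 θ), e (circleMap 0 r θ * I)]
  simp only [cpart, ← hL]
  have hz : circleMap 0 r θ = (r * Real.cos θ : ℝ) + (r * Real.sin θ : ℝ) * I := by
    simp [circleMap, exp_mul_I]; ring
  have hz1 : circleMap 0 1 θ = (Real.cos θ : ℝ) + (Real.sin θ : ℝ) * I := by
    simp [circleMap, exp_mul_I]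
  rw [hz, hz1]
  apply Complex.ext <;> simp <;> ring

def Cf (u : ℂ → ℝ) (n : ℕ) (r : ℝ) : ℂ :=
  ∫ θ in (0:ℝ)..(2 * Real.pi), (u (circleMap 0 r θ) : ℂ) * Complex.exp (n * θ * Complex.I)

open Complex InnerProductSpace in
lemma cont_u (u : ℂ → ℝ) (R : ℝ) (hu : ∀ z : ℂ, R < ‖z‖ → HarmonicAt u z) :
    ContinuousOn u {z | R < ‖z‖} := fun z hz =>
  ((hu z hz).1.continuousAt).continuousWithinAt

open Complex InnerProductSpace in
lemma cont_fu (u : ℂ → ℝ) (R : ℝ) (hu : ∀ z : ℂ, R < ‖z‖ → HarmonicAt u z) :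
    ContinuousOn (fderiv ℝ u) {z | R < ‖z‖} := fun z hz =>
  (((hu z hz).1.fderiv_right (m := 1) (by norm_num)).continuousAt).continuousWithinAt

lemma norm_cm {R r : ℝ} (hR : 0 < R) (hr : R < r) (θ : ℝ) : R < ‖circleMap 0 r θ‖ := by
  rw [norm_circleMap_zero, abs_of_pos (hR.trans hr)]; exact hr

lemma cont_cm : Continuous (fun p : ℝ × ℝ => circleMap 0 p.1 p.2) := by
  unfold circleMap; fun_prop

open Complex InnerProductSpace in
lemma Cf_deriv (u : ℂ → ℝ) (R : ℝ) (hR : 0 < R) (hu : ∀ z : ℂ, R < ‖z‖ → HarmonicAt u z)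
    (n : ℕ) (r : ℝ) (hr : R < r) :
    HasDerivAt (Cf u n) (∫ θ in (0:ℝ)..(2 * Real.pi),
      (fderiv ℝ u (circleMap 0 r θ) (circleMap 0 1 θ) : ℂ) * Complex.exp (n * θ * Complex.I)) r := by
  obtain ⟨a, ha1, ha2⟩ := exists_between hr
  have hc : ContinuousOn (fun p : ℝ × ℝ => ((fderiv ℝ u (circleMap 0 p.1 p.2) (circleMap 0 1 p.2) : ℝ) : ℂ)
      * Complex.exp (n * p.2 * Complex.I)) {p | R < p.1} := by
    refine ContinuousOn.mul ?_ (by fun_prop)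
    refine Complex.continuous_ofReal.comp_continuousOn ?_
    refine ContinuousOn.clm_apply ?_ ((cont_cm.comp (f := fun p : ℝ × ℝ => ((1:ℝ), p.2)) (by fun_prop)).continuousOn)
    exact (cont_fu u R hu).comp cont_cm.continuousOn (fun p hp => norm_cm hR hp _)
  have hcu : ContinuousOn (fun p : ℝ × ℝ => (u (circleMap 0 p.1 p.2) : ℂ)
      * Complex.exp (n * p.2 * Complex.I)) {p | R < p.1} := by
    refine ContinuousOn.mul ?_ (by fun_prop)
    refine Complex.continuous_ofReal.comp_continuousOn ?_
    exact (cont_u u R hu).comp cont_cm.continuousOn (fun p hp => norm_cm hR hp _)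
  have slice : ∀ s : ℝ, R < s → ∀ f : ℝ × ℝ → ℂ, ContinuousOn f {p | R < p.1} →
      Continuous (fun θ => f (s, θ)) := by
    intro s hs f hf
    exact hf.comp_continuous (by fun_prop) (fun θ => hs)
  have hK : IsCompact (Set.Icc a (r+1) ×ˢ Set.Icc (0:ℝ) (2*Real.pi)) := isCompact_Icc.prod isCompact_Icc
  obtain ⟨B, hB⟩ := hK.exists_bound_of_continuousOn (hc.mono (fun p hp => lt_of_lt_of_le ha1 hp.1.1))
  refine (intervalIntegral.hasDerivAt_integral_of_dominated_loc_of_deriv_le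
    (F := fun s θ => (u (circleMap 0 s θ) : ℂ) * Complex.exp (n * θ * Complex.I))
    (F' := fun s θ => ((fderiv ℝ u (circleMap 0 s θ) (circleMap 0 1 θ) : ℝ) : ℂ) * Complex.exp (n * θ * Complex.I))
    (bound := fun _ => B) (s := Set.Ioo a (r+1)) (Ioo_mem_nhds ha2 (by linarith)) ?_ ?_ ?_ ?_ ?_ ?_).2
  · filter_upwards [Ioi_mem_nhds hr] with s hs
    exact (slice s hs _ hcu).aestronglyMeasurable
  · exact (slice r hr _ hcu).intervalIntegrable _ _
  · exact (slice r hr _ hc).aestronglyMeasurable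
  · refine ae_of_all _ fun θ hθ s hs => ?_
    rw [Set.uIoc_of_le (by positivity)] at hθ
    exact hB (s, θ) ⟨⟨hs.1.le, hs.2.le⟩, ⟨hθ.1.le, hθ.2⟩⟩
  · simp
  · refine ae_of_all _ fun θ hθ s hs => ?_
    exact ((aux_radial u s θ (hu _ (norm_cm hR (ha1.trans hs.1) _))).ofReal_comp).mul_const _

open Complex InnerProductSpace in
lemma Cf_ibp (u : ℂ → ℝ) (R : ℝ) (hR : 0 < R) (hu : ∀ z : ℂ, R < ‖z‖ → HarmonicAt u z)
    (n : ℕ) (r : ℝ) (hr : R < r) :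
    (∫ θ in (0:ℝ)..(2 * Real.pi),
      (fderiv ℝ u (circleMap 0 r θ) (circleMap 0 r θ * I) : ℂ) * Complex.exp (n * θ * Complex.I))
      = - (n * I) * Cf u n r := by
  have hcu : Continuous (fun θ : ℝ => (u (circleMap 0 r θ) : ℂ)) :=
    Complex.continuous_ofReal.comp ((cont_u u R hu).comp_continuous (continuous_circleMap 0 r)
      (fun p => norm_cm hR hr _))
  have hc : Continuous (fun θ : ℝ => ((fderiv ℝ u (circleMap 0 r θ) (circleMap 0 r θ * I) : ℝ) : ℂ)) := by
    refine Complex.continuous_ofReal.comp ?_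
    refine Continuous.clm_apply ?_ ((continuous_circleMap 0 r).mul continuous_const)
    exact (cont_fu u R hu).comp_continuous (continuous_circleMap 0 r) (fun p => norm_cm hR hr _)
  have he : ∀ θ : ℝ, HasDerivAt (fun θ : ℝ => Complex.exp (n * θ * I)) (Complex.exp (n * θ * I) * (n * I)) θ := by
    intro θ
    refine HasDerivAt.cexp ?_
    simpa using ((Complex.ofRealCLM.hasDerivAt (x := θ)).const_mul (n:ℂ)).mul_const I
  have hec : Continuous (fun θ : ℝ => Complex.exp (n * θ * I)) := by fun_prop
  have := intervalIntegral.integral_deriv_mul_eq_sub (a := 0) (b := 2 * Real.pi)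
    (u := fun θ : ℝ => (u (circleMap 0 r θ) : ℂ)) (v := fun θ : ℝ => Complex.exp (n * θ * I))
    (u' := fun θ : ℝ => ((fderiv ℝ u (circleMap 0 r θ) (circleMap 0 r θ * I) : ℝ) : ℂ))
    (v' := fun θ : ℝ => Complex.exp (n * θ * I) * (n * I))
    (fun θ _ => (aux_angular u r θ (hu _ (norm_cm hR hr _))).ofReal_comp)
    (fun θ _ => he θ) (hc.intervalIntegrable _ _) ((hec.mul continuous_const).intervalIntegrable _ _)
  have i1 : IntervalIntegrable (fun θ : ℝ => ((fderiv ℝ u (circleMap 0 r θ) (circleMap 0 r θ * I) : ℝ) : ℂ)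
      * Complex.exp (n * θ * I)) volume 0 (2 * Real.pi) := (hc.mul hec).intervalIntegrable _ _
  have i2 : IntervalIntegrable (fun θ : ℝ => (u (circleMap 0 r θ) : ℂ)
      * (Complex.exp (n * θ * I) * (n * I))) volume 0 (2 * Real.pi) :=
    (hcu.mul (hec.mul continuous_const)).intervalIntegrable _ _
  rw [intervalIntegral.integral_add i1 i2] at this
  have e1 : Complex.exp (n * ((2 * Real.pi : ℝ) : ℂ) * I) = 1 := by
    rw [Complex.exp_eq_one_iff]; exact ⟨n, by push_cast; ring⟩
  have e2 : circleMap 0 r (2 * Real.pi) = circleMap 0 r 0 := by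
    simpa using periodic_circleMap 0 r 0
  rw [e1, e2] at this
  have e3 : (∫ θ in (0:ℝ)..(2 * Real.pi), (u (circleMap 0 r θ) : ℂ) * (Complex.exp (n * θ * I) * (n * I)))
      = n * I * Cf u n r := by
    rw [Cf, ← intervalIntegral.integral_const_mul]
    congr 1; ext θ; ring
  rw [e3] at this
  simp at this
  linear_combination this

open Complex InnerProductSpace in
lemma Kconst (u : ℂ → ℝ) (R : ℝ) (hR : 0 < R) (hu : ∀ z : ℂ, R < ‖z‖ → HarmonicAt u z)
    (n : ℕ) : ∃ K : ℂ, ∀ r : ℝ, R < r →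
    (∫ θ in (0:ℝ)..(2 * Real.pi), circleMap 0 r θ * cpart u (circleMap 0 r θ) * Complex.exp (n * θ * Complex.I))
      = K / r ^ n := by
  set f : ℂ → ℂ := fun z => z ^ n * cpart u z with hf
  have hd : ∀ z : ℂ, R < ‖z‖ → DifferentiableAt ℂ f z := by
    intro z hz
    exact (differentiableAt_id.pow n).mul (HarmonicAt.differentiableAt_complex_partial (hu z hz))
  have key : ∀ r s : ℝ, R < r → r ≤ s → (∮ z in C(0, s), f z) = ∮ z in C(0, r), f z := by
    intro r s hr hs
    refine Complex.circleIntegral_eq_of_differentiable_on_annulus_off_countable (hR.trans hr) hs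
      Set.countable_empty ?_ ?_
    · intro z hz
      refine (hd z ?_).continuousAt.continuousWithinAt
      have := hz.2
      simp at this; linarith
    · intro z hz
      refine hd z ?_
      have := hz.1.2
      simp at this; linarith
  have key2 : ∀ r : ℝ, R < r → (∮ z in C(0, r), f z) = ∮ z in C(0, R+1), f z := by
    intro r hr
    rcases le_total r (R+1) with h | h
    · exact (key _ _ hr h).symm
    · exact key _ _ (by linarith) h
  refine ⟨(∮ z in C(0, R+1), f z) / I, fun r hr => ?_⟩
  have hr0 : (r:ℂ) ≠ 0 := by exact_mod_cast (hR.trans hr).ne'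
  rw [← key2 r hr, circleIntegral]
  rw [eq_div_iff (pow_ne_zero _ hr0), eq_div_iff I_ne_zero, ← intervalIntegral.integral_mul_const,
    ← intervalIntegral.integral_mul_const]
  congr 1; ext θ
  simp only [deriv_circleMap, hf, smul_eq_mul]
  have : circleMap 0 r θ ^ n = r ^ n * Complex.exp (n * θ * I) := by
    simp only [circleMap, zero_add, mul_pow, ← Complex.exp_nat_mul]
    ring_nf
  rw [this]; ring

open Complex InnerProductSpace in
lemma Cf_ode (u : ℂ → ℝ) (R : ℝ) (hR : 0 < R) (hu : ∀ z : ℂ, R < ‖z‖ → HarmonicAt u z)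
    (n : ℕ) : ∃ K : ℂ, ∀ r : ℝ, R < r →
      HasDerivAt (Cf u n) ((n * Cf u n r + K / r ^ n) / r) r := by
  obtain ⟨K, hK⟩ := Kconst u R hR hu n
  refine ⟨K, fun r hr => ?_⟩
  have hr0 : (r:ℂ) ≠ 0 := by exact_mod_cast (hR.trans hr).ne'
  convert Cf_deriv u R hR hu n r hr using 1
  rw [div_eq_iff hr0, ← hK r hr]
  have hec : Continuous (fun θ : ℝ => Complex.exp (n * θ * I)) := by fun_prop
  have hfu : Continuous (fun θ : ℝ => fderiv ℝ u (circleMap 0 r θ)) :=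
    (cont_fu u R hu).comp_continuous (continuous_circleMap 0 r) (fun p => norm_cm hR hr _)
  have i1 : IntervalIntegrable (fun θ : ℝ => (r:ℂ) * (((fderiv ℝ u (circleMap 0 r θ) (circleMap 0 1 θ) : ℝ) : ℂ)
      * Complex.exp (n * θ * I))) volume 0 (2 * Real.pi) :=
    (continuous_const.mul ((Complex.continuous_ofReal.comp (hfu.clm_apply (continuous_circleMap 0 1))).mul hec)).intervalIntegrable _ _
  have i2 : IntervalIntegrable (fun θ : ℝ => I * (((fderiv ℝ u (circleMap 0 r θ) (circleMap 0 r θ * I) : ℝ) : ℂ)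
      * Complex.exp (n * θ * I))) volume 0 (2 * Real.pi) :=
    (continuous_const.mul ((Complex.continuous_ofReal.comp (hfu.clm_apply ((continuous_circleMap 0 r).mul continuous_const))).mul hec)).intervalIntegrable _ _
  have : (∫ θ in (0:ℝ)..(2 * Real.pi), circleMap 0 r θ * cpart u (circleMap 0 r θ) * Complex.exp (n * θ * Complex.I))
    = ∫ θ in (0:ℝ)..(2 * Real.pi), ((r:ℂ) * (((fderiv ℝ u (circleMap 0 r θ) (circleMap 0 1 θ) : ℝ) : ℂ)
      * Complex.exp (n * θ * I)) - I * (((fderiv ℝ u (circleMap 0 r θ) (circleMap 0 r θ * I) : ℝ) : ℂ)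
      * Complex.exp (n * θ * I))) := by
    congr 1; ext θ; rw [aux_alg]; ring
  rw [this, intervalIntegral.integral_sub i1 i2, intervalIntegral.integral_const_mul,
    intervalIntegral.integral_const_mul, Cf_ibp u R hR hu n r hr]
  linear_combination (n * Cf u n r) * I_sq

lemma Cf_tendsto (u : ℂ → ℝ) (hlim : Tendsto u (cocompact ℂ) (nhds 0)) (n : ℕ) :
    Tendsto (Cf u n) atTop (nhds 0) := by
  rw [Metric.tendsto_atTop]
  intro ε hε
  have h1 : ∀ᶠ z in cocompact ℂ, |u z| < ε / 8 := by
    have := (Metric.tendsto_nhds.1 hlim) (ε / 8) (by positivity)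
    simpa using this
  rw [← Metric.cobounded_eq_cocompact, ← comap_norm_atTop, eventually_comap] at h1
  obtain ⟨N, hN⟩ := eventually_atTop.1 h1
  refine ⟨max N 0, fun r hr => ?_⟩
  rw [dist_zero_right]
  have := intervalIntegral.norm_integral_le_of_norm_le_const (a := 0) (b := 2 * Real.pi) (C := ε / 8)
    (f := fun θ : ℝ => (u (circleMap 0 r θ) : ℂ) * Complex.exp (n * θ * Complex.I)) (by
      intro θ _
      have e : (n * θ * Complex.I : ℂ) = ((n * θ : ℝ) : ℂ) * Complex.I := by push_cast; ring
      rw [norm_mul, e, Complex.norm_exp_ofReal_mul_I, mul_one, Complex.norm_real, Real.norm_eq_abs]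
      refine (hN r (le_trans (le_max_left _ _) hr) _ ?_).le
      rw [norm_circleMap_zero, abs_of_nonneg (le_trans (le_max_right _ _) hr)])
  refine lt_of_le_of_lt this ?_
  rw [sub_zero, abs_of_pos (by positivity)]
  nlinarith [Real.pi_lt_d2, Real.pi_pos]

open InnerProductSpace in
lemma Cf_form (u : ℂ → ℝ) (R : ℝ) (hR : 0 < R) (hu : ∀ z : ℂ, R < ‖z‖ → HarmonicAt u z)
    (hlim : Tendsto u (cocompact ℂ) (nhds 0)) (n : ℕ) (hn : n ≠ 0) :
    ∃ B : ℂ, ∀ r : ℝ, R < r → Cf u n r = B / r ^ n := by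
  obtain ⟨K, hK⟩ := Cf_ode u R hR hu n
  have hn0 : (n:ℂ) ≠ 0 := by exact_mod_cast hn
  set Φ : ℝ → ℂ := fun r => Cf u n r * ((r:ℂ) ^ n)⁻¹ + K / (2 * n) * ((r:ℂ) ^ (2 * n))⁻¹ with hΦ
  have hder : ∀ r : ℝ, R < r → HasDerivAt Φ 0 r := by
    intro r hr
    have hr0 : (r:ℂ) ≠ 0 := by exact_mod_cast (hR.trans hr).ne'
    have hp : ∀ m : ℕ, HasDerivAt (fun r : ℝ => ((r:ℂ) ^ m)⁻¹) (-(m * (r:ℂ) ^ (m-1)) / ((r:ℂ)^m)^2) r := by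
      intro m
      have : HasDerivAt (fun r : ℝ => ((r:ℂ) ^ m)) (m * (r:ℂ) ^ (m-1)) r := by
        have h0 : HasDerivAt (fun r : ℝ => (r:ℂ)) 1 r := by
          simpa using (hasDerivAt_id r).ofReal_comp
        simpa using h0.fun_pow m
      exact this.inv (pow_ne_zero _ hr0)
    have := ((hK r hr).mul (hp n)).add ((hp (2 * n)).const_mul (K / (2 * n)))
    refine this.congr_deriv ?_
    obtain ⟨k, rfl⟩ := Nat.exists_eq_succ_of_ne_zero hn
    simp only [Nat.succ_eq_add_one, Nat.add_sub_cancel, show 2 * (k+1) - 1 = 2*k+1 by omega]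
    push_cast at hn0 ⊢
    field_simp
    ring
  have hconst : ∀ r s : ℝ, R < r → R < s → Φ r = Φ s := by
    intro r s hr hs
    exact isOpen_Ioi.is_const_of_deriv_eq_zero isPreconnected_Ioi
      (fun x hx => (hder x hx).differentiableAt.differentiableWithinAt)
      (fun x hx => (hder x hx).deriv) hr hs
  have hpt : ∀ m : ℕ, m ≠ 0 → Tendsto (fun r : ℝ => ((r:ℂ) ^ m)⁻¹) atTop (nhds 0) := by
    intro m hm
    have h1 : Tendsto (fun r : ℝ => ((r ^ m)⁻¹ : ℝ)) atTop (nhds 0) :=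
      (tendsto_pow_atTop hm).inv_tendsto_atTop
    have := (Complex.continuous_ofReal.tendsto 0).comp h1
    simpa [Function.comp_def] using this
  have hΦt : Tendsto Φ atTop (nhds 0) := by
    have := ((Cf_tendsto u hlim n).mul (hpt n hn)).add ((hpt (2 * n) (by omega)).const_mul (K / (2 * n)))
    simpa using this
  have hz : ∀ r : ℝ, R < r → Φ r = 0 := by
    intro r hr
    refine tendsto_nhds_unique ?_ hΦt
    refine tendsto_const_nhds.congr' ?_
    filter_upwards [eventually_gt_atTop R] with s hs
    exact hconst r s hr hs
  refine ⟨-(K / (2 * n)), fun r hr => ?_⟩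
  have hr0 : (r:ℂ) ≠ 0 := by exact_mod_cast (hR.trans hr).ne'
  have := hz r hr
  simp only [hΦ] at this
  field_simp at this ⊢
  rw [pow_mul', pow_two] at this
  have hp := pow_ne_zero n hr0
  have h2 : (r:ℂ)^n * (Cf u n r * (2 * n) * r^n + K) = 0 := by
    linear_combination this
  rcases mul_eq_zero.1 h2 with h | h
  · exact absurd h hp
  · linear_combination h

open InnerProductSpace in
lemma Cf_zero (u : ℂ → ℝ) (R : ℝ) (hR : 0 < R) (hu : ∀ z : ℂ, R < ‖z‖ → HarmonicAt u z)
    (hlim : Tendsto u (cocompact ℂ) (nhds 0)) (r : ℝ) (hr : R < r) : Cf u 0 r = 0 := by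
  obtain ⟨K, hK⟩ := Cf_ode u R hR hu 0
  set Φ : ℝ → ℂ := fun r => Cf u 0 r - K * (Real.log r : ℝ) with hΦ
  have hder : ∀ r : ℝ, R < r → HasDerivAt Φ 0 r := by
    intro r hr
    have h1 := ((Real.hasDerivAt_log (hR.trans hr).ne').ofReal_comp).const_mul K
    refine ((hK r hr).sub h1).congr_deriv ?_
    simp [div_eq_mul_inv]
  have hconst : ∀ r s : ℝ, R < r → R < s → Φ r = Φ s := by
    intro r s hr hs
    exact isOpen_Ioi.is_const_of_deriv_eq_zero isPreconnected_Ioi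
      (fun x hx => (hder x hx).differentiableAt.differentiableWithinAt)
      (fun x hx => (hder x hx).deriv) hr hs
  have ht := Cf_tendsto u hlim 0
  have hK0 : K = 0 := by
    -- compare r and 2 r
    have h1 : Tendsto (fun s : ℝ => Cf u 0 (2 * s) - Cf u 0 s) atTop (nhds (0 - 0)) :=
      (ht.comp (tendsto_id.const_mul_atTop (by norm_num : (0:ℝ) < 2))).sub ht
    have h2 : Tendsto (fun s : ℝ => Cf u 0 (2 * s) - Cf u 0 s) atTop (nhds (K * (Real.log 2 : ℝ))) := by
      refine tendsto_const_nhds.congr' ?_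
      filter_upwards [eventually_gt_atTop R] with s hs
      have := hconst (2 * s) s (by linarith) hs
      simp only [hΦ] at this
      rw [Real.log_mul (by norm_num) (hR.trans hs).ne'] at this
      push_cast at this ⊢
      linear_combination -this
    have := tendsto_nhds_unique h2 h1
    rw [sub_zero] at this
    rcases mul_eq_zero.1 this with h | h
    · exact h
    · exact absurd (Complex.ofReal_eq_zero.1 h) (Real.log_pos (by norm_num : (1:ℝ) < 2)).ne'
  refine tendsto_nhds_unique ?_ ht
  refine tendsto_const_nhds.congr' ?_
  filter_upwards [eventually_gt_atTop R] with s hs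
  simpa [hΦ, hK0] using hconst r s hr hs

open InnerProductSpace in
lemma Cf_mono (u : ℂ → ℝ) (R : ℝ) (hR : 0 < R) (hu : ∀ z : ℂ, R < ‖z‖ → HarmonicAt u z)
    (hlim : Tendsto u (cocompact ℂ) (nhds 0)) (n : ℕ) (r s : ℝ) (hr : R < r) (hrs : r ≤ s) :
    s * ‖Cf u n s‖ ≤ r * ‖Cf u n r‖ := by
  have hr0 := hR.trans hr
  have hs := hr.trans_le hrs
  have hs0 := hR.trans hs
  rcases Nat.eq_zero_or_pos n with rfl | hn
  · rw [Cf_zero u R hR hu hlim r hr, Cf_zero u R hR hu hlim s hs]; simp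
  obtain ⟨B, hB⟩ := Cf_form u R hR hu hlim n hn.ne'
  rw [hB r hr, hB s hs, norm_div, norm_div, norm_pow, norm_pow, Complex.norm_real, Complex.norm_real,
    Real.norm_of_nonneg hr0.le, Real.norm_of_nonneg hs0.le]
  obtain ⟨k, rfl⟩ := Nat.exists_eq_succ_of_ne_zero hn.ne'
  rw [Nat.succ_eq_add_one, pow_succ, pow_succ]
  have e : ∀ x : ℝ, 0 < x → x * (‖B‖ / (x ^ k * x)) = ‖B‖ / x ^ k := by
    intro x hx; field_simp
  rw [e r hr0, e s hs0]
  gcongr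

def Mf (u : ℂ → ℝ) (r : ℝ) : ℝ := ∫ θ in (0:ℝ)..(2 * Real.pi), u (circleMap 0 r θ) ^ 2

open InnerProductSpace in
lemma Mf_mono (u : ℂ → ℝ) (R : ℝ) (hR : 0 < R) (hu : ∀ z : ℂ, R < ‖z‖ → HarmonicAt u z)
    (hlim : Tendsto u (cocompact ℂ) (nhds 0)) (r s : ℝ) (hr : R < r) (hrs : r ≤ s) :
    s ^ 2 * Mf u s ≤ r ^ 2 * Mf u r := by
  have hpi : (0:ℝ) < 2 * Real.pi := by positivity
  have co : ∀ r : ℝ, ∀ k : ℤ, ‖fourierCoeffOn hpi (fun θ => (u (circleMap 0 r θ) : ℂ)) k‖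
      = (2 * Real.pi)⁻¹ * ‖Cf u k.natAbs r‖ := by
    intro r k
    rw [fourierCoeffOn_eq_integral, norm_smul]
    have hnn : ‖(1 / (2 * Real.pi - 0) : ℝ)‖ = (2 * Real.pi)⁻¹ := by
      rw [sub_zero, one_div, Real.norm_of_nonneg (by positivity)]
    rw [hnn]
    congr 1
    have hexp : ∀ θ : ℝ, (fourier (-k) (θ : AddCircle (2 * Real.pi - 0)) : ℂ) = Complex.exp (-(k * θ * Complex.I)) := by
      intro θ
      rw [fourier_coe_apply]
      congr 1
      have : (Real.pi : ℂ) ≠ 0 := by exact_mod_cast Real.pi_ne_zero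
      push_cast
      rw [sub_zero]
      field_simp
    have heq : (∫ x in (0:ℝ)..(2 * Real.pi), fourier (-k) (x : AddCircle (2 * Real.pi - 0)) • (u (circleMap 0 r x) : ℂ))
      = ∫ x in (0:ℝ)..(2 * Real.pi), (u (circleMap 0 r x) : ℂ) * Complex.exp (-(k * x * Complex.I)) := by
      simp only [smul_eq_mul, hexp]
      congr 1; ext x; ring
    rw [heq, Cf]
    rcases Int.natAbs_eq k with hk | hk
    · -- conj
      rw [← Complex.norm_conj, intervalIntegral.integral_of_le hpi.le, intervalIntegral.integral_of_le hpi.le,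
        ← integral_conj]
      congr 2; ext x
      have : (k : ℂ) = (k.natAbs : ℂ) := by
        rw [← Int.cast_natCast, ← hk]
      rw [map_mul, Complex.conj_ofReal, ← Complex.exp_conj, this]
      simp
    · have : (k : ℂ) = -(k.natAbs : ℂ) := by
        rw [← Int.cast_natCast, ← Int.cast_neg, ← hk]
      congr 2; ext x
      rw [this]; simp
  have par : ∀ r : ℝ, R < r → HasSum (fun k : ℤ => ((2 * Real.pi)⁻¹ * ‖Cf u k.natAbs r‖) ^ 2) ((2 * Real.pi)⁻¹ * Mf u r) := by
    intro r hr
    have hcu : Continuous (fun θ : ℝ => (u (circleMap 0 r θ) : ℂ)) :=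
      Complex.continuous_ofReal.comp ((cont_u u R hu).comp_continuous (continuous_circleMap 0 r)
        (fun p => norm_cm hR hr _))
    have hL2 : MemLp (fun θ : ℝ => (u (circleMap 0 r θ) : ℂ)) 2 (volume.restrict (Set.Ioc 0 (2 * Real.pi))) := by
      obtain ⟨B, hB⟩ := (isCompact_Icc (a := (0:ℝ)) (b := 2 * Real.pi)).exists_bound_of_continuousOn hcu.continuousOn
      refine MemLp.of_bound hcu.aestronglyMeasurable B ?_
      refine (ae_restrict_iff' measurableSet_Ioc).2 (ae_of_all _ fun x hx => hB x ⟨hx.1.le, hx.2⟩)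
    have := hasSum_sq_fourierCoeffOn hpi hL2
    simp only [co, sub_zero, smul_eq_mul, Complex.norm_real, Real.norm_eq_abs, sq_abs] at this
    exact this
  have hs := hr.trans_le hrs
  have h1 := (par r hr).mul_left (r^2)
  have h2 := (par s hs).mul_left (s^2)
  have := hasSum_le (fun k : ℤ => ?_) h2 h1
  · have h3 : (2 * Real.pi)⁻¹ * (s ^ 2 * Mf u s) ≤ (2 * Real.pi)⁻¹ * (r ^ 2 * Mf u r) := by
      linarith
    exact le_of_mul_le_mul_left h3 (by positivity)
  · have := Cf_mono u R hR hu hlim k.natAbs r s hr hrs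
    have hs0 := hR.trans hs
    have h4 : (s * ‖Cf u k.natAbs s‖)^2 ≤ (r * ‖Cf u k.natAbs r‖)^2 := by
      gcongr
    have h5 : (2 * Real.pi)⁻¹ ^ 2 * (s * ‖Cf u k.natAbs s‖)^2 ≤ (2 * Real.pi)⁻¹ ^ 2 * (r * ‖Cf u k.natAbs r‖)^2 := by
      gcongr
    calc _ = (2 * Real.pi)⁻¹ ^ 2 * (s * ‖Cf u k.natAbs s‖)^2 := by ring
      _ ≤ _ := h5
      _ = _ := by ring

open InnerProductSpace in
lemma Mf_shift (u : ℂ → ℝ) (R : ℝ) (hR : 0 < R) (hu : ∀ z : ℂ, R < ‖z‖ → HarmonicAt u z)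
    (r : ℝ) (hr : R < r) :
    ∫⁻ θ in Set.Ioo (-Real.pi) Real.pi, ENNReal.ofReal (u (circleMap 0 r θ) ^ 2)
      = ENNReal.ofReal (Mf u r) := by
  have hcu : Continuous (fun θ : ℝ => u (circleMap 0 r θ) ^ 2) :=
    ((cont_u u R hu).comp_continuous (continuous_circleMap 0 r) (fun p => norm_cm hR hr _)).pow 2
  have hper : Function.Periodic (fun θ : ℝ => u (circleMap 0 r θ) ^ 2) (2 * Real.pi) := by
    intro θ; simp only [periodic_circleMap 0 r θ]
  have h1 := hper.intervalIntegral_add_eq 0 (-Real.pi)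
  rw [zero_add, show -Real.pi + 2 * Real.pi = Real.pi by ring] at h1
  rw [Mf, h1, intervalIntegral.integral_of_le (by linarith [Real.pi_pos]),
    integral_Ioc_eq_integral_Ioo, ofReal_integral_eq_lintegral_ofReal]
  · exact (hcu.integrableOn_Icc).mono_set Set.Ioo_subset_Icc_self
  · exact ae_of_all _ fun θ => sq_nonneg _

open InnerProductSpace in
lemma polar_annulus (u : ℂ → ℝ) (R : ℝ) (hR : 0 < R) (hu : ∀ z : ℂ, R < ‖z‖ → HarmonicAt u z)
    (a b : ℝ) (ha : R ≤ a) :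
    ∫⁻ z in {z : ℂ | a < ‖z‖ ∧ ‖z‖ < b}, ENNReal.ofReal (u z ^ 2)
      = ∫⁻ r in Set.Ioo a b, ENNReal.ofReal (r * Mf u r) := by
  have hAo : IsOpen {z : ℂ | a < ‖z‖ ∧ ‖z‖ < b} :=
    (isOpen_lt continuous_const continuous_norm).inter (isOpen_lt continuous_norm continuous_const)
  set A := {z : ℂ | a < ‖z‖ ∧ ‖z‖ < b} with hA
  set F : ℂ → ENNReal := A.indicator (fun z => ENNReal.ofReal (u z ^ 2)) with hF
  have hFm : Measurable F := by
    classical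
    rw [hF, ← Set.piecewise_eq_indicator]
    refine ContinuousOn.measurable_piecewise ?_ continuousOn_const hAo.measurableSet
    refine ENNReal.continuous_ofReal.comp_continuousOn ?_
    exact ((cont_u u R hu).mono (fun z hz => lt_of_le_of_lt ha hz.1)).pow 2
  rw [← lintegral_indicator hAo.measurableSet, ← hF, ← Complex.lintegral_comp_polarCoord_symm,
    polarCoord_target, Measure.volume_eq_prod, ← Measure.prod_restrict]
  have hcm : ∀ p : ℝ × ℝ, Complex.polarCoord.symm p = circleMap 0 p.1 p.2 := by
    intro p
    rw [Complex.polarCoord_symm_apply, circleMap, Complex.exp_mul_I]; simp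
  simp only [hcm, smul_eq_mul]
  rw [lintegral_prod _ (by
    refine Measurable.aemeasurable ?_
    exact (ENNReal.measurable_ofReal.comp measurable_fst).mul (hFm.comp cont_cm.measurable))]
  rw [← lintegral_indicator measurableSet_Ioi, ← lintegral_indicator measurableSet_Ioo]
  congr 1; ext r
  by_cases hr : r ∈ Set.Ioo a b
  · have hr0 : 0 < r := hR.trans_le (ha.trans hr.1.le)
    rw [Set.indicator_of_mem hr, Set.indicator_of_mem (show r ∈ Set.Ioi (0:ℝ) from hr0)]
    have : ∀ θ : ℝ, F (circleMap 0 r θ) = ENNReal.ofReal (u (circleMap 0 r θ) ^ 2) := by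
      intro θ
      refine Set.indicator_of_mem ?_ _
      simp only [hA, Set.mem_ofPred_eq, norm_circleMap_zero, abs_of_pos hr0]
      exact hr
    simp only [this]
    rw [lintegral_const_mul' _ _ ENNReal.ofReal_ne_top, Mf_shift u R hR hu r (ha.trans_lt hr.1),
      ENNReal.ofReal_mul hr0.le]
  · rw [Set.indicator_of_notMem hr]
    by_cases hr0 : r ∈ Set.Ioi (0:ℝ)
    · rw [Set.indicator_of_mem hr0]
      have : ∀ θ : ℝ, F (circleMap 0 r θ) = 0 := by
        intro θ
        refine Set.indicator_of_notMem ?_ _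
        simp only [hA, Set.mem_ofPred_eq, norm_circleMap_zero, abs_of_pos (show 0 < r from hr0)]
        exact hr
      simp [this]
    · rw [Set.indicator_of_notMem hr0]

lemma lint_inv (N a b : ℝ) (ha : 0 < a) (hab : a ≤ b) (hN : 0 ≤ N) :
    ∫⁻ r in Set.Ioo a b, ENNReal.ofReal (N * r⁻¹) = ENNReal.ofReal (N * Real.log (b / a)) := by
  rw [← integral_inv_of_pos ha (ha.trans_le hab), ← intervalIntegral.integral_const_mul,
    intervalIntegral.integral_of_le hab, integral_Ioc_eq_integral_Ioo, ofReal_integral_eq_lintegral_ofReal]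
  · refine (ContinuousOn.integrableOn_Icc ?_).mono_set Set.Ioo_subset_Icc_self
    exact continuousOn_const.mul (continuousOn_id.inv₀ (fun x hx => (ha.trans_le hx.1).ne'))
  · refine (ae_restrict_iff' measurableSet_Ioo).2 (ae_of_all _ fun x hx => ?_)
    have := ha.trans hx.1
    simp only [Pi.zero_apply]; positivity

open InnerProductSpace in
lemma annuli (u : ℂ → ℝ) (Rm Rp Re : ℝ) (hR : 0 < Rm) (h1 : Rm < Rp) (h2 : Rp ≤ Re)
    (hu : ∀ z : ℂ, Rm < ‖z‖ → HarmonicAt u z)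
    (hlim : Tendsto u (cocompact ℂ) (nhds 0)) :
    ∃ N : ℝ, 0 ≤ N ∧
      ∫⁻ z in {z : ℂ | Rp < ‖z‖ ∧ ‖z‖ < Re}, ENNReal.ofReal (u z ^ 2)
        ≤ ENNReal.ofReal (N * Real.log (Re / Rp)) ∧
      ENNReal.ofReal (N * Real.log (Rp / Rm)) ≤
        ∫⁻ z in {z : ℂ | Rm < ‖z‖ ∧ ‖z‖ < Rp}, ENNReal.ofReal (u z ^ 2) := by
  have hN : 0 ≤ Rp ^ 2 * Mf u Rp :=
    mul_nonneg (sq_nonneg _) (intervalIntegral.integral_nonneg (by positivity) (fun _ _ => sq_nonneg _))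
  refine ⟨Rp ^ 2 * Mf u Rp, hN, ?_, ?_⟩
  · rw [polar_annulus u Rm hR hu Rp Re h1.le, ← lint_inv _ _ _ (hR.trans h1) h2 hN]
    refine setLIntegral_mono' measurableSet_Ioo fun r hr => ENNReal.ofReal_le_ofReal ?_
    have hr0 : 0 < r := (hR.trans h1).trans hr.1
    have := Mf_mono u Rm hR hu hlim Rp r h1 hr.1.le
    rw [← div_eq_mul_inv, le_div_iff₀ hr0]
    linarith
  · rw [polar_annulus u Rm hR hu Rm Rp le_rfl, ← lint_inv _ _ _ hR h1.le hN]
    refine setLIntegral_mono' measurableSet_Ioo fun r hr => ENNReal.ofReal_le_ofReal ?_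
    have hr0 : 0 < r := hR.trans hr.1
    have := Mf_mono u Rm hR hu hlim r Rp hr.1 hr.2.le
    rw [← div_eq_mul_inv, div_le_iff₀ hr0]
    linarith

abbrev eIso : ℂ ≃ₗᵢ[ℝ] Pt := Complex.orthonormalBasisOneI.repr

open InnerProductSpace in
lemma harm_transfer (h : Pt → ℝ) (c : Pt) (U : Set Pt) (hU : IsOpen U) (hh : IsHarmonicOn h U)
    (z : ℂ) (hz : c + eIso z ∈ U) : HarmonicAt (fun w => h (c + eIso w)) z := by
  have hcont : Continuous (fun w : ℂ => c + eIso w) := continuous_const.add eIso.continuous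
  constructor
  · have h1 : ContDiffAt ℝ 2 h (c + eIso z) := hh.1.contDiffAt (hU.mem_nhds hz)
    exact h1.comp z (contDiffAt_const.add eIso.contDiff.contDiffAt)
  · have hnh : ∀ᶠ w in nhds z, c + eIso w ∈ U := hcont.continuousAt.preimage_mem_nhds (hU.mem_nhds hz)
    filter_upwards [hnh] with w hw
    rw [laplacian_eq_iteratedFDeriv_orthonormalBasis _ Complex.orthonormalBasisOneI]
    rw [Pi.zero_apply, ← hh.2 _ hw, lap]
    refine Finset.sum_congr rfl fun i _ => ?_
    have h2 : iteratedFDeriv ℝ 2 ((fun y => h (c + y)) ∘ eIso.toContinuousLinearEquiv) w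
        = (iteratedFDeriv ℝ 2 (fun y => h (c + y)) (eIso w)).compContinuousLinearMap
          (fun _ => (eIso.toContinuousLinearEquiv : ℂ →L[ℝ] Pt)) := by
      simp only [← iteratedFDerivWithin_univ]
      exact eIso.toContinuousLinearEquiv.iteratedFDerivWithin_comp_right (fun y => h (c + y))
        uniqueDiffOn_univ (Set.mem_univ _) 2
    have h3 : (fun w => h (c + eIso w)) = (fun y => h (c + y)) ∘ eIso.toContinuousLinearEquiv := rfl
    rw [h3, h2, iteratedFDeriv_comp_add_left]
    rw [ContinuousMultilinearMap.compContinuousLinearMap_apply]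
    congr 1
    ext1 j
    have h4 : eIso (Complex.orthonormalBasisOneI i) = EuclideanSpace.single i (1:ℝ) :=
      Complex.orthonormalBasisOneI.repr_self i
    rw [← h4]
    fin_cases j <;> rfl

lemma eL2 (h : Pt → ℝ) (μ : Measure Pt) :
    eLpNorm h 2 μ ^ 2 = ∫⁻ x, ENNReal.ofReal (h x ^ 2) ∂μ := by
  have := eLpNorm_nnreal_pow_eq_lintegral (f := h) (μ := μ) (p := 2) (by norm_num)
  norm_num at this
  rw [this]
  refine lintegral_congr fun x => ?_
  rw [← Real.enorm_of_nonneg (sq_nonneg _), enorm_pow]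

lemma trans_annulus (h : Pt → ℝ) (c : Pt) (a b : ℝ) :
    ∫⁻ z in {z : ℂ | a < ‖z‖ ∧ ‖z‖ < b}, ENNReal.ofReal (h (c + eIso z) ^ 2)
      = ∫⁻ x in {x : Pt | a < dist x c ∧ dist x c < b}, ENNReal.ofReal (h x ^ 2) := by
  have mp : MeasurePreserving (fun z : ℂ => c + eIso z) volume volume :=
    (measurePreserving_add_left volume c).comp eIso.measurePreserving
  have me : MeasurableEmbedding (fun z : ℂ => c + eIso z) :=
    ((Homeomorph.addLeft c).measurableEmbedding).comp eIso.toHomeomorph.measurableEmbedding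
  rw [← mp.setLIntegral_comp_preimage_emb me]
  congr 2
  ext z
  simp [dist_eq_norm]

theorem stmt3 (𝒢 𝒪 : Set Pt) (c : Pt) (Re Ri Rp Rm δ δ₀ : ℝ)
    (geom : Geometry 𝒢 𝒪 c Re Ri Rp Rm δ δ₀)
    (h : Pt → ℝ) (hharm : IsHarmonicOn h (closure 𝒪)ᶜ)
    (hloc : LocallyIntegrableOn (fun x => h x ^ 2) (closure 𝒪)ᶜ)
    (hlim : Tendsto h (cocompact Pt) (nhds 0)) :
    eLpNorm h 2 (volume.restrict ((𝒢 \ closure 𝒪) \ closedBall c Rp)) ^ 2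
        ≤ ENNReal.ofReal (1 / δ) * eLpNorm h 2 (volume.restrict (𝒢 \ closure 𝒪)) ^ 2
      ∧ ENNReal.ofReal (1 - 1 / δ) * eLpNorm h 2 (volume.restrict (𝒢 \ closure 𝒪)) ^ 2
        ≤ eLpNorm h 2 (volume.restrict (ball c Rp \ closure 𝒪)) ^ 2 := by
  have hU : IsOpen (closure 𝒪)ᶜ := isClosed_closure.isOpen_compl
  have hRm := geom.Rm_pos
  have hRp : 0 < Rp := hRm.trans geom.Rm_lt_Rp
  have hRe : 0 < Re := hRp.trans (geom.Rp_lt_Ri.trans geom.Ri_lt_Re)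
  have hRi : 0 < Ri := hRp.trans geom.Rp_lt_Ri
  have hδ : 2 < δ := by
    have h1 := geom.δ₀_lt_δ
    rw [geom.δ₀_eq] at h1
    have := Real.log_pos ((one_lt_div hRi).2 geom.Ri_lt_Re)
    linarith
  have hout : ∀ x : Pt, Rm < dist x c → x ∉ closure 𝒪 := by
    intro x hx hx2
    have := geom.clO_sub hx2
    rw [mem_ball] at this
    linarith
  have hu : ∀ z : ℂ, Rm < ‖z‖ → InnerProductSpace.HarmonicAt (fun w => h (c + eIso w)) z := by
    intro z hz
    refine harm_transfer h c _ hU hharm z (hout _ ?_)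
    simpa [dist_eq_norm] using hz
  have hl : Tendsto (fun w => h (c + eIso w)) (cocompact ℂ) (nhds 0) := by
    refine hlim.comp ?_
    exact (eIso.toHomeomorph.trans (Homeomorph.addLeft c)).isClosedEmbedding.tendsto_cocompact
  obtain ⟨N, hN, hA, hB⟩ := annuli (fun w => h (c + eIso w)) Rm Rp Re hRm geom.Rm_lt_Rp
    (geom.Rp_lt_Ri.trans geom.Ri_lt_Re).le hu hl
  rw [trans_annulus] at hA hB
  have l1 : Real.log (Re / Rp) = δ := by
    rw [geom.Rp_eq, ← div_div, div_self hRe.ne', one_div, ← Real.exp_neg, Real.log_exp, neg_neg]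
  have l2 : Real.log (Rp / Rm) = δ ^ 2 - δ := by
    rw [geom.Rp_eq, geom.Rm_eq, mul_div_mul_left _ _ hRe.ne', ← Real.exp_sub, Real.log_exp]
    ring
  rw [l1] at hA
  rw [l2] at hB
  simp only [eL2]
  set f : Pt → ENNReal := fun x => ENNReal.ofReal (h x ^ 2) with hf
  set A := ∫⁻ x in (𝒢 \ closure 𝒪) \ closedBall c Rp, f x with hAdef
  set T := ∫⁻ x in 𝒢 \ closure 𝒪, f x with hTdef
  set S := ∫⁻ x in ball c Rp \ closure 𝒪, f x with hSdef
  set B := ∫⁻ x in {x : Pt | Rm < dist x c ∧ dist x c < Rp}, f x with hBdef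
  have hBS : B ≤ S := by
    refine lintegral_mono_set fun x hx => ⟨hx.2, hout x hx.1⟩
  have hAle : A ≤ ENNReal.ofReal (N * δ) := by
    have hsub : (𝒢 \ closure 𝒪) \ closedBall c Rp ⊆ {x : Pt | Rp < dist x c ∧ dist x c < Re} := by
      intro x hx
      refine ⟨?_, geom.clG_sub (subset_closure hx.1.1)⟩
      simpa using hx.2
    exact le_trans (lintegral_mono_set hsub) hA
  have hAB : ENNReal.ofReal (δ - 1) * A ≤ B := by
    refine le_trans ?_ hB
    calc ENNReal.ofReal (δ - 1) * A ≤ ENNReal.ofReal (δ - 1) * ENNReal.ofReal (N * δ) := by gcongr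
      _ = ENNReal.ofReal (N * (δ ^ 2 - δ)) := by
        rw [← ENNReal.ofReal_mul (by linarith)]; congr 1; ring
  have hTle : T ≤ A + S := by
    have hs : 𝒢 \ closure 𝒪 ⊆ (((𝒢 \ closure 𝒪) \ closedBall c Rp) ∪ (ball c Rp \ closure 𝒪)) ∪ sphere c Rp := by
      intro x hx
      rcases lt_trichotomy (dist x c) Rp with h1 | h1 | h1
      · exact Or.inl (Or.inr ⟨h1, hx.2⟩)
      · exact Or.inr h1
      · exact Or.inl (Or.inl ⟨hx, by simpa using h1⟩)
    refine (lintegral_mono_set hs).trans ((lintegral_union_le _ _ _).trans ?_)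
    rw [setLIntegral_measure_zero (sphere c Rp) f (Measure.addHaar_sphere volume c Rp), add_zero]
    exact lintegral_union_le _ _ _
  have hTge : A + B ≤ T := by
    have hms : MeasurableSet {x : Pt | Rm < dist x c ∧ dist x c < Rp} :=
      ((isOpen_lt continuous_const (continuous_id.dist continuous_const)).inter
        (isOpen_lt (continuous_id.dist continuous_const) continuous_const)).measurableSet
    rw [hAdef, hBdef, ← lintegral_union hms]
    · refine lintegral_mono_set ?_
      rintro x (hx | hx)
      · exact hx.1
      · refine ⟨geom.clDi_sub ?_, hout x hx.1⟩
        rw [mem_closedBall]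
        linarith [hx.2, geom.Rp_lt_Ri]
    · rw [Set.disjoint_left]
      intro x hx hx2
      exact hx.2 (mem_closedBall.2 hx2.2.le)
  have hδ0 : 0 < δ := by linarith
  have hinv : 0 ≤ 1 / δ := by positivity
  have hm : 0 ≤ 1 - 1 / δ := by
    rw [sub_nonneg, div_le_one hδ0]; linarith
  constructor
  · calc A = ENNReal.ofReal (1 / δ) * (ENNReal.ofReal δ * A) := by
          rw [← mul_assoc, ← ENNReal.ofReal_mul hinv, one_div, inv_mul_cancel₀ hδ0.ne',
            ENNReal.ofReal_one, one_mul]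
      _ = ENNReal.ofReal (1 / δ) * (A + ENNReal.ofReal (δ - 1) * A) := by
          congr 1
          conv_lhs => rw [show δ = 1 + (δ - 1) by ring,
            ENNReal.ofReal_add (by norm_num) (by linarith), ENNReal.ofReal_one, add_mul, one_mul]
      _ ≤ ENNReal.ofReal (1 / δ) * T := by
          gcongr
          exact le_trans (by gcongr) hTge
  · calc ENNReal.ofReal (1 - 1 / δ) * T ≤ ENNReal.ofReal (1 - 1 / δ) * (A + S) := by gcongr
      _ = ENNReal.ofReal (1 / δ) * (ENNReal.ofReal (δ - 1) * A) + ENNReal.ofReal (1 - 1 / δ) * S := by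
          rw [mul_add, ← mul_assoc, ← ENNReal.ofReal_mul hinv]
          congr 3
          field_simp
      _ ≤ ENNReal.ofReal (1 / δ) * S + ENNReal.ofReal (1 - 1 / δ) * S := by
          gcongr
          exact hAB.trans hBS
      _ = S := by
          rw [← add_mul, ← ENNReal.ofReal_add hinv hm]
          simp
end
end

section
/- Under the Geometry hypothesis, every function h that is harmonic on 𝒢 and square-integrable on 𝒢 satisfies ‖h‖²_{L²(ℱ_Σ)} ≤ (R_+²/(R_i² − R_-²)) · ‖h‖²_{L²(ℱ)} and ‖h‖²_{L²(ℱ_Γ)} ≥ ((R_i² − (R_-² + R_+²))/(R_i² − R_-²)) · ‖h‖²_{L²(ℱ)}. (Estimates (3.8) of Lemma 3.3.) -/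
open MeasureTheory Metric Filter

noncomputable section

lemma core_diff (f : ℂ → ℂ) (R' : ℝ) (hf : DifferentiableOn ℂ f (ball 0 R'))
    (v : ℂ → ℂ) (hv : ContinuousOn v (closedBall 0 1)) :
    DifferentiableOn ℂ (fun w => ∫ y in closedBall (0:ℂ) 1, f (w * y) * v y) (ball 0 R') := by
  intro w0 hw0
  rw [mem_ball_zero_iff] at hw0
  obtain ⟨ρ, h1, h2⟩ := exists_between hw0
  have hf' : DifferentiableOn ℂ (deriv f) (ball 0 R') := hf.deriv isOpen_ball
  have hsub : closedBall (0:ℂ) ρ ⊆ ball 0 R' := closedBall_subset_ball h2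
  obtain ⟨M, hM⟩ := (isCompact_closedBall (0:ℂ) ρ).exists_bound_of_continuousOn
    (hf'.continuousOn.mono hsub)
  obtain ⟨M2, hM2⟩ := (isCompact_closedBall (0:ℂ) 1).exists_bound_of_continuousOn hv
  have hmul : ∀ w ∈ ball (0:ℂ) ρ, ∀ y ∈ closedBall (0:ℂ) 1, w * y ∈ closedBall (0:ℂ) ρ := by
    intro w hw y hy
    simp only [mem_ball_zero_iff, mem_closedBall_zero_iff, norm_mul] at *
    nlinarith [norm_nonneg w, norm_nonneg y]
  have hcomp : ∀ g : ℂ → ℂ, ContinuousOn g (ball 0 R') → ∀ w ∈ ball (0:ℂ) ρ,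
      ContinuousOn (fun y => g (w * y)) (closedBall 0 1) := by
    intro g hg w hw
    exact hg.comp (by fun_prop) (fun y hy => hsub (hmul w hw y hy))
  have hw0' : w0 ∈ ball (0:ℂ) ρ := by simpa using h1
  have key := hasDerivAt_integral_of_dominated_loc_of_deriv_le
    (μ := volume.restrict (closedBall (0:ℂ) 1)) (𝕜 := ℂ) (F := fun w y => f (w * y) * v y)
    (F' := fun w y => (deriv f (w * y) * y) * v y) (x₀ := w0) (s := ball 0 ρ)
    (bound := fun _ => M * M2)
    (isOpen_ball.mem_nhds hw0')
    (by
      filter_upwards [isOpen_ball.mem_nhds hw0'] with w hw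
      exact ((hcomp f hf.continuousOn w hw).mul hv).aestronglyMeasurable measurableSet_closedBall)
    (((hcomp f hf.continuousOn w0 hw0').mul hv).integrableOn_compact (isCompact_closedBall _ _))
    ((((hcomp _ hf'.continuousOn w0 hw0').mul continuousOn_id).mul hv).aestronglyMeasurable
      measurableSet_closedBall)
    (by
      filter_upwards [ae_restrict_mem measurableSet_closedBall] with y hy w hw
      have a1 := hM _ (hmul w hw y hy)
      have a2 := hM2 y hy
      rw [norm_mul, norm_mul]
      have hy' : ‖y‖ ≤ 1 := by simpa using hy
      have := norm_nonneg (deriv f (w*y))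
      have := norm_nonneg (v y)
      have := norm_nonneg y
      gcongr
      · linarith
      · nlinarith)
    (integrableOn_const (isCompact_closedBall (0:ℂ) 1).measure_lt_top.ne)
    (by
      filter_upwards [ae_restrict_mem measurableSet_closedBall] with y hy w hw
      have hd : HasDerivAt f (deriv f (w*y)) (w*y) :=
        (hf.differentiableAt (isOpen_ball.mem_nhds (hsub (hmul w hw y hy)))).hasDerivAt
      have hl : HasDerivAt (fun w : ℂ => w * y) y w := by
        simpa using (hasDerivAt_id w).mul_const y
      exact (hd.comp w hl).mul_const (v y))
  exact key.2.differentiableAt.differentiableWithinAt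

lemma core_rot (g : ℂ → ℝ) (R : ℝ) (w : ℂ) (hR : 0 < R) (hw : ‖w‖ = R) :
    ∫ y in closedBall (0:ℂ) 1, g (w * y) = ∫ y in closedBall (0:ℂ) 1, g (R * y) := by
  have hR0 : (R:ℂ) ≠ 0 := by exact_mod_cast hR.ne'
  let a : Circle := ⟨w / R, by
    change w / R ∈ sphere (0:ℂ) 1
    rw [mem_sphere_zero_iff_norm, norm_div, hw]; simp [abs_of_pos hR, hR.ne']⟩
  have ha : ∀ y, rotation a y = w / R * y := fun y => rfl
  have mp := (rotation a).measurePreserving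
  have := mp.setIntegral_preimage_emb (rotation a).toHomeomorph.measurableEmbedding
    (fun y => g (R * y)) (closedBall (0:ℂ) 1)
  rw [← this]
  have hp : (rotation a) ⁻¹' closedBall (0:ℂ) 1 = closedBall 0 1 := by
    ext y
    rw [Set.mem_preimage, mem_closedBall_zero_iff, mem_closedBall_zero_iff, LinearIsometryEquiv.norm_map]
  rw [hp]
  congr 1
  ext y
  rw [ha]
  congr 1
  field_simp

lemma core (f : ℂ → ℂ) (r R R' : ℝ) (hf : DifferentiableOn ℂ f (ball 0 R'))
    (hr : 0 < r) (hrR : r ≤ R) (hR : R < R') :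
    ∫ y in closedBall (0:ℂ) 1, (f (r * y)).re ^ 2 ≤ ∫ y in closedBall (0:ℂ) 1, (f (R * y)).re ^ 2 := by
  have hR0 : 0 < R := hr.trans_le hrR
  have hcf : ∀ w : ℂ, ‖w‖ ≤ R → ContinuousOn (fun y => f (w * y)) (closedBall 0 1) := by
    intro w hw
    refine hf.continuousOn.comp (by fun_prop) (fun y hy => ?_)
    simp only [mem_ball_zero_iff, mem_closedBall_zero_iff, norm_mul] at *
    nlinarith [norm_nonneg w, norm_nonneg y]
  have hcr : ∀ w : ℂ, ‖w‖ ≤ R → ContinuousOn (fun y => (f (w * y)).re) (closedBall 0 1) :=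
    fun w hw => Complex.continuous_re.comp_continuousOn (hcf w hw)
  have hrn : ‖(r:ℂ)‖ ≤ R := by simpa [abs_of_pos hr] using hrR
  let v : ℂ → ℂ := fun y => ((f (r * y)).re : ℂ)
  have hv : ContinuousOn v (closedBall 0 1) :=
    Complex.continuous_ofReal.comp_continuousOn (hcr r hrn)
  have hG := core_diff f R' hf v hv
  set G := fun w => ∫ y in closedBall (0:ℂ) 1, f (w * y) * v y with hGdef
  have hre : ∀ w : ℂ, ‖w‖ ≤ R → (G w).re = ∫ y in closedBall (0:ℂ) 1, (f (w * y)).re * (f (r * y)).re := by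
    intro w hw
    have hi : IntegrableOn (fun y => f (w * y) * v y) (closedBall (0:ℂ) 1) :=
      ((hcf w hw).mul hv).integrableOn_compact (isCompact_closedBall _ _)
    have := integral_re (𝕜 := ℂ) hi
    simp only [RCLike.re_eq_complex_re] at this
    rw [hGdef]
    simp only
    rw [← this]
    simp [v]
  have hint : ∀ w : ℂ, ‖w‖ ≤ R → IntegrableOn (fun y => (f (w * y)).re ^ 2) (closedBall (0:ℂ) 1) :=
    fun w hw => ((hcr w hw).pow 2).integrableOn_compact (isCompact_closedBall _ _)
  set N := fun s : ℝ => ∫ y in closedBall (0:ℂ) 1, (f (s * y)).re ^ 2 with hN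
  have hb : ∀ w : ℂ, ‖w‖ = R → (G w).re ≤ (N R + N r) / 2 := by
    intro w hw
    rw [hre w hw.le]
    have e1 : N R = ∫ y in closedBall (0:ℂ) 1, (f (w * y)).re ^ 2 :=
      (core_rot (fun z => (f z).re ^ 2) R w hR0 hw).symm
    rw [e1, hN]
    simp only
    rw [← integral_add (hint w hw.le) (hint r hrn), ← integral_div]
    refine integral_mono ?_ (((hint w hw.le).add (hint r hrn)).div_const 2) ?_
    · exact ((hcr w hw.le).mul (hcr r hrn)).integrableOn_compact (isCompact_closedBall _ _)
    · intro y
      simp only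
      nlinarith [sq_nonneg ((f (w * y)).re - (f (r * y)).re)]
  have hE : DifferentiableOn ℂ (fun w => Complex.exp (G w)) (ball 0 R') := hG.cexp
  have hd : DiffContOnCl ℂ (fun w => Complex.exp (G w)) (ball 0 R) :=
    hE.diffContOnCl_ball (closedBall_subset_ball hR)
  have hmax := Complex.norm_le_of_forall_mem_frontier_norm_le (isBounded_ball) hd
    (C := Real.exp ((N R + N r) / 2)) (fun z hz => by
      rw [frontier_ball _ hR0.ne', mem_sphere_zero_iff_norm] at hz
      rw [Complex.norm_exp]
      exact Real.exp_le_exp.2 (hb z hz)) (z := (r:ℂ)) (by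
      rw [closure_ball _ hR0.ne']; simpa using hrn)
  rw [Complex.norm_exp, Real.exp_le_exp, hre r hrn] at hmax
  have : ∫ y in closedBall (0:ℂ) 1, (f (r * y)).re * (f (r * y)).re = N r := by
    simp only [hN, sq]
  rw [this] at hmax
  show N r ≤ N R
  linarith

/-- The isometry between the complex plane and the Euclidean plane. -/
def cpt : ℂ ≃ₗᵢ[ℝ] Pt := Complex.orthonormalBasisOneI.repr

lemma lap_comp (h : Pt → ℝ) (c : Pt) (z : ℂ) :
    Laplacian.laplacian (fun z : ℂ => h (c + cpt z)) z = lap h (c + cpt z) := by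
  have e : (fun z : ℂ => h (c + cpt z)) = (fun x => h (c + x)) ∘ cpt.toContinuousLinearEquiv := rfl
  rw [InnerProductSpace.laplacian_eq_iteratedFDeriv_orthonormalBasis _ Complex.orthonormalBasisOneI]
  simp only [lap]
  refine Finset.sum_congr rfl fun i _ => ?_
  rw [e, ← iteratedFDerivWithin_univ]
  have := cpt.toContinuousLinearEquiv.iteratedFDerivWithin_comp_right (fun x => h (c + x))
    uniqueDiffOn_univ (x := z) (Set.mem_univ _) 2
  rw [Set.preimage_univ] at this
  rw [this, iteratedFDerivWithin_univ, iteratedFDeriv_comp_add_left']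
  rw [ContinuousMultilinearMap.compContinuousLinearMap_apply]
  congr 1
  have : cpt (Complex.orthonormalBasisOneI i) = EuclideanSpace.single i 1 := by
    exact Complex.orthonormalBasisOneI.repr_self i
  funext j
  fin_cases j <;> exact this

lemma harm_comp (h : Pt → ℝ) (U : Set Pt) (hU : IsOpen U) (hh : IsHarmonicOn h U) (c : Pt) (z : ℂ)
    (hz : c + cpt z ∈ U) : InnerProductSpace.HarmonicAt (fun z : ℂ => h (c + cpt z)) z := by
  refine ⟨?_, ?_⟩
  · have h1 : ContDiffAt ℝ 2 h (c + cpt z) := hh.1.contDiffAt (hU.mem_nhds hz)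
    have h2 : ContDiff ℝ 2 (fun z : ℂ => c + cpt z) :=
      contDiff_const.add cpt.toContinuousLinearEquiv.contDiff
    exact ContDiffAt.comp (g := h) z h1 h2.contDiffAt
  · have hc : Continuous (fun z : ℂ => c + cpt z) := continuous_const.add cpt.continuous
    filter_upwards [hc.continuousAt.preimage_mem_nhds (hU.mem_nhds hz)] with y hy
    rw [lap_comp]
    exact hh.2 _ hy

lemma int_comp (g : Pt → ℝ) (c : Pt) (r : ℝ) (hr : 0 < r) :
    ∫ x in closedBall c r, g x = r ^ 2 * ∫ y in closedBall (0:ℂ) 1, g (c + cpt (r * y)) := by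
  have e1 : MeasurePreserving (fun z : ℂ => c + cpt z) volume volume :=
    (measurePreserving_add_left volume c).comp cpt.measurePreserving
  have e2 : MeasurableEmbedding (fun z : ℂ => c + cpt z) :=
    (measurableEmbedding_addLeft c).comp cpt.toHomeomorph.measurableEmbedding
  have e3 : (fun z : ℂ => c + cpt z) ⁻¹' (closedBall c r) = closedBall 0 r := by
    ext y
    simp only [Set.mem_preimage, mem_closedBall, dist_self_add_left, LinearIsometryEquiv.norm_map,
      dist_zero_right]
  rw [← e1.setIntegral_preimage_emb e2, e3]
  have := Measure.setIntegral_comp_smul_of_pos (volume : Measure ℂ) (fun z => g (c + cpt z))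
    (closedBall 0 1) hr
  simp only [Complex.real_smul, Complex.finrank_real_complex] at this
  rw [this, _root_.smul_closedBall _ _ zero_le_one]
  simp [abs_of_pos hr, hr.ne']

lemma mono_avg (𝒢 : Set Pt) (hG : IsOpen 𝒢) (c : Pt) (r R : ℝ) (hr : 0 < r) (hrR : r ≤ R)
    (hsub : closedBall c R ⊆ 𝒢) (h : Pt → ℝ) (hharm : IsHarmonicOn h 𝒢) :
    R ^ 2 * ∫ x in closedBall c r, h x ^ 2 ≤ r ^ 2 * ∫ x in closedBall c R, h x ^ 2 := by
  have hR0 : 0 < R := hr.trans_le hrR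
  obtain ⟨d, hd, hdG⟩ := (isCompact_closedBall c R).exists_thickening_subset_open hG hsub
  have hb : ball c (R + d) ⊆ 𝒢 := by
    rw [thickening_closedBall hd hR0.le, add_comm] at hdG
    exact hdG
  have hH : InnerProductSpace.HarmonicOnNhd (fun z : ℂ => h (c + cpt z)) (ball 0 (R + d)) := by
    intro z hz
    refine harm_comp h 𝒢 hG hharm c z (hb ?_)
    rw [mem_ball, dist_self_add_left, LinearIsometryEquiv.norm_map]
    simpa using hz
  obtain ⟨F, hF, hFe⟩ := hH.exists_analyticOnNhd_ball_re_eq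
  have key := core F r R (R + d) hF.differentiableOn hr hrR (by linarith)
  rw [int_comp _ c r hr, int_comp _ c R hR0]
  have conv : ∀ s : ℝ, 0 < s → s ≤ R → ∫ y in closedBall (0:ℂ) 1, (F (s * y)).re ^ 2
      = ∫ y in closedBall (0:ℂ) 1, h (c + cpt (s * y)) ^ 2 := by
    intro s hs hsR
    refine setIntegral_congr_fun measurableSet_closedBall fun y hy => ?_
    have : (F (s * y)).re = h (c + cpt (s * y)) := hFe (by
      simp only [mem_ball_zero_iff, mem_closedBall_zero_iff, norm_mul, Complex.norm_real,
        Real.norm_eq_abs, abs_of_pos hs] at *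
      nlinarith [norm_nonneg y])
    simp only [this]
  rw [conv r hr hrR, conv R hR0 le_rfl] at key
  have : 0 ≤ R ^ 2 * r ^ 2 := by positivity
  nlinarith

theorem stmt4 (𝒢 𝒪 : Set Pt) (c : Pt) (Re Ri Rp Rm δ δ₀ : ℝ)
    (geom : Geometry 𝒢 𝒪 c Re Ri Rp Rm δ δ₀)
    (h : Pt → ℝ) (hharm : IsHarmonicOn h 𝒢)
    (hL2 : IntegrableOn (fun x => h x ^ 2) 𝒢) :
    (∫ x in ball c Rp \ closure 𝒪, h x ^ 2)
        ≤ Rp ^ 2 / (Ri ^ 2 - Rm ^ 2) * ∫ x in 𝒢 \ closure 𝒪, h x ^ 2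
      ∧ (Ri ^ 2 - (Rm ^ 2 + Rp ^ 2)) / (Ri ^ 2 - Rm ^ 2) * (∫ x in 𝒢 \ closure 𝒪, h x ^ 2)
        ≤ ∫ x in (𝒢 \ closure 𝒪) \ closedBall c Rp, h x ^ 2 := by
  have hm := geom.Rm_pos
  have hmp := geom.Rm_lt_Rp
  have hpi := geom.Rp_lt_Ri
  have hiG := geom.clDi_sub
  have hpG : closedBall c Rp ⊆ 𝒢 := (closedBall_subset_closedBall hpi.le).trans hiG
  have hnn : ∀ s : Set Pt, 0 ≤ᵐ[volume.restrict s] fun x => h x ^ 2 :=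
    fun s => Eventually.of_forall fun x => sq_nonneg _
  have mono : ∀ s t : Set Pt, s ⊆ t → t ⊆ 𝒢 → ∫ x in s, h x ^ 2 ≤ ∫ x in t, h x ^ 2 :=
    fun s t hst ht => setIntegral_mono_set (hL2.mono_set ht) (hnn t)
      (Eventually.of_forall hst)
  have mO : MeasurableSet (closure 𝒪) := isClosed_closure.measurableSet
  have hOm : closure 𝒪 ⊆ closedBall c Rm := geom.clO_sub.trans ball_subset_closedBall
  have hOp : closure 𝒪 ⊆ closedBall c Rp := hOm.trans (closedBall_subset_closedBall hmp.le)
  have k1 := mono_avg 𝒢 geom.openG c Rp Ri (by linarith) hpi.le hiG h hharm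
  have k2 := mono_avg 𝒢 geom.openG c Rm Ri hm (by linarith) hiG h hharm
  have m1 := mono _ _ hiG subset_rfl
  have m2 := mono _ _ hOm ((closedBall_subset_closedBall (hmp.trans hpi).le).trans hiG)
  have d1 : ∫ x in 𝒢 \ closure 𝒪, h x ^ 2 = (∫ x in 𝒢, h x ^ 2) - ∫ x in closure 𝒪, h x ^ 2 :=
    setIntegral_diff mO hL2 geom.clO_sub_G
  have d2 : ∫ x in closedBall c Rp \ closure 𝒪, h x ^ 2
      = (∫ x in closedBall c Rp, h x ^ 2) - ∫ x in closure 𝒪, h x ^ 2 :=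
    setIntegral_diff mO (hL2.mono_set hpG) hOp
  have d3 : ∫ x in (𝒢 \ closure 𝒪) \ (closedBall c Rp \ closure 𝒪), h x ^ 2
      = (∫ x in 𝒢 \ closure 𝒪, h x ^ 2) - ∫ x in closedBall c Rp \ closure 𝒪, h x ^ 2 :=
    setIntegral_diff (measurableSet_closedBall.diff mO) (hL2.mono_set Set.diff_subset)
      (Set.diff_subset_diff_left hpG)
  have s3 : (𝒢 \ closure 𝒪) \ (closedBall c Rp \ closure 𝒪) = (𝒢 \ closure 𝒪) \ closedBall c Rp := by
    ext x; simp only [Set.mem_diff]; tauto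
  rw [s3] at d3
  have m3 : ∫ x in ball c Rp \ closure 𝒪, h x ^ 2 ≤ ∫ x in closedBall c Rp \ closure 𝒪, h x ^ 2 :=
    mono _ _ (Set.diff_subset_diff_left ball_subset_closedBall) (Set.diff_subset.trans hpG)
  have hA : 0 ≤ ∫ x in closure 𝒪, h x ^ 2 := integral_nonneg fun x => sq_nonneg _
  set G := ∫ x in 𝒢, h x ^ 2
  set A := ∫ x in closure 𝒪, h x ^ 2
  set P := ∫ x in closedBall c Rp, h x ^ 2
  set I := ∫ x in closedBall c Ri, h x ^ 2
  set M := ∫ x in closedBall c Rm, h x ^ 2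
  have hden : 0 < Ri ^ 2 - Rm ^ 2 := by nlinarith
  have hi2 : 0 < Ri ^ 2 := by nlinarith
  have a1 : Ri ^ 2 * P ≤ Rp ^ 2 * G := k1.trans (by gcongr)
  have a2 : Ri ^ 2 * A ≤ Rm ^ 2 * G :=
    (mul_le_mul_of_nonneg_left m2 hi2.le).trans (k2.trans (by gcongr))
  have main : P - A ≤ Rp ^ 2 / (Ri ^ 2 - Rm ^ 2) * (G - A) := by
    rw [div_mul_eq_mul_div, le_div_iff₀ hden]
    have b1 : (Ri ^ 2 - Rm ^ 2) * (Ri ^ 2 * P) ≤ (Ri ^ 2 - Rm ^ 2) * (Rp ^ 2 * G) := by gcongr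
    have b2 : Rp ^ 2 * (Ri ^ 2 * A) ≤ Rp ^ 2 * (Rm ^ 2 * G) := by gcongr
    have b3 : Ri ^ 2 * (P * (Ri ^ 2 - Rm ^ 2)) ≤ Ri ^ 2 * (Rp ^ 2 * (G - A)) := by linarith
    have b4 := le_of_mul_le_mul_left b3 hi2
    have b5 : 0 ≤ A * (Ri ^ 2 - Rm ^ 2) := by positivity
    linarith
  rw [d1]
  refine ⟨by linarith, ?_⟩
  rw [d3, d1, d2]
  have : (Ri ^ 2 - (Rm ^ 2 + Rp ^ 2)) / (Ri ^ 2 - Rm ^ 2) = 1 - Rp ^ 2 / (Ri ^ 2 - Rm ^ 2) := by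
    field_simp
    ring
  rw [this]
  linarith
end
end

section
/- Let c ∈ ℝ² and 0 < ρ < R. If h is harmonic on ℝ² ∖ closure(D(c,ρ)) and has finite Dirichlet energy there, i.e. ∫_{ℝ² ∖ closure(D(c,ρ))} |∇h|² dx < ∞, then ∫_{|x−c| > R} |∇h(x)|² dx ≤ (ρ²/(R² − ρ²)) · ∫_{ρ < |x−c| < R} |∇h(x)|² dx. -/
open MeasureTheory Metric Filter

noncomputable section

def MM (f : ℂ → ℂ) (r : ℝ) : ℝ :=
  ∫ θ in (-Real.pi)..Real.pi, ‖f ((r : ℂ) * Complex.exp (θ * Complex.I))‖ ^ 2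

theorem norm_mul_exp (w : ℂ) (θ : ℝ) : ‖w * Complex.exp (θ * Complex.I)‖ = ‖w‖ := by
  rw [norm_mul, Complex.norm_exp_ofReal_mul_I, mul_one]

theorem MM_shift (f : ℂ → ℂ) (r φ : ℝ) :
    ∫ θ in (-Real.pi)..Real.pi,
      ‖f (((r : ℂ) * Complex.exp (φ * Complex.I)) * Complex.exp (θ * Complex.I))‖ ^ 2 = MM f r := by
  unfold MM
  have hper : Function.Periodic
      (fun θ : ℝ => ‖f ((r : ℂ) * Complex.exp (θ * Complex.I))‖ ^ 2) (2 * Real.pi) := by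
    intro θ
    simp only
    congr 4
    push_cast
    rw [add_mul, Complex.exp_add, Complex.exp_two_pi_mul_I, mul_one]
  have h1 := intervalIntegral.integral_comp_add_right (a := -Real.pi) (b := Real.pi)
    (fun θ : ℝ => ‖f ((r : ℂ) * Complex.exp (θ * Complex.I))‖ ^ 2) φ
  have h2 := hper.intervalIntegral_add_eq (-Real.pi + φ) (-Real.pi)
  rw [show -Real.pi + φ + 2 * Real.pi = Real.pi + φ by ring,
    show -Real.pi + 2 * Real.pi = Real.pi by ring] at h2
  rw [← h2, ← h1]
  congr 1
  ext θ
  congr 3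
  push_cast
  rw [add_mul, Complex.exp_add]
  ring

theorem cont_circle {f : ℂ → ℂ} {w : ℂ} (hf : ContinuousOn f {z | ‖z‖ = ‖w‖}) :
    Continuous (fun θ : ℝ => f (w * Complex.exp (θ * Complex.I))) := by
  apply hf.comp_continuous (by fun_prop)
  intro θ
  exact norm_mul_exp w θ

theorem MM_mono {G : ℂ → ℂ} {T : ℝ} (hG : DifferentiableOn ℂ G (ball 0 T)) {s S : ℝ}
    (hs : 0 ≤ s) (hsS : s ≤ S) (hST : S < T) : MM G s ≤ MM G S := by
  rcases hsS.eq_or_lt with rfl | hlt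
  · exact le_rfl
  have hcont : ∀ w : ℂ, ‖w‖ < T →
      Continuous (fun θ : ℝ => G (w * Complex.exp (θ * Complex.I))) := by
    intro w hw
    apply cont_circle
    apply hG.continuousOn.mono
    intro z hz
    simp only [Set.mem_ofPred_eq] at hz
    simpa [hz] using hw
  have hdG : DifferentiableOn ℂ (deriv G) (ball 0 T) := hG.deriv isOpen_ball
  have hcontd : ∀ w : ℂ, ‖w‖ < T →
      Continuous (fun θ : ℝ => deriv G (w * Complex.exp (θ * Complex.I))) := by
    intro w hw
    apply cont_circle
    apply hdG.continuousOn.mono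
    intro z hz
    simp only [Set.mem_ofPred_eq] at hz
    simpa [hz] using hw
  have hs' : ‖(s : ℂ)‖ = s := by simp [abs_of_nonneg hs]
  have hS' : ‖(S : ℂ)‖ = S := by simp [abs_of_nonneg (hs.trans hsS)]
  have hcs := hcont s (by rw [hs']; linarith)
  set k : ℝ → ℂ := fun θ => (starRingEnd ℂ) (G ((s : ℂ) * Complex.exp (θ * Complex.I))) with hk
  have hkc : Continuous k := Complex.continuous_conj.comp hcs
  set Ψ : ℂ → ℂ := fun w => ∫ θ in (-Real.pi)..Real.pi, G (w * Complex.exp (θ * Complex.I)) * k θ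
  have hΨ : DifferentiableOn ℂ Ψ (ball 0 T) := by
    intro w hw
    have hw' : ‖w‖ < T := by simpa using hw
    obtain ⟨r, hwr, hrT⟩ := exists_between hw'
    have hcomp : IsCompact (closedBall (0 : ℂ) r) := isCompact_closedBall _ _
    have hsub : closedBall (0 : ℂ) r ⊆ ball 0 T := closedBall_subset_ball hrT
    obtain ⟨C, hC⟩ := hcomp.exists_bound_of_continuousOn (hdG.continuousOn.mono hsub)
    refine (intervalIntegral.hasDerivAt_integral_of_dominated_loc_of_deriv_le
      (F := fun w θ => G (w * Complex.exp ((θ : ℝ) * Complex.I)) * k θ)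
      (F' := fun w θ => (deriv G (w * Complex.exp ((θ : ℝ) * Complex.I)) *
        Complex.exp ((θ : ℝ) * Complex.I)) * k θ)
      (s := ball 0 r) (bound := fun θ => C * ‖k θ‖)
      (isOpen_ball.mem_nhds (by simpa using hwr)) ?_ ?_ ?_ ?_ ?_
      ?_).2.differentiableAt.differentiableWithinAt
    · filter_upwards [isOpen_ball.mem_nhds hw] with x hx
      exact ((hcont x (by simpa using hx)).mul hkc).aestronglyMeasurable
    · exact ((hcont w hw').mul hkc).intervalIntegrable _ _
    · exact (((hcontd w hw').mul (by fun_prop)).mul hkc).aestronglyMeasurable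
    · refine Filter.Eventually.of_forall fun θ _ x hx => ?_
      rw [norm_mul, norm_mul, Complex.norm_exp_ofReal_mul_I, mul_one]
      gcongr
      apply hC
      rw [mem_closedBall_zero_iff, norm_mul_exp]
      exact (by simpa using hx : ‖x‖ < r).le
    · exact (continuous_const.mul hkc.norm).intervalIntegrable _ _
    · refine Filter.Eventually.of_forall fun θ _ x hx => ?_
      have hx' : x * Complex.exp (θ * Complex.I) ∈ ball (0 : ℂ) T := by
        rw [mem_ball_zero_iff, norm_mul_exp]
        exact (by simpa using hx : ‖x‖ < r).trans hrT
      have h1 := ((hG _ hx').differentiableAt (isOpen_ball.mem_nhds hx')).hasDerivAt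
      have h2 : HasDerivAt (fun x : ℂ => x * Complex.exp (θ * Complex.I))
        (Complex.exp (θ * Complex.I)) x := by
        simpa using (hasDerivAt_id x).mul_const (Complex.exp (θ * Complex.I))
      exact (h1.comp x h2).mul_const _
  have hbd : ‖Ψ s‖ ≤ (MM G S + MM G s) / 2 := by
    apply Complex.norm_le_of_forall_mem_frontier_norm_le (isBounded_ball (x := (0:ℂ)) (r := S))
    · apply DifferentiableOn.diffContOnCl
      apply hΨ.mono
      exact closure_ball_subset_closedBall.trans (closedBall_subset_ball hST)
    · intro w hw
      have hw' : ‖w‖ = S := by simpa using frontier_ball_subset_sphere hw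
      have hwp : w = (S : ℂ) * Complex.exp (w.arg * Complex.I) := by
        rw [← hw']; exact (Complex.norm_mul_exp_arg_mul_I w).symm
      have hcw := hcont w (by linarith)
      calc ‖Ψ w‖ ≤ ∫ θ in (-Real.pi)..Real.pi,
            ‖G (w * Complex.exp (θ * Complex.I)) * k θ‖ :=
              intervalIntegral.norm_integral_le_integral_norm (by linarith [Real.pi_pos])
        _ ≤ ∫ θ in (-Real.pi)..Real.pi, ((‖G (w * Complex.exp (θ * Complex.I))‖ ^ 2
              + ‖G ((s : ℂ) * Complex.exp (θ * Complex.I))‖ ^ 2) / 2) := by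
            apply intervalIntegral.integral_mono_on (by linarith [Real.pi_pos])
            · exact (hcw.mul hkc).norm.intervalIntegrable _ _
            · exact (((hcw.norm.pow 2).add (hcs.norm.pow 2)).div_const 2).intervalIntegrable _ _
            · intro θ _
              simp only [hk, norm_mul, RCLike.norm_conj]
              nlinarith [sq_nonneg (‖G (w * Complex.exp (θ * Complex.I))‖ -
                ‖G ((s : ℂ) * Complex.exp (θ * Complex.I))‖)]
        _ = (MM G S + MM G s) / 2 := by
            rw [intervalIntegral.integral_div, intervalIntegral.integral_add]
            · congr 2
              rw [← MM_shift G S w.arg, ← hwp]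
            · exact (hcw.norm.pow 2).intervalIntegrable _ _
            · exact (hcs.norm.pow 2).intervalIntegrable _ _
    · apply subset_closure
      rw [mem_ball_zero_iff, hs']; exact hlt
  have hΨs : Ψ s = (MM G s : ℂ) := by
    simp only [Ψ, hk, Complex.mul_conj, MM]
    rw [← intervalIntegral.integral_ofReal]
    congr 1
    ext θ
    rw [Complex.normSq_eq_norm_sq]
  have : MM G s ≤ ‖Ψ s‖ := by
    rw [hΨs, Complex.norm_real]; exact le_abs_self _
  linarith

theorem MM_nonneg (f : ℂ → ℂ) (r : ℝ) : 0 ≤ MM f r := by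
  apply intervalIntegral.integral_nonneg (by linarith [Real.pi_pos])
  intros; positivity

theorem polar {f : ℂ → ℂ} {A : Set ℝ} (hA : IsOpen A) (hA0 : A ⊆ Set.Ioi 0)
    (hf : ContinuousOn f {z | ‖z‖ ∈ A}) :
    ∫⁻ z in {z : ℂ | ‖z‖ ∈ A}, ENNReal.ofReal (‖f z‖ ^ 2) =
      ∫⁻ r in A, ENNReal.ofReal (r * MM f r) := by
  have hSm : IsOpen {z : ℂ | ‖z‖ ∈ A} := hA.preimage continuous_norm
  rw [← lintegral_indicator hSm.measurableSet, ← Complex.lintegral_comp_polarCoord_symm]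
  have e1 : ∫⁻ p in polarCoord.target, ENNReal.ofReal p.1 •
      Set.indicator {z : ℂ | ‖z‖ ∈ A} (fun z => ENNReal.ofReal (‖f z‖ ^ 2))
        (Complex.polarCoord.symm p)
      = ∫⁻ p in A ×ˢ Set.Ioo (-Real.pi) Real.pi, ENNReal.ofReal (p.1 *
        ‖f ((p.1 : ℂ) * Complex.exp ((p.2 : ℝ) * Complex.I))‖ ^ 2) := by
    have hsub : A ×ˢ Set.Ioo (-Real.pi) Real.pi ⊆ polarCoord.target := by
      rw [polarCoord_target]; exact Set.prod_mono hA0 le_rfl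
    have hAm : MeasurableSet (A ×ˢ Set.Ioo (-Real.pi) Real.pi) :=
      hA.measurableSet.prod measurableSet_Ioo
    rw [← lintegral_indicator polarCoord.open_target.measurableSet, ← lintegral_indicator hAm]
    congr 1
    ext p
    by_cases hp : p ∈ polarCoord.target
    · have hp0 : 0 < p.1 := by rw [polarCoord_target] at hp; exact hp.1
      have hps : Complex.polarCoord.symm p = (p.1 : ℂ) * Complex.exp ((p.2 : ℝ) * Complex.I) := by
        rw [Complex.polarCoord_symm_apply, Complex.exp_mul_I]; simp
      rw [Set.indicator_of_mem hp, hps]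
      by_cases hpA : p.1 ∈ A
      · rw [Set.indicator_of_mem, Set.indicator_of_mem]
        · rw [smul_eq_mul, ENNReal.ofReal_mul hp0.le]
        · exact ⟨hpA, by rw [polarCoord_target] at hp; exact hp.2⟩
        · simpa [norm_mul_exp, abs_of_pos hp0] using hpA
      · rw [Set.indicator_of_notMem, Set.indicator_of_notMem]
        · simp
        · exact fun h => hpA h.1
        · simpa [norm_mul_exp, abs_of_pos hp0] using hpA
    · rw [Set.indicator_of_notMem hp, Set.indicator_of_notMem (fun h => hp (hsub h))]
  rw [e1, Measure.volume_eq_prod, setLIntegral_prod]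
  · apply setLIntegral_congr_fun hA.measurableSet
    intro r hr
    have hr0 : 0 < r := hA0 hr
    have hc : Continuous (fun θ : ℝ => f ((r : ℂ) * Complex.exp (θ * Complex.I))) := by
      apply cont_circle
      apply hf.mono
      intro z hz
      simp only [Set.mem_ofPred_eq] at hz ⊢
      rw [hz]; simpa [abs_of_pos hr0] using hr
    simp only
    rw [MM, intervalIntegral.integral_of_le (by linarith [Real.pi_pos]), ← integral_const_mul,
      ofReal_integral_eq_lintegral_ofReal]
    · exact setLIntegral_congr Ioo_ae_eq_Ioc
    · exact ((continuous_const.mul (hc.norm.pow 2)).integrableOn_Icc).mono_set Set.Ioc_subset_Icc_self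
    · exact Filter.Eventually.of_forall fun θ => by positivity
  · rw [← Measure.volume_eq_prod]
    apply ENNReal.measurable_ofReal.comp_aemeasurable
    apply ContinuousOn.aemeasurable _ (hA.measurableSet.prod measurableSet_Ioo)
    apply continuousOn_fst.mul
    apply ContinuousOn.pow
    apply ContinuousOn.norm
    apply hf.comp (by fun_prop)
    intro p hp
    have h0 : 0 < p.1 := hA0 hp.1
    simp only [Set.mem_ofPred_eq, norm_mul_exp]
    simpa [abs_of_pos h0] using hp.1

theorem submean {f : ℂ → ℂ} {z : ℂ} {r : ℝ} (hr : 0 < r) (hf : DifferentiableOn ℂ f (ball z r)) :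
    ENNReal.ofReal (Real.pi * r ^ 2 * ‖f z‖ ^ 2) ≤ ∫⁻ w in ball z r, ENNReal.ofReal (‖f w‖ ^ 2) := by
  set g : ℂ → ℂ := fun w => f (z + w) with hg
  have hgd : DifferentiableOn ℂ g (ball 0 r) := by
    apply hf.comp (by fun_prop)
    intro w hw
    simpa using hw
  have h0 : MM g 0 = 2 * Real.pi * ‖f z‖ ^ 2 := by
    simp only [MM, hg, Complex.ofReal_zero, zero_mul, add_zero, intervalIntegral.integral_const,
      smul_eq_mul]
    ring
  have e1 : ∫⁻ w in ball z r, ENNReal.ofReal (‖f w‖ ^ 2)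
      = ∫⁻ w in ball 0 r, ENNReal.ofReal (‖g w‖ ^ 2) := by
    rw [← lintegral_indicator measurableSet_ball, ← lintegral_indicator measurableSet_ball,
      ← lintegral_add_left_eq_self _ z]
    congr 1
    ext w
    simp [Set.indicator, hg]
  rw [e1]
  have hsub : {w : ℂ | ‖w‖ ∈ Set.Ioo 0 r} ⊆ ball 0 r := by
    intro w hw
    simpa using hw.2
  refine le_trans ?_ (lintegral_mono_set hsub)
  rw [polar isOpen_Ioo (fun x hx => hx.1) (hgd.continuousOn.mono hsub)]
  have e2 : ENNReal.ofReal (Real.pi * r ^ 2 * ‖f z‖ ^ 2)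
      = ∫⁻ t in Set.Ioo 0 r, ENNReal.ofReal (t * MM g 0) := by
    rw [← ofReal_integral_eq_lintegral_ofReal]
    · rw [← integral_Ioc_eq_integral_Ioo, ← intervalIntegral.integral_of_le hr.le,
        intervalIntegral.integral_mul_const, integral_id, h0]
      congr 1; ring
    · exact ((continuous_id.mul continuous_const).integrableOn_Icc).mono_set Set.Ioo_subset_Icc_self
    · filter_upwards [ae_restrict_mem measurableSet_Ioo] with t ht
      exact mul_nonneg ht.1.le (MM_nonneg _ _)
  rw [e2]
  apply setLIntegral_mono' measurableSet_Ioo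
  intro t ht
  apply ENNReal.ofReal_le_ofReal
  exact mul_le_mul_of_nonneg_left (MM_mono hgd le_rfl ht.1.le ht.2) ht.1.le

theorem decay {f : ℂ → ℂ} {ρ : ℝ} (hρ : 0 < ρ) (hf : DifferentiableOn ℂ f {z | ρ < ‖z‖})
    (hi : IntegrableOn (fun z => ‖f z‖ ^ 2) {z | ρ < ‖z‖}) {ε : ℝ} (hε : 0 < ε) :
    ∃ N, 0 < N ∧ ∀ z, N < ‖z‖ → ‖f z‖ * ‖z‖ ≤ ε := by
  have hopen : ∀ a : ℝ, IsOpen {z : ℂ | a < ‖z‖} := fun a => isOpen_lt continuous_const continuous_norm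
  have ht := tendsto_setIntegral_of_antitone (μ := volume) (f := fun z => ‖f z‖ ^ 2)
    (s := fun n : ℕ => {z : ℂ | ρ + n < ‖z‖}) (fun n => (hopen _).measurableSet)
    (fun a b hab z hz => by
      simp only [Set.mem_ofPred_eq] at hz ⊢
      have : (a : ℝ) ≤ b := by exact_mod_cast hab
      linarith) ⟨0, by simpa using hi⟩
  have hem : ⋂ n : ℕ, {z : ℂ | ρ + n < ‖z‖} = ∅ := by
    ext z
    simp only [Set.mem_iInter, Set.mem_ofPred_eq, Set.mem_empty_iff_false, iff_false, not_forall,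
      not_lt]
    obtain ⟨n, hn⟩ := exists_nat_ge ‖z‖
    exact ⟨n, by linarith⟩
  rw [hem, setIntegral_empty] at ht
  have hδ : 0 < Real.pi * ε ^ 2 / 4 := by positivity
  obtain ⟨n, hn⟩ := (ht.eventually (gt_mem_nhds hδ)).exists
  refine ⟨2 * (ρ + n), by positivity, fun z hz => ?_⟩
  have hn0 : (0 : ℝ) ≤ n := by positivity
  have hz0 : 0 < ‖z‖ / 2 := by linarith
  have hsub : ball z (‖z‖ / 2) ⊆ {w : ℂ | ρ + n < ‖w‖} := by
    intro w hw
    rw [mem_ball, dist_eq_norm] at hw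
    have := norm_sub_norm_le z w
    rw [norm_sub_rev] at this
    simp only [Set.mem_ofPred_eq]
    linarith
  have hsub2 : {w : ℂ | ρ + n < ‖w‖} ⊆ {w : ℂ | ρ < ‖w‖} := by
    intro w hw
    simp only [Set.mem_ofPred_eq] at hw ⊢
    linarith
  have h1 := submean hz0 (hf.mono (hsub.trans hsub2))
  have h2 := h1.trans (lintegral_mono_set hsub)
  rw [← ofReal_integral_eq_lintegral_ofReal (hi.mono_set hsub2)
    (Filter.Eventually.of_forall fun _ => by positivity)] at h2
  have h3 : Real.pi * (‖z‖ / 2) ^ 2 * ‖f z‖ ^ 2 ≤ Real.pi * ε ^ 2 / 4 :=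
    (ENNReal.ofReal_lt_ofReal_iff hδ).2 hn |> fun h => by
      have := h2.trans h.le
      rwa [ENNReal.ofReal_le_ofReal_iff hδ.le] at this
  have h4 : (‖f z‖ * ‖z‖) ^ 2 ≤ ε ^ 2 := by
    have : Real.pi * (‖f z‖ * ‖z‖) ^ 2 ≤ Real.pi * ε ^ 2 := by nlinarith
    exact le_of_mul_le_mul_left this Real.pi_pos
  exact abs_le_of_sq_le_sq' h4 hε.le |>.2

theorem MM_decay {f : ℂ → ℂ} {ρ : ℝ} (hρ : 0 < ρ) (hf : DifferentiableOn ℂ f {z | ρ < ‖z‖})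
    (hi : IntegrableOn (fun z => ‖f z‖ ^ 2) {z | ρ < ‖z‖}) {r₁ r₂ : ℝ} (h1 : ρ < r₁)
    (h2 : r₁ ≤ r₂) : r₂ ^ 4 * MM f r₂ ≤ r₁ ^ 4 * MM f r₁ := by
  have hopen : IsOpen {z : ℂ | ρ < ‖z‖} := isOpen_lt continuous_const continuous_norm
  set G₀ : ℂ → ℂ := fun w => f w⁻¹ * (w⁻¹) ^ 2 with hG₀
  have hd : DifferentiableOn ℂ G₀ (ball 0 ρ⁻¹ \ {0}) := by
    have hinv : DifferentiableOn ℂ (fun w : ℂ => w⁻¹) (ball 0 ρ⁻¹ \ {0}) :=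
      differentiableOn_inv.mono (fun w hw => hw.2)
    refine DifferentiableOn.mul (hf.comp hinv ?_) (hinv.pow 2)
    intro w hw
    have hw0 : 0 < ‖w‖ := norm_pos_iff.2 hw.2
    have hw1 : ‖w‖ < ρ⁻¹ := by simpa using hw.1
    simp only [Set.mem_ofPred_eq, norm_inv]
    exact (lt_inv_comm₀ hw0 hρ).1 hw1
  have ho : (fun w => G₀ w - G₀ 0) =o[nhdsWithin 0 {0}ᶜ] fun w => (w - 0)⁻¹ := by
    rw [Asymptotics.isLittleO_iff]
    intro ε hε
    obtain ⟨N, hN0, hN⟩ := decay hρ hf hi hε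
    have hb : ball (0 : ℂ) N⁻¹ ∈ nhdsWithin (0 : ℂ) {0}ᶜ :=
      mem_nhdsWithin_of_mem_nhds (ball_mem_nhds _ (by positivity))
    filter_upwards [hb, self_mem_nhdsWithin] with w hw hw0
    have hw0 : 0 < ‖w‖ := norm_pos_iff.2 hw0
    have hw1 : ‖w‖ < N⁻¹ := by simpa using hw
    have := hN w⁻¹ (by rw [norm_inv]; exact (lt_inv_comm₀ hw0 hN0).1 hw1)
    simp only [hG₀, inv_zero, ne_eq, OfNat.ofNat_ne_zero, not_false_eq_true, zero_pow, mul_zero,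
      sub_zero, norm_mul, norm_pow]
    rw [pow_two, ← mul_assoc]
    exact mul_le_mul_of_nonneg_right this (norm_nonneg _)
  have hG := Complex.differentiableOn_update_limUnder_of_isLittleO
    (ball_mem_nhds (0 : ℂ) (inv_pos.2 hρ)) hd ho
  set G := Function.update G₀ 0 (limUnder (nhdsWithin 0 {0}ᶜ) G₀)
  have key : ∀ r, 0 < r → r ^ 4 * MM f r = MM G r⁻¹ := by
    intro r hr
    have hn := intervalIntegral.integral_comp_neg (a := -Real.pi) (b := Real.pi)
      (fun θ : ℝ => ‖G (((r⁻¹ : ℝ) : ℂ) * Complex.exp (θ * Complex.I))‖ ^ 2)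
    rw [neg_neg] at hn
    unfold MM
    rw [← hn, ← intervalIntegral.integral_const_mul]
    congr 1
    ext θ
    have hne : (((r⁻¹ : ℝ) : ℂ) * Complex.exp (((-θ : ℝ) : ℂ) * Complex.I)) ≠ 0 := by
      apply mul_ne_zero _ (Complex.exp_ne_zero _)
      exact_mod_cast (inv_pos.2 hr).ne'
    have hi : (((r⁻¹ : ℝ) : ℂ) * Complex.exp (((-θ : ℝ) : ℂ) * Complex.I))⁻¹
        = (r : ℂ) * Complex.exp (θ * Complex.I) := by
      rw [mul_inv, ← Complex.exp_neg]; simp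
    simp only [G, Function.update_of_ne hne, hG₀, hi, norm_mul, norm_pow,
      Complex.norm_exp_ofReal_mul_I, mul_one, Complex.norm_real, Real.norm_eq_abs, sq_abs]
    ring
  have p1 : 0 < r₁ := hρ.trans h1
  rw [key r₂ (p1.trans_le h2), key r₁ p1]
  exact MM_mono hG (inv_pos.2 (p1.trans_le h2)).le (inv_anti₀ p1 h2) (inv_strictAnti₀ hρ h1)

theorem main_complex {f : ℂ → ℂ} {ρ R : ℝ} (hρ : 0 < ρ) (hρR : ρ < R)
    (hf : DifferentiableOn ℂ f {z | ρ < ‖z‖})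
    (hi : IntegrableOn (fun z => ‖f z‖ ^ 2) {z | ρ < ‖z‖}) :
    (∫ z in {z : ℂ | ‖z‖ ∈ Set.Ioi R}, ‖f z‖ ^ 2) ≤
      ρ ^ 2 / (R ^ 2 - ρ ^ 2) * ∫ z in {z : ℂ | ‖z‖ ∈ Set.Ioo ρ R}, ‖f z‖ ^ 2 := by
  have hR : 0 < R := hρ.trans hρR
  have s1 : {z : ℂ | ‖z‖ ∈ Set.Ioi R} ⊆ {z | ρ < ‖z‖} := fun z hz => hρR.trans hz
  have s2 : {z : ℂ | ‖z‖ ∈ Set.Ioo ρ R} ⊆ {z | ρ < ‖z‖} := fun z hz => hz.1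
  set m := R ^ 4 * MM f R with hm
  have hm0 : 0 ≤ m := mul_nonneg (by positivity) (MM_nonneg _ _)
  -- upper bound
  have hup : (∫ z in {z : ℂ | ‖z‖ ∈ Set.Ioi R}, ‖f z‖ ^ 2) ≤ m * (R ^ (-2 : ℝ) / 2) := by
    rw [← ENNReal.ofReal_le_ofReal_iff (by positivity),
      ofReal_integral_eq_lintegral_ofReal (hi.mono_set s1)
        (Filter.Eventually.of_forall fun _ => by positivity),
      polar isOpen_Ioi (fun x hx => hR.trans hx) (hf.continuousOn.mono s1)]
    have e : m * (R ^ (-2 : ℝ) / 2) = ∫ t in Set.Ioi R, m * t ^ (-3 : ℝ) := by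
      rw [integral_const_mul, integral_Ioi_rpow_of_lt (by norm_num) hR]
      norm_num
    rw [e, ofReal_integral_eq_lintegral_ofReal]
    · apply setLIntegral_mono' measurableSet_Ioi
      intro t ht
      have ht0 : 0 < t := hR.trans ht
      apply ENNReal.ofReal_le_ofReal
      have := MM_decay hρ hf hi hρR (le_of_lt ht)
      rw [show (-3 : ℝ) = ((-3 : ℤ) : ℝ) by norm_num, Real.rpow_intCast]
      rw [zpow_neg, ← div_eq_mul_inv, le_div_iff₀ (by positivity)]
      calc t * MM f t * t ^ (3 : ℤ) = t ^ 4 * MM f t := by norm_cast; ring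
        _ ≤ m := this
    · exact (integrableOn_Ioi_rpow_of_lt (by norm_num) hR).const_mul m
    · filter_upwards [ae_restrict_mem measurableSet_Ioi] with t ht
      have ht0 : 0 < t := hR.trans ht
      positivity
  have hlow : m * ((ρ ^ (-2 : ℝ) - R ^ (-2 : ℝ)) / 2) ≤
      ∫ z in {z : ℂ | ‖z‖ ∈ Set.Ioo ρ R}, ‖f z‖ ^ 2 := by
    rw [← ENNReal.ofReal_le_ofReal_iff (integral_nonneg fun _ => by positivity),
      ofReal_integral_eq_lintegral_ofReal (hi.mono_set s2)
        (Filter.Eventually.of_forall fun _ => by positivity),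
      polar isOpen_Ioo (fun x hx => hρ.trans hx.1) (hf.continuousOn.mono s2)]
    have e : m * ((ρ ^ (-2 : ℝ) - R ^ (-2 : ℝ)) / 2) = ∫ t in Set.Ioo ρ R, m * t ^ (-3 : ℝ) := by
      rw [integral_const_mul, ← integral_Ioc_eq_integral_Ioo,
        ← intervalIntegral.integral_of_le hρR.le, integral_rpow]
      · norm_num
        left; ring
      · right
        refine ⟨by norm_num, ?_⟩
        rw [Set.uIcc_of_le hρR.le]
        exact fun h => absurd h.1 (not_le.2 hρ)
    rw [e, ofReal_integral_eq_lintegral_ofReal]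
    · apply setLIntegral_mono' measurableSet_Ioo
      intro t ht
      have ht0 : 0 < t := hρ.trans ht.1
      apply ENNReal.ofReal_le_ofReal
      have := MM_decay hρ hf hi ht.1 ht.2.le
      rw [show (-3 : ℝ) = ((-3 : ℤ) : ℝ) by norm_num, Real.rpow_intCast]
      rw [zpow_neg, ← div_eq_mul_inv, div_le_iff₀ (by positivity)]
      calc m ≤ t ^ 4 * MM f t := this
        _ = t * MM f t * t ^ (3 : ℤ) := by norm_cast; ring
    · exact ((integrableOn_Ioi_rpow_of_lt (by norm_num) hρ).mono_set
        Set.Ioo_subset_Ioi_self).const_mul m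
    · filter_upwards [ae_restrict_mem measurableSet_Ioo] with t ht
      have ht0 : 0 < t := hρ.trans ht.1
      positivity
  refine hup.trans ?_
  have hpos : 0 < R ^ 2 - ρ ^ 2 := by nlinarith
  refine le_trans (le_of_eq ?_) (mul_le_mul_of_nonneg_left hlow (by positivity))
  rw [show (-2 : ℝ) = ((-2 : ℤ) : ℝ) by norm_num, Real.rpow_intCast, Real.rpow_intCast, zpow_neg,
    zpow_neg]
  norm_cast
  field_simp

theorem iter_comp (h : Pt → ℝ) (c : Pt) (e : ℂ ≃L[ℝ] Pt) (z v : ℂ) :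
    iteratedFDeriv ℝ 2 (fun z => h (c + e z)) z ![v, v]
      = iteratedFDeriv ℝ 2 h (c + e z) (fun _ => e v) := by
  have := e.iteratedFDerivWithin_comp_right (fun x => h (c + x)) (s := Set.univ) uniqueDiffOn_univ
    (x := z) (Set.mem_univ _) 2
  simp only [Set.preimage_univ, iteratedFDerivWithin_univ] at this
  change iteratedFDeriv ℝ 2 ((fun x => h (c + x)) ∘ e) z ![v, v] = _
  rw [this, iteratedFDeriv_comp_add_left]
  simp only [ContinuousMultilinearMap.compContinuousLinearMap_apply]
  congr 1
  ext i
  fin_cases i <;> rfl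

theorem stmt5 (c : Pt) (ρ R : ℝ) (hρ : 0 < ρ) (hρR : ρ < R)
    (h : Pt → ℝ) (hharm : IsHarmonicOn h (closedBall c ρ)ᶜ)
    (hdir : IntegrableOn (fun x => ‖gradient h x‖ ^ 2) (closedBall c ρ)ᶜ) :
    (∫ x in (closedBall c R)ᶜ, ‖gradient h x‖ ^ 2)
      ≤ ρ ^ 2 / (R ^ 2 - ρ ^ 2) * ∫ x in ball c R \ closedBall c ρ, ‖gradient h x‖ ^ 2 := by
  set e : ℂ ≃ₗᵢ[ℝ] Pt := Complex.orthonormalBasisOneI.repr with he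
  have e1 : e 1 = EuclideanSpace.single 0 (1 : ℝ) := by
    have := Complex.orthonormalBasisOneI.repr_self 0
    simpa using this
  have eI : e Complex.I = EuclideanSpace.single 1 (1 : ℝ) := by
    have := Complex.orthonormalBasisOneI.repr_self 1
    simpa using this
  set φ : ℂ → Pt := fun z => c + e z with hφ
  set H : ℂ → ℝ := fun z => h (c + e z) with hH
  set f : ℂ → ℂ := fun z => fderiv ℝ H z 1 - Complex.I * fderiv ℝ H z Complex.I with hf
  have hdist : ∀ z, dist (φ z) c = ‖z‖ := by
    intro z; rw [dist_eq_norm]; simp [hφ]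
  have hUo : IsOpen ((closedBall c ρ)ᶜ) := isClosed_closedBall.isOpen_compl
  have hmem : ∀ z, ρ < ‖z‖ → φ z ∈ (closedBall c ρ)ᶜ := by
    intro z hz; simpa [hdist] using hz
  have hcd : ∀ z, ρ < ‖z‖ → ContDiffAt ℝ 2 h (φ z) := fun z hz =>
    hharm.1.contDiffAt (hUo.mem_nhds (hmem z hz))
  have hφc : ContDiff ℝ 2 φ := contDiff_const.add e.contDiff
  have hopen : IsOpen {z : ℂ | ρ < ‖z‖} := isOpen_lt continuous_const continuous_norm
  have hdf : DifferentiableOn ℂ f {z | ρ < ‖z‖} := by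
    intro z hz
    apply DifferentiableAt.differentiableWithinAt
    apply HarmonicAt.differentiableAt_complex_partial
    refine ⟨(hcd z hz).comp z hφc.contDiffAt, ?_⟩
    filter_upwards [hopen.mem_nhds hz] with w hw
    rw [InnerProductSpace.laplacian_eq_iteratedFDeriv_complexPlane]
    have h1 := iter_comp h c e.toContinuousLinearEquiv w 1
    have h2 := iter_comp h c e.toContinuousLinearEquiv w Complex.I
    have h3 := hharm.2 _ (hmem w hw)
    simp only [lap, Fin.sum_univ_two, ← e1, ← eI] at h3
    exact (congrArg₂ (· + ·) h1 h2).trans h3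
  have hnorm : ∀ z, ρ < ‖z‖ → ‖gradient h (φ z)‖ ^ 2 = ‖f z‖ ^ 2 := by
    intro z hz
    have hd : ∀ v, fderiv ℝ H z v = fderiv ℝ h (φ z) (e v) := by
      intro v
      have hh := ((hcd z hz).differentiableAt (by norm_num)).hasFDerivAt
      have hp : HasFDerivAt φ (e.toContinuousLinearEquiv : ℂ →L[ℝ] Pt) z :=
        (e.toContinuousLinearEquiv.hasFDerivAt).const_add c
      have := (hh.comp z hp).fderiv
      change fderiv ℝ (h ∘ φ) z v = _
      rw [this]; rfl
    rw [EuclideanSpace.norm_sq_eq, Fin.sum_univ_two]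
    have g : ∀ i, gradient h (φ z) i = fderiv ℝ h (φ z) (EuclideanSpace.single i (1:ℝ)) := by
      intro i
      rw [← inner_gradient_left, EuclideanSpace.inner_single_right]
      simp
    rw [g, g, ← e1, ← eI, ← hd, ← hd, ← Complex.normSq_eq_norm_sq, Complex.normSq_apply]
    simp [hf]
    ring
  have hmp : MeasurePreserving φ volume volume :=
    (measurePreserving_add_left volume c).comp e.measurePreserving
  have hemb : MeasurableEmbedding φ :=
    (measurableEmbedding_addLeft c).comp e.toHomeomorph.measurableEmbedding
  have hmeas : ∀ A : Set ℝ, MeasurableSet A → MeasurableSet {z : ℂ | ‖z‖ ∈ A} :=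
    fun A hA => measurable_norm hA
  have pre1 : φ ⁻¹' (closedBall c R)ᶜ = {z | ‖z‖ ∈ Set.Ioi R} := by
    ext z; simp [hdist]
  have pre2 : φ ⁻¹' (ball c R \ closedBall c ρ) = {z | ‖z‖ ∈ Set.Ioo ρ R} := by
    ext z; simp [hdist, and_comm]
  have pre3 : φ ⁻¹' (closedBall c ρ)ᶜ = {z | ρ < ‖z‖} := by
    ext z; simp [hdist]
  rw [← hmp.setIntegral_preimage_emb hemb, ← hmp.setIntegral_preimage_emb hemb, pre1, pre2]
  rw [← hmp.integrableOn_comp_preimage hemb, pre3] at hdir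
  rw [setIntegral_congr_fun (hmeas _ measurableSet_Ioi) (fun z hz => hnorm z (hρR.trans hz)),
    setIntegral_congr_fun (hmeas _ measurableSet_Ioo) (fun z hz => hnorm z hz.1)]
  apply main_complex hρ hρR hdf
  exact hdir.congr_fun (fun z hz => hnorm z hz) hopen.measurableSet
end
end

section
/- Under the Geometry hypothesis, every function h that is harmonic on 𝒦 = ℝ² ∖ closure(𝒪) with finite Dirichlet energy ∫_𝒦 |∇h|² dx < ∞ satisfies ∫_{ℝ² ∖ closure(𝒢)} |∇h|² dx ≤ (R_-²/(R_i² − R_-²)) · ∫_ℱ |∇h|² dx. (Estimate (3.9) of Lemma 3.4.) -/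
open MeasureTheory Metric Filter

noncomputable section

lemma scale_int (a : ℂ) (ha : a ≠ 0) (G : ℂ → ℝ) :
    ∫ z, G (a * z) = (‖a‖ ^ 2)⁻¹ * ∫ z, G z := by
  have hdet : LinearMap.det (LinearMap.mulLeft ℝ a) = ‖a‖ ^ 2 := by
    have := Algebra.norm_complex_apply a
    rw [Algebra.norm_apply] at this
    rw [← Complex.normSq_eq_norm_sq, ← this]
    rfl
  have hne : LinearMap.det (LinearMap.mulLeft ℝ a) ≠ 0 := by
    rw [hdet]; positivity
  have hmap := Measure.map_linearMap_addHaar_eq_smul_addHaar (volume : Measure ℂ) hne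
  have he : MeasurableEmbedding (fun z : ℂ => a * z) :=
    (Homeomorph.mulLeft₀ a ha).measurableEmbedding
  have h1 := he.integral_map (μ := volume) G
  rw [← h1]
  have h2 : Measure.map (fun z : ℂ => a * z) volume = ENNReal.ofReal ((‖a‖ ^ 2)⁻¹) • volume := by
    rw [hdet] at hmap
    rw [abs_of_nonneg (by positivity)] at hmap
    exact hmap
  rw [h2, integral_smul_measure, ENNReal.toReal_ofReal (by positivity), smul_eq_mul]

def ann (a b : ℝ) : Set ℂ := {z | a ≤ ‖z‖ ∧ ‖z‖ ≤ b}

lemma ann_closed (a b : ℝ) : IsClosed (ann a b) :=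
  (isClosed_le continuous_const continuous_norm).inter
    (isClosed_le continuous_norm continuous_const)

lemma ann_compact (a b : ℝ) : IsCompact (ann a b) :=
  (isCompact_closedBall (0 : ℂ) b).of_isClosed_subset (ann_closed a b)
    (fun z hz => by simpa using hz.2)

lemma scale_ann (f : ℂ → ℂ) (n : ℝ) (w : ℂ) (hw : w ≠ 0) :
    ∫ z in ann 1 n, ‖f (w⁻¹ * z)‖ ^ 2
      = ‖w‖ ^ 2 * ∫ z in ann (‖w‖⁻¹) (n * ‖w‖⁻¹), ‖f z‖ ^ 2 := by
  have hw' : 0 < ‖w‖ := norm_pos_iff.2 hw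
  rw [← integral_indicator (ann_closed _ _).measurableSet,
    ← integral_indicator (ann_closed _ _).measurableSet]
  have := scale_int w⁻¹ (inv_ne_zero hw)
    (Set.indicator (ann (‖w‖⁻¹) (n * ‖w‖⁻¹)) (fun z => ‖f z‖ ^ 2))
  rw [norm_inv, inv_pow, inv_inv] at this
  rw [← this]
  congr 1
  ext z
  have : w⁻¹ * z ∈ ann (‖w‖⁻¹) (n * ‖w‖⁻¹) ↔ z ∈ ann 1 n := by
    simp only [ann, Set.mem_ofPred_eq, norm_mul, norm_inv]
    rw [le_mul_iff_one_le_right (by positivity), mul_comm n, mul_le_mul_iff_right₀ (by positivity)]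
  by_cases hz : z ∈ ann 1 n
  · rw [Set.indicator_of_mem hz, Set.indicator_of_mem (this.2 hz)]
  · rw [Set.indicator_of_notMem hz, Set.indicator_of_notMem (fun h => hz (this.1 h))]

lemma J_diff (f : ℂ → ℂ) (r0 n : ℝ) (hr0 : 0 < r0)
    (hf : DifferentiableOn ℂ f {z | r0 < ‖z‖}) (φ : ℂ → ℂ) (hφ : ContinuousOn φ (ann 1 n)) :
    DifferentiableOn ℂ (fun w => ∫ z in ann 1 n, f (w⁻¹ * z) * φ z) {w | w ≠ 0 ∧ r0 * ‖w‖ < 1} := by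
  have hU : IsOpen {z : ℂ | r0 < ‖z‖} := isOpen_lt continuous_const continuous_norm
  have hV : IsOpen {w : ℂ | w ≠ 0 ∧ r0 * ‖w‖ < 1} :=
    isOpen_ne.inter (isOpen_lt (continuous_const.mul continuous_norm) continuous_const)
  have hf' : ContinuousOn (deriv f) {z | r0 < ‖z‖} := (hf.deriv hU).continuousOn
  have hmem : ∀ w ∈ {w : ℂ | w ≠ 0 ∧ r0 * ‖w‖ < 1}, ∀ z ∈ ann 1 n,
      w⁻¹ * z ∈ {z : ℂ | r0 < ‖z‖} := by
    intro w hw z hz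
    have hw' : 0 < ‖w‖ := norm_pos_iff.2 hw.1
    simp only [Set.mem_ofPred_eq, norm_mul, norm_inv]
    have h1 := hz.1
    calc r0 < ‖w‖⁻¹ := by rw [lt_inv_comm₀ hr0 hw', ← one_div, lt_div_iff₀ hr0]; linarith [hw.2]
      _ ≤ ‖w‖⁻¹ * ‖z‖ := le_mul_of_one_le_right (by positivity) h1
  intro w0 hw0
  obtain ⟨ε, hε, hball⟩ := Metric.nhds_basis_closedBall.mem_iff.1 (hV.mem_nhds hw0)
  let F' : ℂ → ℂ → ℂ := fun w z => deriv f (w⁻¹ * z) * (-(w ^ 2)⁻¹ * z) * φ z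
  have hcont : ContinuousOn (fun p : ℂ × ℂ => F' p.1 p.2) (closedBall w0 ε ×ˢ ann 1 n) := by
    have hinv : ContinuousOn (fun p : ℂ × ℂ => p.1⁻¹) (closedBall w0 ε ×ˢ ann 1 n) :=
      continuousOn_fst.inv₀ (fun p hp => (hball hp.1).1)
    refine ContinuousOn.mul (ContinuousOn.mul ?_ ?_) ?_
    · exact hf'.comp (hinv.mul continuousOn_snd) (fun p hp => hmem _ (hball hp.1) _ hp.2)
    · refine ContinuousOn.mul (ContinuousOn.neg (ContinuousOn.inv₀ (by fun_prop) ?_)) (by fun_prop)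
      intro p hp
      exact pow_ne_zero _ (hball hp.1).1
    · exact hφ.comp continuousOn_snd (fun p hp => hp.2)
  obtain ⟨C, hC⟩ := ((isCompact_closedBall w0 ε).prod (ann_compact 1 n)).exists_bound_of_continuousOn
    hcont
  have hFc : ∀ w ∈ {w : ℂ | w ≠ 0 ∧ r0 * ‖w‖ < 1},
      ContinuousOn (fun z => f (w⁻¹ * z) * φ z) (ann 1 n) := by
    intro w hw
    exact (hf.continuousOn.comp (by fun_prop) (fun z hz => hmem w hw z hz)).mul hφ
  have hms := (ann_closed 1 n).measurableSet
  have key := hasDerivAt_integral_of_dominated_loc_of_deriv_le (𝕜 := ℂ)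
    (μ := volume.restrict (ann 1 n)) (F := fun w z => f (w⁻¹ * z) * φ z) (F' := F') (x₀ := w0)
    (bound := fun _ => C) (closedBall_mem_nhds w0 hε) ?_ ?_ ?_ ?_ ?_ ?_
  · exact key.2.differentiableAt.differentiableWithinAt
  · filter_upwards [hV.mem_nhds hw0] with w hw
    exact (hFc w hw).aestronglyMeasurable hms
  · exact (hFc w0 hw0).integrableOn_compact (ann_compact 1 n)
  · refine ContinuousOn.aestronglyMeasurable ?_ hms
    exact hcont.comp (f := fun z => (w0, z)) (by fun_prop)
      (fun z hz => ⟨mem_closedBall_self hε.le, hz⟩)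
  · filter_upwards [ae_restrict_mem hms] with z hz w hw
    exact hC (w, z) ⟨hw, hz⟩
  · have : IsFiniteMeasure (volume.restrict (ann 1 n)) :=
      ⟨by simpa using (ann_compact 1 n).measure_lt_top⟩
    exact integrable_const C
  · filter_upwards [ae_restrict_mem hms] with z hz w hw
    have hw1 := hball hw
    have h1 : HasDerivAt (fun w : ℂ => w⁻¹ * z) (-(w ^ 2)⁻¹ * z) w :=
      (hasDerivAt_inv hw1.1).mul_const z
    have h2 : HasDerivAt f (deriv f (w⁻¹ * z)) (w⁻¹ * z) :=
      (hf.differentiableAt (hU.mem_nhds (hmem w hw1 z hz))).hasDerivAt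
    exact (h2.comp w h1).mul_const (φ z)

lemma core_ann (f : ℂ → ℂ) (r0 r R n : ℝ) (hr0 : 0 < r0) (hr : r0 < r) (hR : r < R)
    (hf : DifferentiableOn ℂ f {z | r0 < ‖z‖})
    (hint : IntegrableOn (fun z => ‖f z‖ ^ 2) {z | r0 < ‖z‖}) :
    R ^ 2 * ∫ z in ann R (n * R), ‖f z‖ ^ 2 ≤ r ^ 2 * ∫ z in ann r (n * r), ‖f z‖ ^ 2 := by
  have hrp : 0 < r := hr0.trans hr
  have hRp : 0 < R := hrp.trans hR
  set V : Set ℂ := {w : ℂ | w ≠ 0 ∧ r0 * ‖w‖ < 1} with hVdef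
  have hmem : ∀ w ∈ V, ∀ z ∈ ann 1 n, w⁻¹ * z ∈ {z : ℂ | r0 < ‖z‖} := by
    intro w hw z hz
    have hw' : 0 < ‖w‖ := norm_pos_iff.2 hw.1
    simp only [Set.mem_ofPred_eq, norm_mul, norm_inv]
    have h1 := hz.1
    calc r0 < ‖w‖⁻¹ := by rw [lt_inv_comm₀ hr0 hw', ← one_div, lt_div_iff₀ hr0]; linarith [hw.2]
      _ ≤ ‖w‖⁻¹ * ‖z‖ := le_mul_of_one_le_right (by positivity) h1
  have hfc : ∀ w ∈ V, ContinuousOn (fun z => f (w⁻¹ * z)) (ann 1 n) := fun w hw =>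
    hf.continuousOn.comp (by fun_prop) (fun z hz => hmem w hw z hz)
  set s : ℂ := ((R⁻¹ : ℝ) : ℂ) with hs
  have hsn : ‖s‖ = R⁻¹ := by rw [hs, Complex.norm_real, Real.norm_of_nonneg (by positivity)]
  have hVof : ∀ w : ℂ, w ≠ 0 → ‖w‖ ≤ r⁻¹ → w ∈ V := by
    intro w hw h
    refine ⟨hw, ?_⟩
    calc r0 * ‖w‖ ≤ r0 * r⁻¹ := by gcongr
      _ < 1 := by rw [← div_eq_mul_inv, div_lt_one hrp]; exact hr
  have hs0 : s ≠ 0 := by rw [← norm_pos_iff, hsn]; positivity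
  have hRr : R⁻¹ < r⁻¹ := inv_strictAnti₀ hrp hR
  have hsV : s ∈ V := hVof s hs0 (by rw [hsn]; exact hRr.le)
  let φ : ℂ → ℂ := fun z => (starRingEnd ℂ) (f (s⁻¹ * z))
  have hφ : ContinuousOn φ (ann 1 n) := Complex.continuous_conj.comp_continuousOn (hfc s hsV)
  let J : ℂ → ℂ := fun w => ∫ z in ann 1 n, f (w⁻¹ * z) * φ z
  have hJ : DifferentiableOn ℂ J V := J_diff f r0 n hr0 hf φ hφ
  let Q : ℂ → ℝ := fun w => ∫ z in ann 1 n, ‖f (w⁻¹ * z)‖ ^ 2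
  let I : ℝ → ℝ := fun ρ => ∫ z in ann ρ (n * ρ), ‖f z‖ ^ 2
  have hQ : ∀ w, w ≠ 0 → Q w = ‖w‖ ^ 2 * I (‖w‖⁻¹) := fun w hw => scale_ann f n w hw
  have hQi : ∀ w ∈ V, IntegrableOn (fun z => ‖f (w⁻¹ * z)‖ ^ 2) (ann 1 n) := fun w hw =>
    ((hfc w hw).norm.pow 2).integrableOn_compact (ann_compact 1 n)
  have hms := (ann_closed 1 n).measurableSet
  have hJle : ∀ w ∈ V, ∀ l : ℝ, 0 < l → ‖J w‖ ≤ (l * Q w + l⁻¹ * Q s) / 2 := by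
    intro w hw l hl
    calc ‖J w‖ ≤ ∫ z in ann 1 n, ‖f (w⁻¹ * z) * φ z‖ := norm_integral_le_integral_norm _
      _ ≤ ∫ z in ann 1 n, (l * ‖f (w⁻¹ * z)‖ ^ 2 + l⁻¹ * ‖f (s⁻¹ * z)‖ ^ 2) / 2 := by
        refine integral_mono ?_ ?_ ?_
        · exact (((hfc w hw).mul hφ).norm).integrableOn_compact (ann_compact 1 n)
        · exact (((hQi w hw).const_mul l).add ((hQi s hsV).const_mul l⁻¹)).div_const 2
        · intro z
          simp only [norm_mul, φ, RCLike.norm_conj]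
          generalize ‖f (w⁻¹ * z)‖ = a
          generalize ‖f (s⁻¹ * z)‖ = b
          have : l * a ^ 2 + l⁻¹ * b ^ 2 - 2 * (a * b) = l⁻¹ * (l * a - b) ^ 2 := by
            field_simp; ring
          have h2 : 0 ≤ l⁻¹ * (l * a - b) ^ 2 := by positivity
          linarith
      _ = (l * Q w + l⁻¹ * Q s) / 2 := by
        rw [integral_div, integral_add ((hQi w hw).const_mul l) ((hQi s hsV).const_mul l⁻¹),
          integral_const_mul, integral_const_mul]
  let Ψ : ℂ → ℂ := fun w => (w ^ 2)⁻¹ * J w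
  have hΨ : DifferentiableOn ℂ Ψ V := by
    refine DifferentiableOn.mul (DifferentiableOn.inv (by fun_prop) ?_) hJ
    intro w hw
    exact pow_ne_zero _ hw.1
  have hQs0 : 0 ≤ Q s := integral_nonneg (fun z => by positivity)
  -- tail
  have htail : Tendsto (fun ρ : ℝ => ∫ z in {z : ℂ | ρ ≤ ‖z‖}, ‖f z‖ ^ 2) atTop (nhds 0) := by
    have := tendsto_setIntegral_of_antitone (μ := volume) (f := fun z => ‖f z‖ ^ 2)
      (s := fun ρ : ℝ => {z : ℂ | ρ ≤ ‖z‖})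
      (fun ρ => (isClosed_le continuous_const continuous_norm).measurableSet)
      (fun a b hab z hz => le_trans hab hz)
      ⟨r, hint.mono_set (fun z hz => lt_of_lt_of_le hr hz)⟩
    have he : (⋂ ρ : ℝ, {z : ℂ | ρ ≤ ‖z‖}) = ∅ := by
      ext z
      simp only [Set.mem_iInter, Set.mem_ofPred_eq, Set.mem_empty_iff_false, iff_false, not_forall,
        not_le]
      exact ⟨‖z‖ + 1, by linarith⟩
    rw [he] at this
    simpa using this
  have hItail : ∀ ρ, r ≤ ρ → I ρ ≤ ∫ z in {z : ℂ | ρ ≤ ‖z‖}, ‖f z‖ ^ 2 := by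
    intro ρ hρ
    refine setIntegral_mono_set (hint.mono_set ?_) ?_ ?_
    · intro z hz
      exact lt_of_lt_of_le hr (hρ.trans hz)
    · exact Eventually.of_forall (fun z => by positivity)
    · exact LE.le.eventuallyLE (fun z hz => hz.1)
  have hnorm : Tendsto (fun w : ℂ => ‖w‖⁻¹) (nhdsWithin 0 {0}ᶜ) atTop :=
    tendsto_inv_nhdsGT_zero.comp tendsto_norm_nhdsNE_zero
  have ho : (fun z => Ψ z - Ψ 0) =o[nhdsWithin 0 {0}ᶜ] fun z => (z - 0)⁻¹ := by
    rw [Asymptotics.isLittleO_iff]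
    intro ε hε
    have hμ : 0 < (Q s + 1) / ε := by positivity
    have h1 := hnorm.eventually ((htail.eventually (gt_mem_nhds (show 0 < ε / ((Q s + 1) / ε) by positivity))).and
      (eventually_ge_atTop r))
    filter_upwards [h1, self_mem_nhdsWithin] with w hw hw0
    have hw0 : w ≠ 0 := hw0
    have hwp : 0 < ‖w‖ := norm_pos_iff.2 hw0
    have hwV : w ∈ V := hVof w hw0 (by rw [le_inv_comm₀ hwp hrp]; exact hw.2)
    have hI := (hItail _ hw.2).trans_lt hw.1
    rw [lt_div_iff₀ hμ] at hI
    have hb := hJle w hwV ((Q s + 1) / ε * ‖w‖⁻¹) (by positivity)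
    rw [hQ w hw0] at hb
    have e0 : Ψ 0 = 0 := by simp [Ψ]
    rw [e0, sub_zero, sub_zero, norm_inv]
    have e1 : ‖Ψ w‖ = (‖w‖ ^ 2)⁻¹ * ‖J w‖ := by simp [Ψ]
    rw [e1]
    have hq : ε * (Q s / (Q s + 1)) ≤ ε := by
      have : Q s / (Q s + 1) ≤ 1 := by rw [div_le_one (by positivity)]; linarith
      nlinarith
    calc (‖w‖ ^ 2)⁻¹ * ‖J w‖ ≤ (‖w‖ ^ 2)⁻¹ * (((Q s + 1) / ε * ‖w‖⁻¹ * (‖w‖ ^ 2 * I ‖w‖⁻¹)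
          + ((Q s + 1) / ε * ‖w‖⁻¹)⁻¹ * Q s) / 2) := by gcongr
      _ = (I ‖w‖⁻¹ * ((Q s + 1) / ε) + ε * (Q s / (Q s + 1))) / 2 * ‖w‖⁻¹ := by
        have : Q s + 1 ≠ 0 := by positivity
        field_simp
      _ ≤ ε * ‖w‖⁻¹ := by
        gcongr
        linarith
  have hball : closedBall (0 : ℂ) r⁻¹ ⊆ insert 0 V := by
    intro w hw
    by_cases h0 : w = 0
    · exact Or.inl h0
    · exact Or.inr (hVof w h0 (by simpa using hw))
  have hnb : insert 0 V ∈ nhds (0 : ℂ) :=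
    mem_of_superset (closedBall_mem_nhds 0 (by positivity)) hball
  have hupd := Complex.differentiableOn_update_limUnder_of_isLittleO hnb
    (hΨ.mono (by rintro w ⟨h1 | h1, h2⟩; exacts [absurd h1 h2, h1])) ho
  set Ψ' := Function.update Ψ 0 (limUnder (nhdsWithin 0 {0}ᶜ) Ψ) with hΨ'
  have hne : ∀ w, w ≠ 0 → Ψ' w = Ψ w := fun w hw => Function.update_of_ne hw _ _
  have hdc : DiffContOnCl ℂ Ψ' (ball 0 r⁻¹) := by
    refine DifferentiableOn.diffContOnCl ?_
    rw [closure_ball _ (by positivity)]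
    exact hupd.mono hball
  have hmax := Complex.norm_le_of_forall_mem_frontier_norm_le isBounded_ball hdc
    (C := (r⁻¹ ^ 2)⁻¹ * ((R⁻¹ ^ 2 / r⁻¹ ^ 2 * (r⁻¹ ^ 2 * I r) + (R⁻¹ ^ 2 / r⁻¹ ^ 2)⁻¹ * Q s) / 2)) ?_
    (z := s) (subset_closure (by simpa [hsn] using hRr))
  · have hJs : J s = (Q s : ℂ) := by
      simp only [J, Q, φ]
      rw [← integral_complex_ofReal]
      congr 1
      ext z
      rw [Complex.mul_conj, Complex.normSq_eq_norm_sq]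
    rw [hne s hs0] at hmax
    have e1 : ‖Ψ s‖ = (R⁻¹ ^ 2)⁻¹ * Q s := by
      simp only [Ψ, norm_mul, norm_inv, norm_pow, hsn, hJs, Complex.norm_real,
        Real.norm_of_nonneg hQs0]
    rw [e1, hQ s hs0, hsn, inv_inv] at hmax
    change R ^ 2 * I R ≤ r ^ 2 * I r
    have e2 : (R⁻¹ ^ 2)⁻¹ * (R⁻¹ ^ 2 * I R) = I R := by field_simp
    have e3 : (r⁻¹ ^ 2)⁻¹ * ((R⁻¹ ^ 2 / r⁻¹ ^ 2 * (r⁻¹ ^ 2 * I r) +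
        (R⁻¹ ^ 2 / r⁻¹ ^ 2)⁻¹ * (R⁻¹ ^ 2 * I R)) / 2) = (r ^ 2 * I r / R ^ 2 + I R) / 2 := by
      field_simp
    rw [e2, e3] at hmax
    have : I R ≤ r ^ 2 * I r / R ^ 2 := by linarith
    rw [le_div_iff₀ (by positivity)] at this
    linarith
  · intro w hw
    rw [frontier_ball _ (by positivity), mem_sphere_zero_iff_norm] at hw
    have hw0 : w ≠ 0 := by rw [← norm_pos_iff, hw]; positivity
    have hb := hJle w (hVof w hw0 hw.le) (R⁻¹ ^ 2 / r⁻¹ ^ 2) (by positivity)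
    rw [hQ w hw0, hw, inv_inv] at hb
    rw [hne w hw0]
    have e1 : ‖Ψ w‖ = (r⁻¹ ^ 2)⁻¹ * ‖J w‖ := by
      simp only [Ψ, norm_mul, norm_inv, norm_pow, hw]
    rw [e1]
    gcongr

lemma core_s6 (f : ℂ → ℂ) (r0 r R : ℝ) (hr0 : 0 < r0) (hr : r0 < r) (hR : r < R)
    (hf : DifferentiableOn ℂ f {z | r0 < ‖z‖})
    (hint : IntegrableOn (fun z => ‖f z‖ ^ 2) {z | r0 < ‖z‖}) :
    R ^ 2 * ∫ z in {z : ℂ | R ≤ ‖z‖}, ‖f z‖ ^ 2 ≤ r ^ 2 * ∫ z in {z : ℂ | r ≤ ‖z‖}, ‖f z‖ ^ 2 := by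
  have hrp : 0 < r := hr0.trans hr
  have lim : ∀ ρ, r ≤ ρ → Tendsto (fun n : ℝ => ∫ z in ann ρ (n * ρ), ‖f z‖ ^ 2) atTop
      (nhds (∫ z in {z : ℂ | ρ ≤ ‖z‖}, ‖f z‖ ^ 2)) := by
    intro ρ hρ
    have hρp : 0 < ρ := hrp.trans_le hρ
    have hU : (⋃ n : ℝ, ann ρ (n * ρ)) = {z : ℂ | ρ ≤ ‖z‖} := by
      ext z
      simp only [Set.mem_iUnion, ann, Set.mem_ofPred_eq]
      constructor
      · rintro ⟨n, h, _⟩; exact h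
      · intro h; exact ⟨‖z‖ / ρ, h, by rw [div_mul_cancel₀ _ hρp.ne']⟩
    rw [← hU]
    refine tendsto_setIntegral_of_monotone (fun n => (ann_closed _ _).measurableSet) ?_ ?_
    · intro a b hab z hz
      exact ⟨hz.1, hz.2.trans (by gcongr)⟩
    · rw [hU]
      exact hint.mono_set (fun z hz => lt_of_lt_of_le hr (hρ.trans hz))
  exact le_of_tendsto_of_tendsto' ((lim R hR.le).const_mul _) ((lim r le_rfl).const_mul _)
    (fun n => core_ann f r0 r R n hr0 hr hR hf hint)

def toPt (c : Pt) (z : ℂ) : Pt := c + Complex.orthonormalBasisOneI.repr z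

lemma repr_one : Complex.orthonormalBasisOneI.repr (1 : ℂ) = EuclideanSpace.single 0 (1 : ℝ) := by
  ext i; fin_cases i <;> simp
lemma repr_I : Complex.orthonormalBasisOneI.repr Complex.I = EuclideanSpace.single 1 (1 : ℝ) := by
  ext i; fin_cases i <;> simp

lemma toPt_mp (c : Pt) : MeasurePreserving (toPt c) :=
  (measurePreserving_add_left volume c).comp Complex.orthonormalBasisOneI.measurePreserving_repr

lemma toPt_me (c : Pt) : MeasurableEmbedding (toPt c) :=
  ((Complex.orthonormalBasisOneI.repr.toHomeomorph).trans (Homeomorph.addLeft c)).measurableEmbedding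

lemma toPt_norm (c : Pt) (z : ℂ) : dist (toPt c z) c = ‖z‖ := by
  simp [toPt]

lemma fderiv_toPt (h : Pt → ℝ) (c : Pt) (z v : ℂ) :
    fderiv ℝ (fun z => h (toPt c z)) z v
      = fderiv ℝ h (toPt c z) (Complex.orthonormalBasisOneI.repr v) := by
  have := Complex.orthonormalBasisOneI.repr.toContinuousLinearEquiv.comp_right_fderiv
    (f := fun y => h (c + y)) (x := z)
  have e : (fun z => h (toPt c z)) = (fun y => h (c + y)) ∘
    Complex.orthonormalBasisOneI.repr.toContinuousLinearEquiv := rfl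
  rw [e, this, fderiv_comp_add_left]
  rfl

lemma grad_norm (h : Pt → ℝ) (x : Pt) : ‖gradient h x‖ ^ 2 =
    (fderiv ℝ h x (EuclideanSpace.single 0 1)) ^ 2
      + (fderiv ℝ h x (EuclideanSpace.single 1 1)) ^ 2 := by
  rw [EuclideanSpace.norm_sq_eq, Fin.sum_univ_two]
  have : ∀ i, gradient h x i = fderiv ℝ h x (EuclideanSpace.single i 1) := by
    intro i
    have h1 : inner ℝ (gradient h x) (EuclideanSpace.single i (1:ℝ))
        = fderiv ℝ h x (EuclideanSpace.single i 1) := by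
      rw [gradient, InnerProductSpace.toDual_symm_apply]
    rw [← h1, EuclideanSpace.inner_single_right]
    simp
  simp [this]

lemma lap_toPt (h : Pt → ℝ) (c : Pt) (z : ℂ) :
    Laplacian.laplacian (fun z => h (toPt c z)) z = lap h (toPt c z) := by
  have e : (fun z => h (toPt c z)) = (fun y => h (c + y)) ∘
    Complex.orthonormalBasisOneI.repr.toContinuousLinearEquiv := rfl
  have h2 := Complex.orthonormalBasisOneI.repr.toContinuousLinearEquiv.iteratedFDerivWithin_comp_right
    (fun y => h (c + y)) uniqueDiffOn_univ (x := z) (Set.mem_univ _) 2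
  rw [Set.preimage_univ, iteratedFDerivWithin_univ, iteratedFDerivWithin_univ,
    iteratedFDeriv_comp_add_left] at h2
  rw [InnerProductSpace.laplacian_eq_iteratedFDeriv_complexPlane, lap, Fin.sum_univ_two, e]
  simp only [h2, ContinuousMultilinearMap.compContinuousLinearMap_apply]
  congr 1
  · refine congrArg _ ?_
    ext1 i
    fin_cases i <;> exact repr_one
  · refine congrArg _ ?_
    ext1 i
    fin_cases i <;> exact repr_I

theorem stmt6 (𝒢 𝒪 : Set Pt) (c : Pt) (Re Ri Rp Rm δ δ₀ : ℝ)
    (geom : Geometry 𝒢 𝒪 c Re Ri Rp Rm δ δ₀)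
    (h : Pt → ℝ) (hharm : IsHarmonicOn h (closure 𝒪)ᶜ)
    (hdir : IntegrableOn (fun x => ‖gradient h x‖ ^ 2) (closure 𝒪)ᶜ) :
    (∫ x in (closure 𝒢)ᶜ, ‖gradient h x‖ ^ 2)
      ≤ Rm ^ 2 / (Ri ^ 2 - Rm ^ 2) * ∫ x in 𝒢 \ closure 𝒪, ‖gradient h x‖ ^ 2 := by
  have hRm := geom.Rm_pos
  have hRmi : Rm < Ri := geom.Rm_lt_Rp.trans geom.Rp_lt_Ri
  obtain ⟨r0, ⟨hr0, hr0m⟩, hsub⟩ := exists_pos_lt_subset_ball hRm isClosed_closure geom.clO_sub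
  have hWo : IsOpen (closure 𝒪)ᶜ := isClosed_closure.isOpen_compl
  let H : ℂ → ℝ := fun z => h (toPt c z)
  let f : ℂ → ℂ := fun z => fderiv ℝ H z 1 - Complex.I * fderiv ℝ H z Complex.I
  have hcT : ContDiff ℝ 2 (toPt c) :=
    contDiff_const.add (Complex.orthonormalBasisOneI.repr.toContinuousLinearEquiv.contDiff)
  have hmem : ∀ z ∈ {z : ℂ | r0 < ‖z‖}, toPt c z ∈ (closure 𝒪)ᶜ := by
    intro z hz hz'
    have := hsub hz'
    rw [mem_ball, toPt_norm] at this
    exact lt_asymm this hz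
  have hUo : IsOpen {z : ℂ | r0 < ‖z‖} := isOpen_lt continuous_const continuous_norm
  have hf : DifferentiableOn ℂ f {z | r0 < ‖z‖} := by
    intro z hz
    refine (HarmonicAt.differentiableAt_complex_partial ⟨?_, ?_⟩).differentiableWithinAt
    · exact (hharm.1.contDiffAt (hWo.mem_nhds (hmem z hz))).comp z hcT.contDiffAt
    · filter_upwards [hUo.mem_nhds hz] with y hy
      rw [lap_toPt]
      exact hharm.2 _ (hmem y hy)
  have hfn : ∀ z, ‖f z‖ ^ 2 = ‖gradient h (toPt c z)‖ ^ 2 := by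
    intro z
    rw [grad_norm, ← repr_one, ← repr_I, ← fderiv_toPt, ← fderiv_toPt, ← Complex.normSq_eq_norm_sq,
      Complex.normSq_apply]
    simp [f, H]
    ring
  have hpre : ∀ ρ : ℝ, toPt c ⁻¹' {x | ρ ≤ dist x c} = {z : ℂ | ρ ≤ ‖z‖} := by
    intro ρ; ext z; simp [toPt_norm]
  have hint : IntegrableOn (fun z => ‖f z‖ ^ 2) {z | r0 < ‖z‖} := by
    have h1 := ((toPt_mp c).integrableOn_comp_preimage (toPt_me c)).2 hdir
    refine (h1.mono_set (fun z hz => hmem z hz)).congr_fun ?_ hUo.measurableSet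
    intro z _
    exact (hfn z).symm
  have hE : ∀ ρ : ℝ, ∫ z in {z : ℂ | ρ ≤ ‖z‖}, ‖f z‖ ^ 2
      = ∫ x in {x | ρ ≤ dist x c}, ‖gradient h x‖ ^ 2 := by
    intro ρ
    rw [← (toPt_mp c).setIntegral_preimage_emb (toPt_me c), hpre]
    simp only [hfn]
  have key := core_s6 f r0 Rm Ri hr0 hr0m hRmi hf hint
  rw [hE, hE] at key
  have hcl : ∀ ρ : ℝ, MeasurableSet {x : Pt | ρ ≤ dist x c} := fun ρ =>
    (isClosed_le continuous_const (by fun_prop)).measurableSet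
  have hsubW : {x : Pt | Rm ≤ dist x c} ⊆ (closure 𝒪)ᶜ := by
    intro x hx hx'
    have := geom.clO_sub hx'
    rw [mem_ball] at this
    exact absurd this (not_lt.2 hx)
  have hss : {x : Pt | Ri ≤ dist x c} ⊆ {x : Pt | Rm ≤ dist x c} := fun x hx => hRmi.le.trans hx
  have hdiff := setIntegral_sdiff (hcl Ri) (hdir.mono_set hsubW) hss
  have h1 : ∫ x in (closure 𝒢)ᶜ, ‖gradient h x‖ ^ 2
      ≤ ∫ x in {x : Pt | Ri ≤ dist x c}, ‖gradient h x‖ ^ 2 := by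
    refine setIntegral_mono_set (hdir.mono_set (hss.trans hsubW))
      (Eventually.of_forall fun x => by positivity) (LE.le.eventuallyLE ?_)
    intro x hx
    by_contra hlt
    exact hx (subset_closure (geom.clDi_sub (mem_closedBall.2 (not_le.1 hlt).le)))
  have h2 : ∫ x in {x : Pt | Rm ≤ dist x c} \ {x : Pt | Ri ≤ dist x c}, ‖gradient h x‖ ^ 2
      ≤ ∫ x in 𝒢 \ closure 𝒪, ‖gradient h x‖ ^ 2 := by
    refine setIntegral_mono_set (hdir.mono_set (fun x hx => hx.2))
      (Eventually.of_forall fun x => by positivity) (LE.le.eventuallyLE ?_)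
    intro x hx
    exact ⟨geom.clDi_sub (mem_closedBall.2 (not_le.1 hx.2).le), hsubW hx.1⟩
  rw [hdiff] at h2
  have hpos : 0 < Ri ^ 2 - Rm ^ 2 := by nlinarith
  refine h1.trans ?_
  rw [div_mul_eq_mul_div, le_div_iff₀ hpos]
  have h3 := mul_le_mul_of_nonneg_left h2 (sq_nonneg Rm)
  linarith
end
end

section
/- Under the Geometry hypothesis, every function h that is harmonic on 𝒦 = ℝ² ∖ closure(𝒪) with finite Dirichlet energy ∫_𝒦 |∇h|² dx < ∞ satisfies ∫_{ℱ_Γ} |∇h|² dx ≤ (R_- /R_+)² · ∫_ℱ |∇h|² dx and ∫_{ℱ_Σ} |∇h|² dx ≥ (1 − (R_- /R_+)²) · ∫_ℱ |∇h|² dx. (Estimates (3.11) of Lemma 3.4.) -/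
open MeasureTheory Metric Filter

noncomputable section

def cirM (F : ℂ → ℂ) (r : ℝ) : ℝ := ∫ θ in (0:ℝ)..(2*Real.pi), ‖F (circleMap 0 r θ)‖ ^ 2

def cirC (F : ℂ → ℂ) (r : ℝ) (n : ℤ) : ℂ :=
  fourierCoeffOn Real.two_pi_pos (fun θ => F (circleMap 0 r θ)) n

lemma cir_cont {F : ℂ → ℂ} {a r : ℝ} (ha : 0 < a) (hF : DifferentiableOn ℂ F {z | a < ‖z‖})
    (hr : a < r) : Continuous (fun θ => F (circleMap 0 r θ)) := by
  apply hF.continuousOn.comp_continuous (continuous_circleMap 0 r)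
  intro θ
  simp [abs_of_pos (ha.trans hr), hr]

lemma cirC_integral {F : ℂ → ℂ} {r : ℝ} (hr : 0 < r) (n : ℤ) :
    (∮ z in C(0, r), (z - 0)⁻¹ • (z ^ (-n) * F z)) =
      Complex.I * (2 * Real.pi) * ((r:ℂ) ^ (-n) * cirC F r n) := by
  have hpi : (Real.pi : ℂ) ≠ 0 := by exact_mod_cast Real.pi_ne_zero
  have hr0 : (r : ℂ) ≠ 0 := by exact_mod_cast hr.ne'
  rw [cirC, fourierCoeffOn_eq_integral, circleIntegral]
  have : ∀ θ : ℝ, deriv (circleMap 0 r) θ • ((circleMap 0 r θ - 0)⁻¹ • 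
      (circleMap 0 r θ ^ (-n) * F (circleMap 0 r θ))) = 
      (Complex.I * (r:ℂ)^(-n)) * (fourier (-n) (θ : AddCircle (2 * Real.pi - 0)) • F (circleMap 0 r θ)) := by
    intro θ
    have h0 : circleMap 0 r θ ≠ 0 := circleMap_ne_center hr.ne'
    rw [fourier_coe_apply, deriv_circleMap]
    have : Complex.exp (2 * Real.pi * Complex.I * ((-n : ℤ):ℂ) * θ / ((2 * Real.pi - 0 : ℝ):ℂ)) = 
       Complex.exp (θ * Complex.I) ^ (-n) := by
      rw [← Complex.exp_int_mul]
      congr 1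
      push_cast
      field_simp
      ring
    rw [this]
    have h2 : circleMap 0 r θ ^ (-n) = (r:ℂ)^(-n) * Complex.exp (θ * Complex.I) ^ (-n) := by
      rw [← mul_zpow]; simp [circleMap]
    rw [h2]
    simp only [smul_eq_mul, sub_zero]
    field_simp
  simp_rw [this]
  rw [intervalIntegral.integral_const_mul]
  simp only [sub_zero, Complex.real_smul]
  push_cast
  field_simp

lemma cirC_scale {F : ℂ → ℂ} {a s r : ℝ} (ha : 0 < a) (hF : DifferentiableOn ℂ F {z | a < ‖z‖})
    (hs : a < s) (hsr : s ≤ r) (n : ℤ) :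
    (r:ℂ) ^ (-n) * cirC F r n = (s:ℂ) ^ (-n) * cirC F s n := by
  have hpi : (Real.pi : ℂ) ≠ 0 := by exact_mod_cast Real.pi_ne_zero
  have hs0 := ha.trans hs
  have ho : IsOpen {z : ℂ | a < ‖z‖} := isOpen_lt continuous_const continuous_norm
  have hG : ∀ z : ℂ, a < ‖z‖ → DifferentiableAt ℂ (fun z => z ^ (-n) * F z) z := by
    intro z hz
    have hz0 : z ≠ 0 := by rintro rfl; simp at hz; linarith
    exact (differentiableAt_zpow.2 (Or.inl hz0)).mul (hF.differentiableAt (ho.mem_nhds hz))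
  have := Complex.circleIntegral_sub_center_inv_smul_eq_of_differentiable_on_annulus_off_countable
    (c := 0) hs0 hsr (f := fun z => z ^ (-n) * F z) Set.countable_empty
    (fun z hz => (hG z (by simp at hz; linarith [hz.2])).continuousAt.continuousWithinAt)
    (fun z hz => hG z (by simp at hz; linarith [hz.2]))
  rw [cirC_integral hs0, cirC_integral (hs0.trans_le hsr)] at this
  exact mul_left_cancel₀ (by simp [hpi]) this

lemma cirC_norm_scale {F : ℂ → ℂ} {a s r : ℝ} (ha : 0 < a)
    (hF : DifferentiableOn ℂ F {z | a < ‖z‖})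
    (hs : a < s) (hsr : s ≤ r) (n : ℤ) :
    ‖cirC F r n‖ = (r / s) ^ n * ‖cirC F s n‖ := by
  have h := congrArg norm (cirC_scale ha hF hs hsr n)
  have hs0 := ha.trans hs
  have hr0 := hs0.trans_le hsr
  simp only [norm_mul, norm_zpow, Complex.norm_real, Real.norm_eq_abs, abs_of_pos hs0,
    abs_of_pos hr0, zpow_neg, norm_inv] at h
  rw [div_zpow]
  field_simp at h ⊢
  linarith

lemma cir_hasSum {F : ℂ → ℂ} {a r : ℝ} (ha : 0 < a) (hF : DifferentiableOn ℂ F {z | a < ‖z‖})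
    (hr : a < r) : HasSum (fun n => ‖cirC F r n‖ ^ 2) ((2 * Real.pi)⁻¹ * cirM F r) := by
  have hc := cir_cont ha hF hr
  have := hasSum_sq_fourierCoeffOn (f := fun θ => F (circleMap 0 r θ)) Real.two_pi_pos (by
    rw [memLp_two_iff_integrable_sq_norm hc.aestronglyMeasurable]
    exact (hc.norm.pow 2).integrableOn_Ioc)
  simpa [cirC, cirM] using this

lemma cirM_nonneg (F : ℂ → ℂ) (r : ℝ) : 0 ≤ cirM F r := by
  apply intervalIntegral.integral_nonneg Real.two_pi_pos.le
  intro _ _; positivity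

lemma cirC_zero {F : ℂ → ℂ} {a : ℝ} (ha : 0 < a) (hF : DifferentiableOn ℂ F {z | a < ‖z‖})
    (hfin : ∫⁻ r in Set.Ioi a, ENNReal.ofReal (r * cirM F r) ≠ ⊤) {s : ℝ} (hs : a < s)
    {n : ℤ} (hn : -1 ≤ n) : cirC F s n = 0 := by
  by_contra hne
  have hs0 := ha.trans hs
  have hpos : 0 < ‖cirC F s n‖ := norm_pos_iff.2 hne
  set K : ℝ := ‖cirC F s n‖ ^ 2 * s ^ 2 * (2 * Real.pi) with hK
  have hKpos : 0 < K := by positivity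
  have key : ∀ r ∈ Set.Ioi s, K * r⁻¹ ≤ r * cirM F r := by
    intro r hr
    have hr : s < r := hr
    have hr0 := hs0.trans hr
    have h1 : ‖cirC F r n‖ ^ 2 ≤ (2 * Real.pi)⁻¹ * cirM F r :=
      (cir_hasSum ha hF (hs.trans hr)).summable.le_tsum n (fun _ _ => by positivity) |>.trans_eq
        (cir_hasSum ha hF (hs.trans hr)).tsum_eq
    have h2 : (r / s) ^ (-1 : ℤ) * ‖cirC F s n‖ ≤ ‖cirC F r n‖ := by
      rw [cirC_norm_scale ha hF hs hr.le n]
      gcongr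
      rw [le_div_iff₀ hs0]; linarith
    have h3 : ((r / s) ^ (-1 : ℤ) * ‖cirC F s n‖) ^ 2 ≤ (2 * Real.pi)⁻¹ * cirM F r := 
      le_trans (by gcongr) h1
    have h4 : K * r⁻¹ = (2 * Real.pi) * r * ((r / s) ^ (-1 : ℤ) * ‖cirC F s n‖) ^ 2 := by
      rw [zpow_neg_one, hK]; field_simp
    rw [h4]
    calc _ ≤ (2 * Real.pi) * r * ((2 * Real.pi)⁻¹ * cirM F r) := by gcongr
      _ = _ := by field_simp
  apply not_integrableOn_Ioi_inv (a := s)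
  have hI : IntegrableOn (fun r : ℝ => K * r⁻¹) (Set.Ioi s) := by
    refine ⟨by fun_prop, ?_⟩
    rw [hasFiniteIntegral_iff_ofReal]
    · refine lt_of_le_of_lt ?_ (lt_top_iff_ne_top.2 hfin)
      calc _ ≤ ∫⁻ r in Set.Ioi s, ENNReal.ofReal (r * cirM F r) :=
            setLIntegral_mono' measurableSet_Ioi (fun r hr => ENNReal.ofReal_le_ofReal (key r hr))
        _ ≤ _ := lintegral_mono_set (Set.Ioi_subset_Ioi hs.le)
    · filter_upwards [self_mem_ae_restrict measurableSet_Ioi] with r hr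
      have : 0 < r := hs0.trans hr
      positivity
  have := hI.const_mul K⁻¹
  simpa [IntegrableOn, ← mul_assoc, hKpos.ne'] using this

lemma cirM_scale {F : ℂ → ℂ} {a : ℝ} (ha : 0 < a) (hF : DifferentiableOn ℂ F {z | a < ‖z‖})
    (hfin : ∫⁻ r in Set.Ioi a, ENNReal.ofReal (r * cirM F r) ≠ ⊤) {s r : ℝ} (hs : a < s)
    (hsr : s ≤ r) : (r / s) ^ 4 * cirM F r ≤ cirM F s := by
  have hs0 := ha.trans hs
  have hr0 := hs0.trans_le hsr
  have h1 := (cir_hasSum ha hF (hs.trans_le hsr)).mul_left ((r/s)^4)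
  have h2 := cir_hasSum ha hF hs
  have h3 := hasSum_le (fun n => ?_) h1 h2
  · have hp := Real.pi_pos
    have : (2 * Real.pi)⁻¹ * ((r / s) ^ 4 * cirM F r) ≤ (2 * Real.pi)⁻¹ * cirM F s := by linarith
    exact le_of_mul_le_mul_left this (by positivity)
  · by_cases hn : -1 ≤ n
    · simp [cirC_zero ha hF hfin hs hn, cirC_zero ha hF hfin (hs.trans_le hsr) hn]
    · rw [cirC_norm_scale ha hF hs hsr n]
      have hrs : 1 ≤ r / s := by rw [le_div_iff₀ hs0]; linarith
      have h5 : (r / s) ^ n ≤ (r/s) ^ (-2:ℤ) := zpow_le_zpow_right₀ hrs (by omega)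
      calc _ ≤ (r / s) ^ 4 * ((r / s) ^ (-2:ℤ) * ‖cirC F s n‖) ^ 2 := by gcongr
        _ = _ := by
          rw [zpow_neg]; norm_cast; field_simp

lemma polar_eq {F : ℂ → ℂ} {a : ℝ} (ha : 0 < a) (hF : DifferentiableOn ℂ F {z | a < ‖z‖})
    {b : ℝ} (hb : a ≤ b) :
    ∫⁻ z in {z | b < ‖z‖}, ENNReal.ofReal (‖F z‖ ^ 2) =
      ∫⁻ r in Set.Ioi b, ENNReal.ofReal (r * cirM F r) := by
  have hmeas : MeasurableSet {z : ℂ | b < ‖z‖} := (isOpen_lt continuous_const continuous_norm).measurableSet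
  have hcont : ContinuousOn (fun z => ENNReal.ofReal (‖F z‖ ^ 2)) {z | b < ‖z‖} := by
    have : ContinuousOn F {z | b < ‖z‖} := hF.continuousOn.mono (fun z hz => lt_of_le_of_lt hb hz)
    exact ENNReal.continuous_ofReal.comp_continuousOn (by fun_prop)
  have hmF : Measurable ({z : ℂ | b < ‖z‖}.indicator (fun z => ENNReal.ofReal (‖F z‖ ^ 2))) :=
    by
    classical
    rw [← Set.piecewise_eq_indicator]
    exact hcont.measurable_piecewise continuousOn_const hmeas
  rw [← lintegral_indicator hmeas, ← Complex.lintegral_comp_polarCoord_symm]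
  have hsymm : ∀ p : ℝ × ℝ, Complex.polarCoord.symm p = circleMap 0 p.1 p.2 := by
    intro p
    simp [circleMap, Complex.exp_mul_I]
  simp_rw [hsymm]
  rw [polarCoord_target, Measure.volume_eq_prod, ← Measure.prod_restrict,
    lintegral_prod _ ?_]
  rotate_left
  · apply Measurable.aemeasurable
    have : Measurable (fun p : ℝ × ℝ => circleMap 0 p.1 p.2) := by
      unfold circleMap; fun_prop
    simp only [smul_eq_mul]
    exact (ENNReal.measurable_ofReal.comp measurable_fst).mul (hmF.comp this)
  simp only [smul_eq_mul]
  have hb0 := ha.trans_le hb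
  have hR : ∫⁻ r in Set.Ioi b, ENNReal.ofReal (r * cirM F r) =
      ∫⁻ r in Set.Ioi 0, (Set.Ioi b).indicator (fun r => ENNReal.ofReal (r * cirM F r)) r := by
    rw [lintegral_indicator measurableSet_Ioi, Measure.restrict_restrict measurableSet_Ioi,
      Set.inter_eq_left.2 (Set.Ioi_subset_Ioi hb0.le)]
  rw [hR]
  refine setLIntegral_congr_fun measurableSet_Ioi (fun r hr => ?_)
  have hr : 0 < r := hr
  by_cases hbr : b < r
  · have hmem : ∀ θ, circleMap 0 r θ ∈ {z : ℂ | b < ‖z‖} := by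
      intro θ; simp [abs_of_pos hr, hbr]
    simp only [Set.indicator_of_mem (hmem _), Set.indicator_of_mem (Set.mem_Ioi.2 hbr)]
    have hc := cir_cont ha hF (hb.trans_lt hbr)
    rw [lintegral_const_mul' _ _ ENNReal.ofReal_ne_top, ENNReal.ofReal_mul hr.le]
    congr 1
    rw [← ofReal_integral_eq_lintegral_ofReal]
    · congr 1
      rw [← integral_Ioc_eq_integral_Ioo, ← intervalIntegral.integral_of_le
        (by linarith [Real.pi_pos]), cirM]
      have hper : Function.Periodic (fun θ => ‖F (circleMap 0 r θ)‖ ^ 2) (2 * Real.pi) := by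
        intro θ; simp only [periodic_circleMap 0 r θ]
      have := hper.intervalIntegral_add_eq (-Real.pi) 0
      rw [zero_add] at this
      rw [← this]; congr 1; ring
    · exact (hc.norm.pow 2).integrableOn_Ioc.mono_set Set.Ioo_subset_Ioc_self
    · exact Eventually.of_forall fun _ => by positivity
  · have hmem : ∀ θ, circleMap 0 r θ ∉ {z : ℂ | b < ‖z‖} := by
      intro θ; simpa [abs_of_pos hr] using hbr
    simp only [Set.indicator_of_notMem (hmem _)]
    rw [Set.indicator_of_notMem (by simpa using hbr)]
    simp

lemma ext_scale {F : ℂ → ℂ} {a b : ℝ} (ha : 0 < a) (hF : DifferentiableOn ℂ F {z | a < ‖z‖})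
    (hab : a ≤ b) (hfin : ∫⁻ z in {z | a < ‖z‖}, ENNReal.ofReal (‖F z‖ ^ 2) ≠ ⊤) :
    ∫⁻ z in {z | b < ‖z‖}, ENNReal.ofReal (‖F z‖ ^ 2) ≤
      ENNReal.ofReal ((a / b) ^ 2) * ∫⁻ z in {z | a < ‖z‖}, ENNReal.ofReal (‖F z‖ ^ 2) := by
  rw [polar_eq ha hF le_rfl] at hfin ⊢
  rw [polar_eq ha hF hab]
  have hb0 := ha.trans_le hab
  set k := b / a with hk
  have hk1 : 1 ≤ k := by rw [hk, le_div_iff₀ ha]; linarith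
  have hk0 : 0 < k := by linarith
  have him : Set.Ioi b = (fun x => k * x) '' Set.Ioi a := by
    rw [Set.image_mul_left_Ioi hk0, hk]; congr 1; field_simp
  rw [him, lintegral_image_eq_lintegral_abs_deriv_mul measurableSet_Ioi (f' := fun _ => k)
    (fun x _ => by simpa using ((hasDerivAt_id x).const_mul k).hasDerivWithinAt)
    (fun x _ y _ h => mul_left_cancel₀ hk0.ne' h),
    ← lintegral_const_mul' _ _ ENNReal.ofReal_ne_top]
  refine setLIntegral_mono' measurableSet_Ioi (fun s hs => ?_)
  have hs : a < s := hs
  have hs0 := ha.trans hs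
  rw [← ENNReal.ofReal_mul (by positivity), ← ENNReal.ofReal_mul (by positivity)]
  apply ENNReal.ofReal_le_ofReal
  have h := cirM_scale ha hF hfin hs (show s ≤ k * s by nlinarith)
  rw [mul_div_cancel_right₀ _ hs0.ne'] at h
  have hab' : a / b = k⁻¹ := by rw [hk, inv_div]
  rw [abs_of_pos hk0, hab']
  calc k * (k * s * cirM F (k * s)) = (k⁻¹) ^ 2 * (s * (k ^ 4 * cirM F (k * s))) := by field_simp
    _ ≤ _ := by gcongr

def LL : ℂ ≃ₗᵢ[ℝ] Pt := Complex.orthonormalBasisOneI.repr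

lemma LL_one : LL 1 = EuclideanSpace.single 0 1 := by
  ext i; fin_cases i <;> simp [LL]

lemma LL_I : LL Complex.I = EuclideanSpace.single 1 1 := by
  ext i; fin_cases i <;> simp [LL]

def HH (h : Pt → ℝ) (c : Pt) (z : ℂ) : ℝ := h (c + LL z)

def FF (h : Pt → ℝ) (c : Pt) (z : ℂ) : ℂ :=
  fderiv ℝ (HH h c) z 1 - Complex.I * fderiv ℝ (HH h c) z Complex.I

lemma HH_fderiv (h : Pt → ℝ) (c : Pt) (z v : ℂ) :
    fderiv ℝ (HH h c) z v = fderiv ℝ h (c + LL z) (LL v) := by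
  have h1 : HH h c = (fun y => h (c + y)) ∘ LL.toContinuousLinearEquiv := rfl
  rw [h1, ContinuousLinearEquiv.comp_right_fderiv, fderiv_comp_add_left]
  rfl

lemma lap_HH (h : Pt → ℝ) (c : Pt) (z : ℂ) :
    Laplacian.laplacian (HH h c) z = lap h (c + LL z) := by
  have h1 : HH h c = (fun y => h (c + y)) ∘ LL.toContinuousLinearEquiv := rfl
  have h2 : iteratedFDeriv ℝ 2 (HH h c) z = 
     (iteratedFDeriv ℝ 2 h (c + LL z)).compContinuousLinearMap 
      fun _ => (LL.toContinuousLinearEquiv : ℂ →L[ℝ] Pt) := by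
    have := LL.toContinuousLinearEquiv.iteratedFDerivWithin_comp_right (fun y => h (c + y))
      uniqueDiffOn_univ (x := z) (Set.mem_univ _) 2
    simp only [Set.preimage_univ, iteratedFDerivWithin_univ] at this
    rw [h1, this, iteratedFDeriv_comp_add_left]
    rfl
  rw [InnerProductSpace.laplacian_eq_iteratedFDeriv_complexPlane]
  simp only [h2, lap, Fin.sum_univ_two, ContinuousMultilinearMap.compContinuousLinearMap_apply]
  congr 2 <;> funext i <;> fin_cases i <;> simp [LL_one, LL_I]

lemma norm_FF (h : Pt → ℝ) (c : Pt) (z : ℂ) :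
    ‖FF h c z‖ ^ 2 = ‖gradient h (c + LL z)‖ ^ 2 := by
  rw [FF, HH_fderiv, HH_fderiv, LL_one, LL_I, EuclideanSpace.norm_sq_eq, Fin.sum_univ_two]
  have hi : ∀ i, gradient h (c + LL z) i = fderiv ℝ h (c + LL z) (EuclideanSpace.single i 1) := by
    intro i
    have h1 := InnerProductSpace.toDual_symm_apply (𝕜 := ℝ) (E := Pt)
      (x := EuclideanSpace.single i (1 : ℝ)) (y := fderiv ℝ h (c + LL z))
    rw [EuclideanSpace.inner_single_right] at h1
    simpa [gradient] using h1
  rw [hi, hi, Complex.sq_norm, Complex.normSq_apply]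
  simp
  ring

lemma FF_diff {h : Pt → ℝ} {U : Set Pt} (hU : IsOpen U) (hh : IsHarmonicOn h U) (c : Pt) {z : ℂ}
    (hz : c + LL z ∈ U) : DifferentiableAt ℂ (FF h c) z := by
  have hcont : Continuous (fun z => c + LL z) := by fun_prop
  apply HarmonicAt.differentiableAt_complex_partial
  constructor
  · have h1 : ContDiffAt ℝ 2 h (c + LL z) := hh.1.contDiffAt (hU.mem_nhds hz)
    have h2 : ContDiffAt ℝ 2 (fun z => c + LL z) z :=
      contDiffAt_const.add LL.toContinuousLinearEquiv.contDiff.contDiffAt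
    exact ContDiffAt.comp z h1 h2
  · filter_upwards [hcont.continuousAt.preimage_mem_nhds (hU.mem_nhds hz)] with w hw
    rw [lap_HH]
    exact hh.2 _ hw

lemma lint_transfer (h : Pt → ℝ) (c : Pt) (r : ℝ) :
    ∫⁻ z in {z | r < ‖z‖}, ENNReal.ofReal (‖FF h c z‖ ^ 2) =
      ∫⁻ x in (closedBall c r)ᶜ, ENNReal.ofReal (‖gradient h x‖ ^ 2) := by
  have hmp : MeasurePreserving (fun z => c + LL z) := 
    (measurePreserving_add_left volume c).comp LL.measurePreserving
  have hemb : MeasurableEmbedding (fun z => c + LL z) :=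
    (measurableEmbedding_addLeft c).comp LL.toMeasurableEquiv.measurableEmbedding
  rw [← hmp.setLIntegral_comp_preimage_emb hemb]
  simp_rw [norm_FF]
  congr 2
  ext z
  simp [dist_eq_norm]

theorem stmt7 (𝒢 𝒪 : Set Pt) (c : Pt) (Re Ri Rp Rm δ δ₀ : ℝ)
    (geom : Geometry 𝒢 𝒪 c Re Ri Rp Rm δ δ₀)
    (h : Pt → ℝ) (hharm : IsHarmonicOn h (closure 𝒪)ᶜ)
    (hdir : IntegrableOn (fun x => ‖gradient h x‖ ^ 2) (closure 𝒪)ᶜ) :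
    (∫ x in (𝒢 \ closure 𝒪) \ closedBall c Rp, ‖gradient h x‖ ^ 2)
        ≤ (Rm / Rp) ^ 2 * ∫ x in 𝒢 \ closure 𝒪, ‖gradient h x‖ ^ 2
      ∧ (1 - (Rm / Rp) ^ 2) * (∫ x in 𝒢 \ closure 𝒪, ‖gradient h x‖ ^ 2)
        ≤ ∫ x in ball c Rp \ closure 𝒪, ‖gradient h x‖ ^ 2 := by
  obtain ⟨hGo, -, -, -, -, -, -, hm0, hmp, hpi, -, -, hGi, -, -, hO, -, -, -, -⟩ := geom
  have hp0 := hm0.trans hmp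
  have hUo : IsOpen (closure 𝒪)ᶜ := isClosed_closure.isOpen_compl
  have hOm : (closedBall c Rm)ᶜ ⊆ (closure 𝒪)ᶜ :=
    Set.compl_subset_compl.2 (hO.trans ball_subset_closedBall)
  have hsub : (closedBall c Rp)ᶜ ⊆ (closedBall c Rm)ᶜ :=
    Set.compl_subset_compl.2 (closedBall_subset_closedBall hmp.le)
  have hdiff : DifferentiableOn ℂ (FF h c) {z | Rm < ‖z‖} := by
    intro z hz
    refine (FF_diff hUo hharm c (hOm ?_)).differentiableWithinAt
    simpa [dist_eq_norm] using hz
  have hIm := hdir.mono_set hOm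
  have hIp := hIm.mono_set hsub
  have h0 : ∀ x, 0 ≤ ‖gradient h x‖ ^ 2 := fun _ => by positivity
  have hfin : ∫⁻ z in {z | Rm < ‖z‖}, ENNReal.ofReal (‖FF h c z‖ ^ 2) ≠ ⊤ := by
    rw [lint_transfer, ← ofReal_integral_eq_lintegral_ofReal hIm (Eventually.of_forall h0)]
    exact ENNReal.ofReal_ne_top
  have hmain := ext_scale hm0 hdiff hmp.le hfin
  rw [lint_transfer, lint_transfer,
    ← ofReal_integral_eq_lintegral_ofReal hIm (Eventually.of_forall h0),
    ← ofReal_integral_eq_lintegral_ofReal hIp (Eventually.of_forall h0),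
    ← ENNReal.ofReal_mul (by positivity),
    ENNReal.ofReal_le_ofReal_iff (mul_nonneg (by positivity) (integral_nonneg h0))] at hmain
  have hl1 : (Rm / Rp) ^ 2 ≤ 1 := by
    apply pow_le_one₀ (by positivity)
    rw [div_le_one hp0]; exact hmp.le
  have hl0 : 0 ≤ (Rm / Rp) ^ 2 := by positivity
  set l := (Rm / Rp) ^ 2
  set g := fun x => ‖gradient h x‖ ^ 2 with hg
  have hIF : IntegrableOn g (𝒢 \ closure 𝒪) := hdir.mono_set (fun x hx => hx.2)
  have hX : ∫ x in (𝒢 \ closure 𝒪) \ closedBall c Rp, g x ≤ ∫ x in (closedBall c Rp)ᶜ, g x :=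
    setIntegral_mono_set hIp (Eventually.of_forall h0)
      (HasSubset.Subset.eventuallyLE (fun x hx => hx.2))
  have hsplit := integral_inter_add_diff (μ := volume) (f := g) (s := 𝒢 \ closure 𝒪)
    (t := closedBall c Rp) measurableSet_closedBall hIF
  have hsplit2 := integral_inter_add_diff (μ := volume) (f := g) (s := (closedBall c Rm)ᶜ)
    (t := closedBall c Rp) measurableSet_closedBall hIm
  have hset : (closedBall c Rm)ᶜ \ closedBall c Rp = (closedBall c Rp)ᶜ := by
    ext x; constructor
    · exact fun hx => hx.2
    · exact fun hx => ⟨hsub hx, hx⟩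
  rw [hset] at hsplit2
  have hY : ∫ x in (closedBall c Rm)ᶜ ∩ closedBall c Rp, g x ≤
      ∫ x in (𝒢 \ closure 𝒪) ∩ closedBall c Rp, g x :=
    setIntegral_mono_set (hIF.mono_set Set.inter_subset_left) (Eventually.of_forall h0)
      (HasSubset.Subset.eventuallyLE (fun x hx =>
        ⟨⟨hGi (closedBall_subset_closedBall hpi.le hx.2), hOm hx.1⟩, hx.2⟩))
  have hZ : ∫ x in ball c Rp \ closure 𝒪, g x = ∫ x in (𝒢 \ closure 𝒪) ∩ closedBall c Rp, g x := by
    apply setIntegral_congr_set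
    have h1 : (𝒢 \ closure 𝒪) ∩ closedBall c Rp = closedBall c Rp \ closure 𝒪 := by
      ext x; constructor
      · exact fun hx => ⟨hx.2, hx.1.2⟩
      · exact fun hx => ⟨⟨hGi (closedBall_subset_closedBall hpi.le hx.1), hx.2⟩, hx.1⟩
    rw [h1]
    have h2 : (ball c Rp : Set Pt) =ᵐ[volume] closedBall c Rp := by
      rw [← ball_union_sphere]
      exact (union_ae_eq_left_of_ae_eq_empty
        (ae_eq_empty.2 (Measure.addHaar_sphere volume c Rp))).symm
    exact h2.diff (ae_eq_refl _)
  change (∫ x in (𝒢 \ closure 𝒪) \ closedBall c Rp, g x) ≤ l * ∫ x in 𝒢 \ closure 𝒪, g x ∧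
    (1 - l) * (∫ x in 𝒢 \ closure 𝒪, g x) ≤ ∫ x in ball c Rp \ closure 𝒪, g x
  change (∫ x in (closedBall c Rp)ᶜ, g x) ≤ l * ∫ x in (closedBall c Rm)ᶜ, g x at hmain
  rw [hZ, ← hsplit]
  rw [← hsplit2] at hmain
  have e1 := mul_le_mul_of_nonneg_left hX (sub_nonneg.2 hl1)
  have e2 := mul_le_mul_of_nonneg_left hY hl0
  constructor <;> linarith
end
end
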